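/- arXiv:1903.02216 — 2 statements merged into one kernel-verified Lean document; each statement's English description precedes it below -/
import Mathlib

section
/- There exists a constant C > 0, depending only on β and N, such that for every n ≥ 1, sup_{z ∈ ℝ} |P_{n,β}(W_n/B ≤ z) − Φ(z)| ≤ C n^{−1/2}, where Φ is the standard normal distribution function. (Kolmogorov bound of the main theorem.) -/
open MeasureTheory Real RealInnerProductSpace

noncomputable section

def besselRatio (N : ℕ) (x : ℝ) : ℝ :=
  x / ((N : ℝ) - 1) *
      (∫ θ in (0:ℝ)..π, Real.exp (x * Real.cos θ) * Real.sin θ ^ N) /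
    ∫ θ in (0:ℝ)..π, Real.exp (x * Real.cos θ) * Real.sin θ ^ (N - 2)

/-- The unit sphere `S^{N-1}` in `ℝ^N`. -/
abbrev UnitSphere (N : ℕ) := Metric.sphere (0 : EuclideanSpace ℝ (Fin N)) 1

/-- The map on the unit sphere induced by a linear isometry of `ℝ^N`. -/
def sphereMap {N : ℕ}
    (e : EuclideanSpace ℝ (Fin N) ≃ₗᵢ[ℝ] EuclideanSpace ℝ (Fin N))
    (θ : UnitSphere N) : UnitSphere N :=
  ⟨e θ, by
    rw [mem_sphere_zero_iff_norm, e.norm_map]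
    exact mem_sphere_zero_iff_norm.mp θ.2⟩

/-- Total spin `S_n(σ) = ∑ i, σ_i`. -/
def totalSpin {N n : ℕ} (σ : Fin n → UnitSphere N) : EuclideanSpace ℝ (Fin N) :=
  ∑ i, (σ i : EuclideanSpace ℝ (Fin N))

/-- `W_n(σ) = √n (β²/(n²b²) |S_n(σ)|² - 1)`. -/
def Wspin (N n : ℕ) (β b : ℝ) (σ : Fin n → UnitSphere N) : ℝ :=
  Real.sqrt n * (β ^ 2 / ((n : ℝ) ^ 2 * b ^ 2) * ‖totalSpin σ‖ ^ 2 - 1)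

/-- The (unnormalized) Gibbs weight `exp((β/(2n)) ∑_i ∑_j ⟨σ_i, σ_j⟩)`. -/
def gibbsWeight (N n : ℕ) (β : ℝ) (σ : Fin n → UnitSphere N) : ℝ :=
  Real.exp (β / (2 * n) * ∑ i, ∑ j,
    ⟪(σ i : EuclideanSpace ℝ (Fin N)), (σ j : EuclideanSpace ℝ (Fin N))⟫)

/-- The Gibbs measure `P_{n,β}` on `(S^{N-1})^n`. -/
def gibbsMeasure (N n : ℕ) (β : ℝ) (μ : Measure (UnitSphere N))
    [IsProbabilityMeasure μ] : Measure (Fin n → UnitSphere N) :=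
  (Measure.pi fun _ : Fin n => μ).withDensity fun σ =>
    ENNReal.ofReal
      (gibbsWeight N n β σ / ∫ τ, gibbsWeight N n β τ ∂(Measure.pi fun _ : Fin n => μ))

end

noncomputable section

section

/-! ### Part 1: the Stein equation -/

/-- Unnormalised Gaussian distribution function. -/
def gG (w : ℝ) : ℝ := ∫ u in Set.Iic w, Real.exp (-(1/2) * u ^ 2)

/-- Standard normal distribution function. -/
def gPhi (w : ℝ) : ℝ := gG w / Real.sqrt (2 * π)

/-- Inverse Mills ratio type function. -/
def gA (w : ℝ) : ℝ := Real.exp (w ^ 2 / 2) * gG w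

lemma gauss_int : Integrable (fun u : ℝ => Real.exp (-(1/2) * u ^ 2)) :=
  integrable_exp_neg_mul_sq (by norm_num)

lemma gPhi_eq (z : ℝ) :
    ((ProbabilityTheory.gaussianReal 0 1) (Set.Iic z)).toReal = gPhi z := by
  rw [ProbabilityTheory.gaussianReal_apply_eq_integral 0 (by norm_num), ENNReal.toReal_ofReal]
  · unfold gPhi gG ProbabilityTheory.gaussianPDFReal
    rw [integral_const_mul, div_eq_inv_mul]
    congr 1
    · norm_num
    · apply integral_congr_ae
      filter_upwards with x
      congr 1
      norm_num
      ring
  · exact integral_nonneg fun x => ProbabilityTheory.gaussianPDFReal_nonneg _ _ _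

lemma gG_nonneg (w : ℝ) : 0 ≤ gG w := integral_nonneg fun x => (Real.exp_pos _).le

lemma gG_total : ∫ u : ℝ, Real.exp (-(1/2) * u ^ 2) = Real.sqrt (2 * π) := by
  rw [integral_gaussian]; congr 1; ring

lemma gG_add_neg (w : ℝ) : gG w + gG (-w) = Real.sqrt (2 * π) := by
  unfold gG
  have h := integral_comp_neg_Iic (-w) (fun u : ℝ => Real.exp (-(1/2) * u ^ 2))
  simp only [neg_sq, neg_neg] at h
  rw [h, ← gG_total]
  have := integral_add_compl (s := Set.Iic w) measurableSet_Iic gauss_int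
  rwa [Set.compl_Iic] at this

lemma sqrt2pi_pos : 0 < Real.sqrt (2 * π) := Real.sqrt_pos.mpr (by positivity)

lemma gPhi_add_neg (w : ℝ) : gPhi w + gPhi (-w) = 1 := by
  unfold gPhi
  rw [← add_div, gG_add_neg, div_self sqrt2pi_pos.ne']

lemma gPhi_nonneg (w : ℝ) : 0 ≤ gPhi w := div_nonneg (gG_nonneg w) sqrt2pi_pos.le

lemma gPhi_le_one (w : ℝ) : gPhi w ≤ 1 := by
  have := gPhi_add_neg w
  have := gPhi_nonneg (-w)
  linarith

lemma gG_mono : Monotone gG := by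
  intro x y hxy
  unfold gG
  exact setIntegral_mono_set gauss_int.integrableOn
    (Filter.Eventually.of_forall fun x => (Real.exp_pos _).le)
    (Set.Iic_subset_Iic.mpr hxy).eventuallyLE

lemma gPhi_mono : Monotone gPhi := by
  intro x y hxy
  unfold gPhi
  have := gG_mono hxy
  have := sqrt2pi_pos
  gcongr

lemma gG_hasDeriv (w : ℝ) : HasDerivAt gG (Real.exp (-(1/2) * w ^ 2)) w := by
  have h1 : gG = fun x => gG 0 + ∫ u in (0:ℝ)..x, Real.exp (-(1/2) * u ^ 2) := by
    funext x
    have := intervalIntegral.integral_Iic_sub_Iic (a := 0) (b := x)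
      (f := fun u : ℝ => Real.exp (-(1/2) * u ^ 2)) gauss_int.integrableOn gauss_int.integrableOn
    unfold gG
    rw [← this]; ring
  rw [h1]
  have hc : Continuous (fun u : ℝ => Real.exp (-(1/2) * u ^ 2)) := by fun_prop
  exact (intervalIntegral.integral_hasDerivAt_right (hc.intervalIntegrable _ _)
    hc.aestronglyMeasurable.stronglyMeasurableAtFilter hc.continuousAt).const_add _

lemma gA_hasDeriv (w : ℝ) : HasDerivAt gA (w * gA w + 1) w := by
  unfold gA
  have h1 : HasDerivAt (fun w : ℝ => Real.exp (w ^ 2 / 2)) (Real.exp (w ^ 2 / 2) * w) w := by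
    have := ((hasDerivAt_pow 2 w).div_const 2).exp
    convert this using 1
    norm_num
  refine (h1.mul (gG_hasDeriv w)).congr_deriv ?_
  rw [← Real.exp_add]
  have : w ^ 2 / 2 + -(1/2) * w ^ 2 = 0 := by ring
  rw [this, Real.exp_zero]; ring

lemma gA_nonneg (w : ℝ) : 0 ≤ gA w := mul_nonneg (Real.exp_pos _).le (gG_nonneg w)

lemma gA_mills (w : ℝ) : -w * gA w ≤ 1 := by
  by_cases hw : 0 ≤ w
  · have := mul_nonneg hw (gA_nonneg w)
    linarith
  push Not at hw
  have hd : ∀ x ∈ Set.Iio w, HasDerivAt (fun x : ℝ => Real.exp (-(1/2) * x ^ 2))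
      ((-x) * Real.exp (-(1/2) * x ^ 2)) x := by
    intro x _
    have := ((hasDerivAt_pow 2 x).const_mul (-(1/2))).exp
    convert this using 1
    norm_num
    ring
  have hi : Integrable (fun x : ℝ => (-x) * Real.exp (-(1/2) * x ^ 2)) := by
    have := (integrable_mul_exp_neg_mul_sq (b := 1/2) (by norm_num)).neg
    refine this.congr (Filter.Eventually.of_forall fun x => ?_)
    simp
  have hlim : Filter.Tendsto (fun x : ℝ => Real.exp (-(1/2) * x ^ 2)) Filter.atBot (nhds 0) := by
    apply Real.tendsto_exp_atBot.comp
    apply Filter.Tendsto.const_mul_atTop_of_neg (by norm_num)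
    have := (Filter.tendsto_pow_atTop (α := ℝ) two_ne_zero).comp Filter.tendsto_neg_atBot_atTop
    refine this.congr fun x => ?_
    simp
  have h := integral_Iic_of_hasDerivAt_of_tendsto (a := w)
    (by fun_prop : Continuous (fun x : ℝ => Real.exp (-(1/2) * x ^ 2))).continuousWithinAt hd
    hi.integrableOn hlim
  have h2 : -w * gG w ≤ Real.exp (-(1/2) * w ^ 2) := by
    rw [← sub_zero (Real.exp (-(1/2) * w ^ 2)), ← h]
    unfold gG
    rw [← integral_const_mul]
    refine setIntegral_mono_on (gauss_int.const_mul _).integrableOn hi.integrableOn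
      measurableSet_Iic ?_
    intro x hx
    have : x ≤ w := hx
    have := (Real.exp_pos (-(1/2) * x ^ 2)).le
    nlinarith
  unfold gA
  have : Real.exp (w ^ 2 / 2) * Real.exp (-(1/2) * w ^ 2) = 1 := by
    rw [← Real.exp_add]
    have : w ^ 2 / 2 + -(1/2) * w ^ 2 = 0 := by ring
    rw [this, Real.exp_zero]
  calc -w * (Real.exp (w ^ 2 / 2) * gG w) = Real.exp (w ^ 2 / 2) * (-w * gG w) := by ring
    _ ≤ Real.exp (w ^ 2 / 2) * Real.exp (-(1/2) * w ^ 2) := by gcongr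
    _ = 1 := this

/-- The universal constant in the bounds on the Stein solution. -/
def kS : ℝ := Real.exp 1 * Real.sqrt (2 * π) + 2

lemma kS_ge : 2 ≤ kS := by unfold kS; have := sqrt2pi_pos; have := Real.exp_pos 1; nlinarith [mul_pos this sqrt2pi_pos]

lemma gA_bound {w : ℝ} (hw : w ≤ 0) : gA w ≤ kS := by
  by_cases h1 : w ≤ -1
  · have := gA_mills w
    have := gA_nonneg w
    have := kS_ge
    nlinarith
  · push Not at h1
    have h2 : gG w ≤ Real.sqrt (2 * π) := by
      have := gG_add_neg w
      have := gG_nonneg (-w)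
      linarith
    have h3 : Real.exp (w ^ 2 / 2) ≤ Real.exp 1 := Real.exp_le_exp.mpr (by nlinarith)
    unfold gA kS
    have := mul_le_mul h3 h2 (gG_nonneg w) (Real.exp_pos 1).le
    linarith

/-- Lower branch of the Stein solution. -/
def gF (z w : ℝ) : ℝ := gA w * gPhi (-z)

lemma gF_nonneg (z w : ℝ) : 0 ≤ gF z w := mul_nonneg (gA_nonneg w) (gPhi_nonneg _)

lemma gF_le {z w : ℝ} (h : w ≤ z) : gF z w ≤ gA (-|w|) := by
  unfold gF
  rcases le_total w 0 with hw | hw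
  · rw [abs_of_nonpos hw, neg_neg]
    have := gPhi_le_one (-z)
    have := gA_nonneg w
    nlinarith
  · rw [abs_of_nonneg hw]
    have h1 : gPhi (-z) ≤ gPhi (-w) := gPhi_mono (by linarith)
    have h2 : gA w * gPhi (-w) = gPhi w * gA (-w) := by
      unfold gA gPhi
      rw [neg_sq]; ring
    calc gA w * gPhi (-z) ≤ gA w * gPhi (-w) := mul_le_mul_of_nonneg_left h1 (gA_nonneg w)
      _ = gPhi w * gA (-w) := h2
      _ ≤ 1 * gA (-w) := mul_le_mul_of_nonneg_right (gPhi_le_one w) (gA_nonneg _)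
      _ = _ := one_mul _

lemma gF_bound {z w : ℝ} (h : w ≤ z) : |gF z w| ≤ kS := by
  rw [abs_of_nonneg (gF_nonneg z w)]
  exact (gF_le h).trans (gA_bound (by simp))

lemma gF_mul_bound {z w : ℝ} (h : w ≤ z) : |w * gF z w| ≤ 1 := by
  rw [abs_mul, abs_of_nonneg (gF_nonneg z w)]
  have h1 := gA_mills (-|w|)
  rw [neg_neg] at h1
  exact (mul_le_mul_of_nonneg_left (gF_le h) (abs_nonneg w)).trans h1

lemma gF_hasDeriv (z w : ℝ) : HasDerivAt (gF z) (w * gF z w + gPhi (-z)) w := by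
  unfold gF
  refine ((gA_hasDeriv w).mul_const (gPhi (-z))).congr_deriv ?_
  ring

lemma gF_deriv_bound {z w : ℝ} (h : w ≤ z) : |w * gF z w + gPhi (-z)| ≤ kS := by
  have h1 := gF_mul_bound h
  have h2 := gPhi_le_one (-z)
  have h3 := gPhi_nonneg (-z)
  have := kS_ge
  rw [abs_le] at *
  constructor <;> linarith

lemma gF_lip {z w w' : ℝ} (h : w ≤ z) (h' : w' ≤ z) : |gF z w - gF z w'| ≤ kS * |w - w'| := by
  have := (convex_Iic z).norm_image_sub_le_of_norm_hasDerivWithin_le (f := gF z)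
    (f' := fun w => w * gF z w + gPhi (-z)) (C := kS)
    (fun x _ => (gF_hasDeriv z x).hasDerivWithinAt) (fun x hx => gF_deriv_bound hx)
    (x := w') (y := w) h' h
  simpa using this

lemma gF_taylor {z w w' : ℝ} (h : w ≤ z) (h' : w' ≤ z) :
    |gF z w - gF z w' - (w - w') * (w * gF z w + gPhi (-z))|
      ≤ kS * (1 + |w| + |w - w'|) * |w - w'| * |w - w'| := by
  set s := Set.uIcc w' w with hs
  have hsz : ∀ y ∈ s, y ≤ z := fun y hy => by
    rw [hs, Set.mem_uIcc] at hy
    rcases hy with hy | hy <;> linarith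
  have hsd : ∀ y ∈ s, |y - w| ≤ |w - w'| := fun y hy => by
    rw [hs, Set.mem_uIcc] at hy
    rcases hy with hy | hy
    · rw [abs_of_nonpos (by linarith), abs_of_nonneg (by linarith)]; linarith
    · rw [abs_of_nonneg (by linarith), abs_of_nonpos (by linarith)]; linarith
  have := (convex_uIcc w' w).norm_image_sub_le_of_norm_hasDerivWithin_le
    (f := fun y => gF z y - y * (w * gF z w + gPhi (-z)))
    (f' := fun y => (y * gF z y + gPhi (-z)) - 1 * (w * gF z w + gPhi (-z)))
    (C := kS * (1 + |w| + |w - w'|) * |w - w'|)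
    (fun x _ => ((gF_hasDeriv z x).sub ((hasDerivAt_id x).mul_const _)).hasDerivWithinAt)
    (fun y hy => ?_) (x := w') (y := w) Set.left_mem_uIcc Set.right_mem_uIcc
  · simp only [Real.norm_eq_abs] at this
    convert this using 2
    ring
  · rw [Real.norm_eq_abs]
    have e : (y * gF z y + gPhi (-z)) - 1 * (w * gF z w + gPhi (-z))
      = y * (gF z y - gF z w) + (y - w) * gF z w := by ring
    rw [e]
    have h1 := gF_lip (hsz y hy) h
    have h2 := gF_bound h
    have h3 := hsd y hy
    have h4 : |y| ≤ |w| + |w - w'| := by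
      have : |y| ≤ |w| + |y - w| := by
        have := abs_add_le w (y - w); simpa using this
      linarith
    have hk := kS_ge
    calc _ ≤ |y * (gF z y - gF z w)| + |(y - w) * gF z w| := abs_add_le _ _
      _ = |y| * |gF z y - gF z w| + |y - w| * |gF z w| := by rw [abs_mul, abs_mul]
      _ ≤ (|w| + |w - w'|) * (kS * |w - w'|) + |w - w'| * kS := by
        gcongr
        exact h1.trans (by gcongr)
      _ = _ := by ring

/-- The Stein solution. -/
def gf (z w : ℝ) : ℝ := if w ≤ z then gF z w else gF (-z) (-w)

/-- Its (left) derivative. -/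
def gf' (z w : ℝ) : ℝ := w * gf z w + (if w ≤ z then 1 else 0) - gPhi z

lemma gf_neg_branch {z w : ℝ} (h : z ≤ w) : gf z w = gF (-z) (-w) := by
  unfold gf
  split_ifs with h1
  · have : w = z := le_antisymm h1 h
    subst this
    unfold gF gA gPhi
    rw [neg_neg, neg_sq]; ring
  · rfl

lemma gf_bound (z w : ℝ) : |gf z w| ≤ kS := by
  rcases le_total w z with h | h
  · rw [gf, if_pos h]; exact gF_bound h
  · rw [gf_neg_branch h]; exact gF_bound (by linarith)

lemma gf_lip (z w w' : ℝ) : |gf z w - gf z w'| ≤ kS * |w - w'| := by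
  have key : ∀ u v : ℝ, u ≤ v → |gf z v - gf z u| ≤ kS * (v - u) := by
    intro u v huv
    have hlow : ∀ a c : ℝ, a ≤ c → c ≤ z → |gf z c - gf z a| ≤ kS * (c - a) := by
      intro a c hac hc
      rw [gf, gf, if_pos hc, if_pos (hac.trans hc)]
      have := gF_lip hc (hac.trans hc)
      rwa [abs_of_nonneg (by linarith : 0 ≤ c - a)] at this
    have hup : ∀ a c : ℝ, a ≤ c → z ≤ a → |gf z c - gf z a| ≤ kS * (c - a) := by
      intro a c hac ha
      rw [gf_neg_branch ha, gf_neg_branch (ha.trans hac)]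
      have := gF_lip (z := -z) (w := -c) (w' := -a) (by linarith) (by linarith)
      rwa [abs_of_nonpos (by linarith : -c - -a ≤ 0), show -(-c - -a) = c - a by ring] at this
    rcases le_total v z with h | h
    · exact hlow u v huv h
    · rcases le_total z u with h2 | h2
      · exact hup u v huv h2
      · have h3 := hlow u z h2 le_rfl
        have h4 := hup z v h le_rfl
        have := abs_add_le (gf z v - gf z z) (gf z z - gf z u)
        rw [sub_add_sub_cancel] at this
        linarith
  rcases le_total w w' with h | h
  · have := key w w' h
    rw [abs_sub_comm, abs_sub_comm w w', abs_of_nonneg (by linarith : 0 ≤ w' - w)]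
    exact this
  · have := key w' w h
    rw [abs_of_nonneg (by linarith : 0 ≤ w - w')]
    exact this

lemma gf_continuous (z : ℝ) : Continuous (gf z) := by
  have : LipschitzWith (Real.toNNReal kS) (gf z) := LipschitzWith.of_dist_le_mul fun x y => by
    rw [Real.dist_eq, Real.dist_eq, Real.coe_toNNReal _ (by linarith [kS_ge])]
    exact gf_lip z x y
  exact this.continuous

lemma gf'_low {z w : ℝ} (h : w ≤ z) : gf' z w = w * gF z w + gPhi (-z) := by
  rw [gf', gf, if_pos h, if_pos h]
  have := gPhi_add_neg z
  linarith

lemma gf'_up {z w : ℝ} (h : z < w) : gf' z w = -(-w * gF (-z) (-w) + gPhi (- -z)) := by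
  rw [gf', gf_neg_branch h.le, if_neg (not_le.mpr h), neg_neg]
  ring

lemma gf'_bound (z w : ℝ) : |gf' z w| ≤ kS := by
  rcases le_or_gt w z with h | h
  · rw [gf'_low h]; exact gF_deriv_bound h
  · rw [gf'_up h, abs_neg]; exact gF_deriv_bound (by linarith)

lemma gf'_meas (z : ℝ) : Measurable (gf' z) := by
  unfold gf'
  refine ((measurable_id.mul (gf_continuous z).measurable).add ?_).sub_const _
  exact Measurable.ite measurableSet_Iic measurable_const measurable_const

lemma gf_taylor (z w w' δ : ℝ) (hδ : |w - w'| ≤ δ) :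
    |gf z w - gf z w' - (w - w') * gf' z w|
      ≤ |w - w'| * (kS * (1 + |w| + δ) * δ + 2 * kS * (if |w - z| ≤ δ then 1 else 0)) := by
  have hk := kS_ge
  have hδ0 : 0 ≤ δ := (abs_nonneg _).trans hδ
  have hw0 := abs_nonneg w
  have hite : (0:ℝ) ≤ (if |w - z| ≤ δ then 1 else 0) := by split_ifs <;> norm_num
  have hT : kS * (1 + |w| + |w - w'|) * |w - w'| * |w - w'| ≤
      |w - w'| * (kS * (1 + |w| + δ) * δ + 2 * kS * (if |w - z| ≤ δ then 1 else 0)) := by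
    calc kS * (1 + |w| + |w - w'|) * |w - w'| * |w - w'|
        ≤ kS * (1 + |w| + δ) * δ * |w - w'| := by gcongr
      _ ≤ (kS * (1 + |w| + δ) * δ + 2 * kS * (if |w - z| ≤ δ then 1 else 0)) * |w - w'| := by
        gcongr
        have : 0 ≤ 2 * kS * (if |w - z| ≤ δ then (1:ℝ) else 0) := by positivity
        linarith
      _ = _ := by ring
  have hS : (|w - z| ≤ δ) → |gf z w - gf z w' - (w - w') * gf' z w| ≤
      |w - w'| * (kS * (1 + |w| + δ) * δ + 2 * kS * (if |w - z| ≤ δ then 1 else 0)) := by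
    intro h
    rw [if_pos h]
    have h1 := gf_lip z w w'
    have h2 := gf'_bound z w
    calc _ ≤ |gf z w - gf z w'| + |(w - w') * gf' z w| := abs_sub _ _
      _ ≤ kS * |w - w'| + |w - w'| * kS := by
        rw [abs_mul]
        gcongr
      _ = |w - w'| * (0 + 2 * kS * 1) := by ring
      _ ≤ _ := by gcongr; positivity
  rcases le_or_gt w z with h | h
  · rcases le_or_gt w' z with h' | h'
    · refine le_trans ?_ hT
      rw [gf'_low h, gf, gf, if_pos h, if_pos h']
      exact gF_taylor h h'
    · apply hS
      rw [abs_le] at *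
      constructor <;> linarith
  · rcases le_or_gt w' z with h' | h'
    · apply hS
      rw [abs_le] at *
      constructor <;> linarith
    · refine le_trans ?_ hT
      rw [gf'_up h, gf_neg_branch h.le, gf_neg_branch h'.le]
      have := gF_taylor (z := -z) (w := -w) (w' := -w') (by linarith) (by linarith)
      rw [abs_neg, show -w - -w' = -(w - w') by ring, abs_neg] at this
      rw [show gF (-z) (-w) - gF (-z) (-w') - (w - w') * -(-w * gF (-z) (-w) + gPhi (- -z)) =
        gF (-z) (-w) - gF (-z) (-w') - -(w - w') * (-w * gF (-z) (-w) + gPhi (- -z)) by ring]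
      exact this

end

section

set_option linter.unusedSectionVars false
set_option linter.unusedVariables false

/-! ### Part 2: Gibbs measures on product spaces and the Stein bound -/

section Gibbs

variable {S : Type} [MetricSpace S] [CompactSpace S] [MeasurableSpace S] [BorelSpace S]
  (μ : Measure S) [IsProbabilityMeasure μ] {n : ℕ}

lemma cont_integrable {X : Type} [MetricSpace X] [CompactSpace X] [MeasurableSpace X]
    [BorelSpace X] (ν : Measure X) [IsFiniteMeasure ν] {F : X → ℝ} (hF : Continuous F) :
    Integrable F ν :=
  hF.integrable_of_hasCompactSupport (HasCompactSupport.of_compactSpace F)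

lemma cont_upd (i : Fin n) :
    Continuous (fun p : (Fin n → S) × S => Function.update p.1 i p.2) :=
  continuous_fst.update i continuous_snd

lemma resample (i : Fin n) :
    MeasurePreserving (fun p : (Fin n → S) × S => Function.update p.1 i p.2)
      ((Measure.pi fun _ : Fin n => μ).prod μ) (Measure.pi fun _ : Fin n => μ) := by
  have hm : Measurable (fun p : (Fin n → S) × S => Function.update p.1 i p.2) :=
    (cont_upd i).measurable
  refine ⟨hm, (Measure.pi_eq fun A hA => ?_).symm⟩
  rw [Measure.map_apply hm (MeasurableSet.univ_pi hA)]
  have : (fun p : (Fin n → S) × S => Function.update p.1 i p.2) ⁻¹' (Set.univ.pi A)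
      = (Set.univ.pi (Function.update A i Set.univ)) ×ˢ (A i) := by
    ext p
    simp only [Set.mem_preimage, Set.mem_pi, Set.mem_univ, forall_true_left, Set.mem_prod]
    constructor
    · intro h
      refine ⟨fun j => ?_, by simpa using h i⟩
      by_cases hj : j = i
      · subst hj; simp
      · have := h j
        simpa [hj] using this
    · rintro ⟨h1, h2⟩ j
      by_cases hj : j = i
      · subst hj; simpa using h2
      · have := h1 j
        simpa [hj] using this
  rw [this, Measure.prod_prod, Measure.pi_pi]
  rw [← Finset.mul_prod_erase Finset.univ (fun j => μ (A j)) (Finset.mem_univ i),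
    ← Finset.mul_prod_erase Finset.univ (fun j => μ (Function.update A i Set.univ j))
      (Finset.mem_univ i)]
  have : ∏ j ∈ Finset.univ.erase i, μ (Function.update A i Set.univ j)
      = ∏ j ∈ Finset.univ.erase i, μ (A j) :=
    Finset.prod_congr rfl fun j hj => by
      rw [Function.update_of_ne (Finset.ne_of_mem_erase hj)]
  rw [this]
  simp [mul_comm]

lemma int_resample (i : Fin n) {F : (Fin n → S) → ℝ} (hF : Continuous F) :
    ∫ σ, F σ ∂(Measure.pi fun _ : Fin n => μ) =
      ∫ σ, ∫ t, F (Function.update σ i t) ∂μ ∂(Measure.pi fun _ : Fin n => μ) := by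
  have h := (resample μ i).map_eq
  rw [← h, integral_map (cont_upd i).measurable.aemeasurable
    hF.measurable.aestronglyMeasurable, h]
  exact integral_prod _ (cont_integrable _ (hF.comp (cont_upd i)))

/-- One-site conditional law. -/
def kLaw (H : (Fin n → S) → ℝ) (i : Fin n) (σ : Fin n → S) : Measure S :=
  μ.tilted fun t => H (Function.update σ i t)

/-- One-site conditional expectation. -/
def Kc (H : (Fin n → S) → ℝ) (i : Fin n) (F : (Fin n → S) → ℝ) (σ : Fin n → S) : ℝ :=
  ∫ t, F (Function.update σ i t) ∂(kLaw μ H i σ)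

/-- Gibbs measure. -/
def Pm (H : (Fin n → S) → ℝ) : Measure (Fin n → S) :=
  (Measure.pi fun _ : Fin n => μ).tilted H

variable {H : (Fin n → S) → ℝ}

lemma cont_slice (hH : Continuous H) {F : (Fin n → S) → ℝ} (hF : Continuous F) (i : Fin n) (σ : Fin n → S) :
    Continuous fun t => F (Function.update σ i t) :=
  hF.comp (continuous_const.update i continuous_id)

lemma Pm_prob (hH : Continuous H) : IsProbabilityMeasure (Pm μ H) :=
  isProbabilityMeasure_tilted (cont_integrable _ (Real.continuous_exp.comp hH))

lemma kLaw_prob (hH : Continuous H) (i : Fin n) (σ : Fin n → S) : IsProbabilityMeasure (kLaw μ H i σ) :=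
  isProbabilityMeasure_tilted
    (cont_integrable _ (Real.continuous_exp.comp (cont_slice hH hH i σ)))

lemma cont_par (hH : Continuous H) {F : (Fin n → S) → ℝ} (hF : Continuous F) (i : Fin n) :
    Continuous fun σ => ∫ t, F (Function.update σ i t) ∂μ := by
  have := continuous_parametric_integral_of_continuous (μ := μ)
    (f := fun (σ : Fin n → S) (t : S) => F (Function.update σ i t))
    (hF.comp (cont_upd i)) (isCompact_univ (X := S))
  simpa using this

lemma Kc_eq (F : (Fin n → S) → ℝ) (i : Fin n) (σ : Fin n → S) :
    Kc μ H i F σ = (∫ t, Real.exp (H (Function.update σ i t)) * F (Function.update σ i t) ∂μ) /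
      ∫ t, Real.exp (H (Function.update σ i t)) ∂μ := by
  unfold Kc kLaw
  rw [integral_tilted, ← integral_div]
  congr 1
  funext t
  rw [smul_eq_mul]; ring

lemma cpos (hH : Continuous H) (i : Fin n) (σ : Fin n → S) :
    0 < ∫ t, Real.exp (H (Function.update σ i t)) ∂μ :=
  integral_exp_pos (cont_integrable _ (Real.continuous_exp.comp (cont_slice hH hH i σ)))

lemma Kc_cont (hH : Continuous H) {F : (Fin n → S) → ℝ} (hF : Continuous F) (i : Fin n) :
    Continuous (Kc μ H i F) := by
  have : Kc μ H i F = _ := funext fun σ => Kc_eq μ F i σ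
  rw [this]
  have h1 := cont_par μ hH ((Real.continuous_exp.comp hH).mul hF) i
  have h2 := cont_par μ hH (Real.continuous_exp.comp hH) i
  exact h1.div h2 fun σ => (cpos μ hH i σ).ne'

lemma Kc_inv (F : (Fin n → S) → ℝ) (i : Fin n) (σ : Fin n → S) (t : S) :
    Kc μ H i F (Function.update σ i t) = Kc μ H i F σ := by
  unfold Kc kLaw
  simp

lemma Pm_int (hH : Continuous H) (F : (Fin n → S) → ℝ) : ∫ σ, F σ ∂(Pm μ H) =
    (∫ σ, Real.exp (H σ) * F σ ∂(Measure.pi fun _ : Fin n => μ)) /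
      ∫ σ, Real.exp (H σ) ∂(Measure.pi fun _ : Fin n => μ) := by
  unfold Pm
  rw [integral_tilted, ← integral_div]
  congr 1
  funext t
  rw [smul_eq_mul]; ring

lemma Kc_pull_aux (hH : Continuous H) {F G : (Fin n → S) → ℝ} (hF : Continuous F) (hG : Continuous G) (i : Fin n)
    (hGi : ∀ σ t, G (Function.update σ i t) = G σ) :
    ∫ σ, Real.exp (H σ) * (F σ * G σ) ∂(Measure.pi fun _ : Fin n => μ) =
      ∫ σ, (∫ t, Real.exp (H (Function.update σ i t)) ∂μ) * (Kc μ H i F σ * G σ)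
        ∂(Measure.pi fun _ : Fin n => μ) := by
  rw [int_resample μ i (by fun_prop : Continuous fun σ => Real.exp (H σ) * (F σ * G σ))]
  congr 1
  funext σ
  simp only [hGi, ← mul_assoc]
  rw [integral_mul_const]
  congr 1
  rw [Kc_eq, mul_div_cancel₀ _ (cpos μ hH i σ).ne']

lemma Kc_pull (hH : Continuous H) {F G : (Fin n → S) → ℝ} (hF : Continuous F) (hG : Continuous G) (i : Fin n)
    (hGi : ∀ σ t, G (Function.update σ i t) = G σ) :
    ∫ σ, F σ * G σ ∂(Pm μ H) = ∫ σ, Kc μ H i F σ * G σ ∂(Pm μ H) := by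
  rw [Pm_int μ hH, Pm_int μ hH]
  congr 1
  rw [Kc_pull_aux μ hH hF hG i hGi, Kc_pull_aux μ hH (Kc_cont μ hH hF i) hG i hGi]
  congr 1
  funext σ
  congr 2
  have := kLaw_prob μ hH i σ
  show _ = ∫ t, Kc μ H i F (Function.update σ i t) ∂(kLaw μ H i σ)
  simp only [Kc_inv]
  simp

lemma Kc_sym (hH : Continuous H) {F G : (Fin n → S) → ℝ} (hF : Continuous F) (hG : Continuous G) (i : Fin n) :
    ∫ σ, F σ * Kc μ H i G σ ∂(Pm μ H) = ∫ σ, Kc μ H i F σ * G σ ∂(Pm μ H) := by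
  rw [Kc_pull μ hH hF (Kc_cont μ hH hG i) i (Kc_inv μ G i)]
  have := Kc_pull μ hH hG (Kc_cont μ hH hF i) i (Kc_inv μ F i)
  simp only [mul_comm (Kc μ H i F _)] at *
  rw [this]

lemma Kc_int (hH : Continuous H) {F : (Fin n → S) → ℝ} (hF : Continuous F) (i : Fin n) :
    ∫ σ, Kc μ H i F σ ∂(Pm μ H) = ∫ σ, F σ ∂(Pm μ H) := by
  have := Kc_pull μ hH hF (G := fun _ => 1) continuous_const i (fun _ _ => rfl)
  simpa using this.symm

/-- Total drift. -/
def dr (μ : Measure S) (H W : (Fin n → S) → ℝ) (σ : Fin n → S) : ℝ := ∑ i, (W σ - Kc μ H i W σ)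

/-- Total quadratic variation. -/
def qv (μ : Measure S) (H W : (Fin n → S) → ℝ) (σ : Fin n → S) : ℝ :=
  ∑ i, ∫ t, (W σ - W (Function.update σ i t)) ^ 2 ∂(kLaw μ H i σ)

lemma pair_eq (hH : Continuous H) {W : (Fin n → S) → ℝ} (hW : Continuous W) {f : ℝ → ℝ} (hf : Continuous f)
    (i : Fin n) (σ : Fin n → S) :
    ∫ t, (W σ - W (Function.update σ i t)) * (f (W σ) - f (W (Function.update σ i t)))
        ∂(kLaw μ H i σ)
      = W σ * f (W σ) - W σ * Kc μ H i (fun σ => f (W σ)) σ - Kc μ H i W σ * f (W σ)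
        + Kc μ H i (fun σ => W σ * f (W σ)) σ := by
  have := kLaw_prob μ hH i σ
  have hWs := cont_slice hH hW i σ
  have hfs := cont_slice hH (hf.comp hW) i σ
  simp only [Function.comp_apply] at hfs
  have e : ∀ t, (W σ - W (Function.update σ i t)) * (f (W σ) - f (W (Function.update σ i t)))
    = W σ * f (W σ) - W σ * f (W (Function.update σ i t)) - W (Function.update σ i t) * f (W σ)
      + W (Function.update σ i t) * f (W (Function.update σ i t)) := fun t => by ring
  simp only [e]
  rw [integral_add (cont_integrable _ (by fun_prop)) (cont_integrable _ (by fun_prop)),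
    integral_sub (cont_integrable _ (by fun_prop)) (cont_integrable _ (by fun_prop)),
    integral_sub (cont_integrable _ (by fun_prop)) (cont_integrable _ (by fun_prop)),
    integral_const_mul, integral_mul_const]
  simp [Kc, integral_const_mul, integral_mul_const]

lemma dr_cont (hH : Continuous H) {W : (Fin n → S) → ℝ} (hW : Continuous W) : Continuous (dr μ H W) := by
  unfold dr
  exact continuous_finsetSum _ fun i _ => hW.sub (Kc_cont μ hH hW i)

lemma pair_cont (hH : Continuous H) {W : (Fin n → S) → ℝ} (hW : Continuous W) {f : ℝ → ℝ} (hf : Continuous f)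
    (i : Fin n) : Continuous fun σ => ∫ t, (W σ - W (Function.update σ i t)) *
      (f (W σ) - f (W (Function.update σ i t))) ∂(kLaw μ H i σ) := by
  simp only [pair_eq μ hH hW hf i]
  have h1 := Kc_cont μ hH (hf.comp hW) i
  have h2 := Kc_cont μ hH hW i
  have h3 := Kc_cont μ hH (hW.mul (hf.comp hW)) i
  have h4 := hf.comp hW
  exact (((hW.mul h4).sub (hW.mul h1)).sub (h2.mul h4)).add h3

lemma qv_cont (hH : Continuous H) {W : (Fin n → S) → ℝ} (hW : Continuous W) : Continuous (qv μ H W) := by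
  unfold qv
  refine continuous_finsetSum _ fun i _ => ?_
  have := pair_cont μ hH hW continuous_id i
  simpa only [id, ← sq] using this

lemma stein_identity (hH : Continuous H) {W : (Fin n → S) → ℝ} (hW : Continuous W) {f : ℝ → ℝ} (hf : Continuous f) :
    2 * ∫ σ, dr μ H W σ * f (W σ) ∂(Pm μ H) = ∫ σ, ∑ i, ∫ t, (W σ - W (Function.update σ i t)) *
      (f (W σ) - f (W (Function.update σ i t))) ∂(kLaw μ H i σ) ∂(Pm μ H) := by
  have hP := Pm_prob μ hH
  have hfW : Continuous fun σ => f (W σ) := hf.comp hW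
  have hWfW : Continuous fun σ => W σ * f (W σ) := hW.mul hfW
  rw [integral_finsetSum _ fun i _ => cont_integrable _ (pair_cont μ hH hW hf i)]
  unfold dr
  simp only [Finset.sum_mul]
  have hcK : ∀ i, Continuous fun σ => (W σ - Kc μ H i W σ) * f (W σ) := fun i => by
    have := Kc_cont μ hH hW i
    fun_prop
  rw [integral_finsetSum _ fun i _ => cont_integrable _ (hcK i), Finset.mul_sum]
  refine Finset.sum_congr rfl fun i _ => ?_
  simp only [pair_eq μ hH hW hf i]
  have h1 := Kc_cont μ hH hfW i
  have h2 := Kc_cont μ hH hW i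
  have h3 := Kc_cont μ hH hWfW i
  rw [integral_add (cont_integrable _ (by fun_prop)) (cont_integrable _ h3),
    integral_sub (cont_integrable _ (by fun_prop)) (cont_integrable _ (by fun_prop)),
    integral_sub (cont_integrable _ (by fun_prop)) (cont_integrable _ (by fun_prop)),
    Kc_sym μ hH hW hfW i, Kc_int μ hH hWfW i]
  simp only [sub_mul]
  rw [integral_sub (cont_integrable _ (by fun_prop)) (cont_integrable _ (by fun_prop))]
  ring

/-- Concentration inequality. -/
lemma stein_conc (hH : Continuous H) {W : (Fin n → S) → ℝ} (hW : Continuous W) {δ : ℝ}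
    (hδ : ∀ i σ t, |W σ - W (Function.update σ i t)| ≤ δ) (hδ0 : 0 ≤ δ) (z : ℝ) :
    ∫ σ, qv μ H W σ * (if |W σ - z| ≤ δ then 1 else 0) ∂(Pm μ H) ≤
      4 * δ * ∫ σ, |dr μ H W σ| ∂(Pm μ H) := by
  have hP := Pm_prob μ hH
  set ψ : ℝ → ℝ := fun w => max (-(2 * δ)) (min (w - z) (2 * δ)) with hψ
  have hψc : Continuous ψ := by fun_prop
  have hψb : ∀ w, |ψ w| ≤ 2 * δ := fun w => by
    rw [abs_le]
    exact ⟨le_max_left _ _, max_le (by linarith) (min_le_right _ _)⟩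
  have hψm : Monotone ψ := fun x y h => by
    simp only [hψ]; gcongr
  have hpos : ∀ x y, 0 ≤ (x - y) * (ψ x - ψ y) := fun x y => by
    rcases le_total x y with h | h
    · exact mul_nonneg_of_nonpos_of_nonpos (by linarith) (by linarith [hψm h])
    · exact mul_nonneg (by linarith) (by linarith [hψm h])
  have hlin : ∀ w, |w - z| ≤ 2 * δ → ψ w = w - z := fun w hw => by
    rw [abs_le] at hw
    simp only [hψ]
    rw [min_eq_left hw.2, max_eq_right hw.1]
  have hid := stein_identity μ hH hW hψc
  have hle1 : ∫ σ, qv μ H W σ * (if |W σ - z| ≤ δ then 1 else 0) ∂(Pm μ H) ≤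
      ∫ σ, ∑ i, ∫ t, (W σ - W (Function.update σ i t)) *
      (ψ (W σ) - ψ (W (Function.update σ i t))) ∂(kLaw μ H i σ) ∂(Pm μ H) := by
    refine integral_mono ?_ ?_ ?_
    · refine (cont_integrable _ (qv_cont μ hH hW)).mul_bdd (c := 1) ?_ ?_
      · exact (Measurable.ite (measurableSet_le (by fun_prop) measurable_const) measurable_const
          measurable_const).aestronglyMeasurable
      · refine Filter.Eventually.of_forall fun σ => ?_
        split_ifs <;> simp
    · exact cont_integrable _ (continuous_finsetSum _ fun i _ => pair_cont μ hH hW hψc i)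
    · intro σ
      simp only
      split_ifs with h
      · rw [mul_one]
        unfold qv
        refine (Finset.sum_congr rfl fun i _ => ?_).le
        congr 1
        funext t
        have h2 := hδ i σ t
        rw [hlin _ (by linarith), hlin (W (Function.update σ i t)) (by
          have := abs_sub_le (W (Function.update σ i t)) (W σ) z
          rw [abs_sub_comm (W (Function.update σ i t)) (W σ)] at this
          linarith)]
        ring
      · rw [mul_zero]
        exact Finset.sum_nonneg fun i _ => integral_nonneg fun t => hpos _ _
  rw [← hid] at hle1
  refine hle1.trans ?_
  have hDc := dr_cont μ hH hW
  have : ∫ σ, dr μ H W σ * ψ (W σ) ∂(Pm μ H) ≤ ∫ σ, |dr μ H W σ| * (2 * δ) ∂(Pm μ H) := by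
    refine integral_mono (cont_integrable _ (by fun_prop)) (cont_integrable _ (by fun_prop)) ?_
    intro σ
    refine (le_abs_self _).trans ?_
    simp only [abs_mul]
    exact mul_le_mul_of_nonneg_left (hψb _) (abs_nonneg _)
  rw [integral_mul_const] at this
  linarith

/-- Stein bound for the Kolmogorov distance. -/
lemma stein_bound (hH : Continuous H) {W : (Fin n → S) → ℝ} (hW : Continuous W) {δ κ : ℝ} (hκ : 0 < κ)
    (hδ : ∀ i σ t, |W σ - W (Function.update σ i t)| ≤ δ) (hδ0 : 0 ≤ δ) {M : ℝ}
    (hM : ∀ σ, qv μ H W σ ≤ M) (z : ℝ) :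
    |((Pm μ H) {σ | W σ ≤ z}).toReal - gPhi z| ≤
      kS * ∫ σ, |1 - qv μ H W σ / (2 * κ)| ∂(Pm μ H)
      + kS / κ * ∫ σ, |dr μ H W σ - κ * W σ| ∂(Pm μ H)
      + (kS * δ * M / (2 * κ)) * (1 + δ + ∫ σ, |W σ| ∂(Pm μ H))
      + (4 * kS * δ / κ) * ∫ σ, |dr μ H W σ| ∂(Pm μ H) := by
  have hP := Pm_prob μ hH
  have hk := kS_ge
  have hDc := dr_cont μ hH hW
  have hVc := qv_cont μ hH hW
  have hfc := gf_continuous z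
  have hWm := hW.measurable
  have hf'i : Integrable (fun σ => gf' z (W σ)) (Pm μ H) := by
    refine Integrable.of_bound ((gf'_meas z).comp hWm).aestronglyMeasurable kS
      (Filter.Eventually.of_forall fun σ => gf'_bound z _)
  have hVf'i : Integrable (fun σ => qv μ H W σ * gf' z (W σ)) (Pm μ H) :=
    (cont_integrable _ hVc).mul_bdd (c := kS) ((gf'_meas z).comp hWm).aestronglyMeasurable
      (Filter.Eventually.of_forall fun σ => gf'_bound z _)
  have hitem : Measurable (fun σ => if |W σ - z| ≤ δ then (1:ℝ) else 0) :=
    Measurable.ite (measurableSet_le (by fun_prop) measurable_const) measurable_const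
      measurable_const
  have hVitei : Integrable (fun σ => qv μ H W σ * (if |W σ - z| ≤ δ then 1 else 0)) (Pm μ H) := by
    refine (cont_integrable _ hVc).mul_bdd (c := 1) hitem.aestronglyMeasurable ?_
    refine Filter.Eventually.of_forall fun σ => ?_
    split_ifs <;> simp
  have hset : MeasurableSet {σ | W σ ≤ z} := measurableSet_le hWm measurable_const
  -- Stein equation
  have hA : ((Pm μ H) {σ | W σ ≤ z}).toReal - gPhi z =
      ∫ σ, gf' z (W σ) ∂(Pm μ H) - ∫ σ, W σ * gf z (W σ) ∂(Pm μ H) := by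
    rw [← integral_sub hf'i (cont_integrable _ (by fun_prop))]
    have e : ∀ σ, gf' z (W σ) - W σ * gf z (W σ) =
      Set.indicator {σ | W σ ≤ z} (fun _ => (1:ℝ)) σ - gPhi z := by
      intro σ
      simp only [gf', Set.indicator_apply, Set.mem_ofPred_eq]
      ring
    simp only [e]
    rw [integral_sub ((integrable_const _).indicator hset) (integrable_const _),
      integral_indicator hset]
    simp [Measure.real]
  -- exchangeable pair identity
  have hB := stein_identity μ hH hW hfc
  set PI : (Fin n → S) → ℝ := fun σ => ∑ i, ∫ t, (W σ - W (Function.update σ i t)) *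
      (gf z (W σ) - gf z (W (Function.update σ i t))) ∂(kLaw μ H i σ) with hPI
  have hPIc : Continuous PI := continuous_finsetSum _ fun i _ => pair_cont μ hH hW hfc i
  have herr : ∀ σ, |PI σ - qv μ H W σ * gf' z (W σ)| ≤
      qv μ H W σ * (kS * (1 + |W σ| + δ) * δ + 2 * kS * (if |W σ - z| ≤ δ then 1 else 0)) := by
    intro σ
    simp only [hPI, qv]
    rw [Finset.sum_mul, Finset.sum_mul, ← Finset.sum_sub_distrib]
    refine (Finset.abs_sum_le_sum_abs _ _).trans (Finset.sum_le_sum fun i _ => ?_)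
    have := kLaw_prob μ hH i σ
    have hWs := cont_slice hH hW i σ
    rw [← integral_mul_const, ← integral_mul_const,
      ← integral_sub (cont_integrable _ (by fun_prop)) (cont_integrable _ (by fun_prop))]
    refine (abs_integral_le_integral_abs).trans
      (integral_mono (cont_integrable _ (by fun_prop)) (cont_integrable _ (by fun_prop)) ?_)
    intro t
    simp only
    have h1 := gf_taylor z (W σ) (W (Function.update σ i t)) δ (hδ i σ t)
    have h2 : (W σ - W (Function.update σ i t)) * (gf z (W σ) - gf z (W (Function.update σ i t)))
        - (W σ - W (Function.update σ i t)) ^ 2 * gf' z (W σ)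
        = (W σ - W (Function.update σ i t)) * (gf z (W σ) - gf z (W (Function.update σ i t))
        - (W σ - W (Function.update σ i t)) * gf' z (W σ)) := by ring
    rw [h2, abs_mul, ← sq_abs, sq, mul_assoc |W σ - W (Function.update σ i t)|]
    exact mul_le_mul_of_nonneg_left h1 (abs_nonneg _)
  have hVnn : ∀ σ, 0 ≤ qv μ H W σ := fun σ =>
    Finset.sum_nonneg fun i _ => integral_nonneg fun t => sq_nonneg _
  have hE : |∫ σ, PI σ ∂(Pm μ H) - ∫ σ, qv μ H W σ * gf' z (W σ) ∂(Pm μ H)| ≤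
      kS * δ * M * (1 + δ + ∫ σ, |W σ| ∂(Pm μ H))
        + 2 * kS * (4 * δ * ∫ σ, |dr μ H W σ| ∂(Pm μ H)) := by
    rw [← integral_sub (cont_integrable _ hPIc) hVf'i]
    refine (abs_integral_le_integral_abs).trans ?_
    have hi2 : Integrable (fun σ => kS * δ * M * (1 + δ + |W σ|)) (Pm μ H) :=
      cont_integrable _ (by fun_prop)
    have hi3 : Integrable (fun σ => 2 * kS * (qv μ H W σ * (if |W σ - z| ≤ δ then 1 else 0)))
      (Pm μ H) := hVitei.const_mul _
    calc ∫ σ, |PI σ - qv μ H W σ * gf' z (W σ)| ∂(Pm μ H)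
        ≤ ∫ σ, (kS * δ * M * (1 + δ + |W σ|) +
          2 * kS * (qv μ H W σ * (if |W σ - z| ≤ δ then 1 else 0))) ∂(Pm μ H) := by
          refine integral_mono ((cont_integrable _ hPIc).sub hVf'i).abs (hi2.add hi3) ?_
          intro σ
          simp only
          refine (herr σ).trans ?_
          have : qv μ H W σ * (kS * (1 + |W σ| + δ) * δ) ≤ M * (kS * (1 + |W σ| + δ) * δ) :=
            mul_le_mul_of_nonneg_right (hM σ) (by positivity)
          rw [mul_add]
          linarith
      _ ≤ _ := by
          rw [integral_add hi2 hi3, integral_const_mul, integral_const_mul,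
            integral_add (integrable_const _) (cont_integrable _ (by fun_prop))]
          have := stein_conc μ hH hW hδ hδ0 z
          have h0 : ∫ _ : Fin n → S, (1 + δ) ∂(Pm μ H) = 1 + δ := by simp
          rw [h0]
          gcongr
  -- remainder of drift
  have hR : |∫ σ, (dr μ H W σ - κ * W σ) * gf z (W σ) ∂(Pm μ H)| ≤
      kS * ∫ σ, |dr μ H W σ - κ * W σ| ∂(Pm μ H) := by
    refine (abs_integral_le_integral_abs).trans ?_
    rw [← integral_const_mul]
    refine integral_mono (cont_integrable _ (by fun_prop)) (cont_integrable _ (by fun_prop)) ?_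
    intro σ
    simp only [abs_mul]
    rw [mul_comm]
    exact mul_le_mul_of_nonneg_right (gf_bound _ _) (abs_nonneg _)
  have hQi : Integrable (fun σ => (1 - qv μ H W σ / (2 * κ)) * gf' z (W σ)) (Pm μ H) :=
    (cont_integrable _ (by fun_prop : Continuous fun σ => 1 - qv μ H W σ / (2 * κ))).mul_bdd
      (c := kS) ((gf'_meas z).comp hWm).aestronglyMeasurable
      (Filter.Eventually.of_forall fun σ => gf'_bound z _)
  have hQ : |∫ σ, (1 - qv μ H W σ / (2 * κ)) * gf' z (W σ) ∂(Pm μ H)| ≤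
      kS * ∫ σ, |1 - qv μ H W σ / (2 * κ)| ∂(Pm μ H) := by
    refine (abs_integral_le_integral_abs).trans ?_
    rw [← integral_const_mul]
    refine integral_mono hQi.abs (cont_integrable _ (by fun_prop)) ?_
    intro σ
    simp only [abs_mul]
    rw [mul_comm]
    exact mul_le_mul_of_nonneg_right (gf'_bound _ _) (abs_nonneg _)
  have hQe : ∫ σ, (1 - qv μ H W σ / (2 * κ)) * gf' z (W σ) ∂(Pm μ H) =
      ∫ σ, gf' z (W σ) ∂(Pm μ H) - (∫ σ, qv μ H W σ * gf' z (W σ) ∂(Pm μ H)) / (2 * κ) := by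
    rw [← integral_div, ← integral_sub hf'i (hVf'i.div_const _)]
    congr 1; funext σ; ring
  have hRe : ∫ σ, (dr μ H W σ - κ * W σ) * gf z (W σ) ∂(Pm μ H) =
      ∫ σ, dr μ H W σ * gf z (W σ) ∂(Pm μ H) - κ * ∫ σ, W σ * gf z (W σ) ∂(Pm μ H) := by
    rw [← integral_const_mul, ← integral_sub (cont_integrable _ (by fun_prop))
      (cont_integrable _ (by fun_prop))]
    congr 1; funext σ; ring
  set a1 := ∫ σ, gf' z (W σ) ∂(Pm μ H)
  set a2 := ∫ σ, W σ * gf z (W σ) ∂(Pm μ H)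
  set a3 := ∫ σ, qv μ H W σ * gf' z (W σ) ∂(Pm μ H)
  set a4 := ∫ σ, dr μ H W σ * gf z (W σ) ∂(Pm μ H)
  set a5 := ∫ σ, PI σ ∂(Pm μ H)
  rw [hA]
  have hfin : a1 - a2 = (a1 - a3 / (2 * κ)) + (a4 - κ * a2) / κ - (a5 - a3) / (2 * κ) := by
    have : a5 = 2 * a4 := hB.symm
    rw [this]
    field_simp
    ring
  rw [hfin]
  rw [hQe] at hQ
  rw [hRe] at hR
  have t1 : |(a4 - κ * a2) / κ| ≤ (kS * ∫ σ, |dr μ H W σ - κ * W σ| ∂(Pm μ H)) / κ := by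
    rw [abs_div, abs_of_pos hκ]; gcongr
  have t2 : |(a5 - a3) / (2 * κ)| ≤ (kS * δ * M * (1 + δ + ∫ σ, |W σ| ∂(Pm μ H))
        + 2 * kS * (4 * δ * ∫ σ, |dr μ H W σ| ∂(Pm μ H))) / (2 * κ) := by
    rw [abs_div, abs_of_pos (by linarith : 0 < 2 * κ)]; gcongr
  calc _ ≤ |a1 - a3 / (2 * κ)| + |(a4 - κ * a2) / κ| + |(a5 - a3) / (2 * κ)| :=
        (abs_sub _ _).trans (by gcongr; exact abs_add_le _ _)
    _ ≤ _ := add_le_add (add_le_add hQ t1) t2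
    _ = _ := by field_simp; ring

/-- Variance bound for sums of conditionally centred local functions. -/
lemma var_bound (hH : Continuous H) (c : Fin n → (Fin n → S) → ℝ) (hc : ∀ i, Continuous (c i)) {M L : ℝ}
    (hM : ∀ i σ, |c i σ| ≤ M) (hL0 : 0 ≤ L)
    (hL : ∀ i j, i ≠ j → ∀ σ s, |c j σ - c j (Function.update σ i s)| ≤ L / n)
    (hK : ∀ i σ, Kc μ H i (c i) σ = 0) (hn : 1 ≤ n) :
    ∫ σ, ((∑ i, c i σ) / n) ^ 2 ∂(Pm μ H) ≤ (M ^ 2 + M * L) / n := by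
  have hP := Pm_prob μ hH
  have hn' : (0:ℝ) < n := by exact_mod_cast hn
  obtain ⟨s0⟩ : Nonempty S := by
    by_contra h
    rw [not_nonempty_iff] at h
    have := measure_univ (μ := μ)
    simp [Set.eq_empty_of_isEmpty] at this
  have hcc : ∀ i j, Continuous fun σ => c i σ * c j σ := fun i j => (hc i).mul (hc j)
  have hM0 : 0 ≤ M := (abs_nonneg _).trans (hM ⟨0, hn⟩ (fun _ => s0))
  have hpair : ∀ i j, ∫ σ, c i σ * c j σ ∂(Pm μ H) ≤ (if i = j then M ^ 2 else 0) + M * L / n := by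
    intro i j
    split_ifs with hij
    · subst hij
      have : ∫ σ, c i σ * c i σ ∂(Pm μ H) ≤ ∫ _, M ^ 2 ∂(Pm μ H) := by
        refine integral_mono (cont_integrable _ ((hc i).mul (hc i))) (integrable_const _) ?_
        intro σ
        simp only
        rw [← sq, ← sq_abs]
        exact pow_le_pow_left₀ (abs_nonneg _) (hM i σ) 2
      have h2 : 0 ≤ M * L / n := by positivity
      simp only [integral_const, probReal_univ, one_smul] at this
      linarith
    · rw [zero_add]
      have hcj : Continuous fun σ => c j (Function.update σ i s0) :=
        (hc j).comp (continuous_id.update i continuous_const)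
      have h0 : ∫ σ, c i σ * c j (Function.update σ i s0) ∂(Pm μ H) = 0 := by
        rw [Kc_pull μ hH (hc i) hcj i (fun σ t => by simp)]
        simp [hK]
      have : ∫ σ, c i σ * c j σ ∂(Pm μ H) =
          ∫ σ, c i σ * (c j σ - c j (Function.update σ i s0)) ∂(Pm μ H) := by
        simp only [mul_sub]
        rw [integral_sub (cont_integrable _ (hcc i j))
          (cont_integrable _ (by fun_prop)), h0, sub_zero]
      rw [this]
      have : ∫ σ, c i σ * (c j σ - c j (Function.update σ i s0)) ∂(Pm μ H) ≤
          ∫ _, M * L / n ∂(Pm μ H) := by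
        refine integral_mono (cont_integrable _ ((hc i).mul ((hc j).sub hcj)))
          (integrable_const _) ?_
        intro σ
        refine (le_abs_self _).trans ?_
        simp only [abs_mul]
        rw [mul_div_assoc]
        exact mul_le_mul (hM i σ) (hL i j hij σ s0) (abs_nonneg _) hM0
      simpa using this
  have e : ∀ σ, ((∑ i, c i σ) / n) ^ 2 = (∑ i, ∑ j, c i σ * c j σ) / (n:ℝ) ^ 2 := fun σ => by
    rw [div_pow, sq (∑ i, c i σ), Finset.sum_mul_sum]
  simp only [e]
  rw [integral_div, integral_finsetSum _ fun i _ => cont_integrable _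
    (continuous_finsetSum _ fun j _ => hcc i j)]
  have : ∑ i, ∫ σ, ∑ j, c i σ * c j σ ∂(Pm μ H) ≤ n * (M ^ 2 + M * L) := by
    calc ∑ i, ∫ σ, ∑ j, c i σ * c j σ ∂(Pm μ H) ≤ ∑ _i : Fin n, (M ^ 2 + M * L) := by
          refine Finset.sum_le_sum fun i _ => ?_
          rw [integral_finsetSum _ fun j _ => cont_integrable _ (hcc i j)]
          refine (Finset.sum_le_sum fun j _ => hpair i j).trans ?_
          rw [Finset.sum_add_distrib]
          simp
          field_simp
          exact le_rfl
      _ = _ := by simp; ring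
  rw [div_le_div_iff₀ (by positivity) hn']
  calc _ ≤ (n * (M ^ 2 + M * L)) * n := by gcongr
    _ = _ := by ring

end Gibbs

end

section

/-! ### Part 3: analytic facts on solutions of the Bessel type equation -/

section BesselODE

/-- `L` with its first two derivatives solves `k L' = x (L - L'')` on `[0, ∞)` and is positive. -/
structure BesODE (k : ℕ) (L L1 L2 : ℝ → ℝ) : Prop where
  d0 : ∀ x, HasDerivAt L (L1 x) x
  d1 : ∀ x, HasDerivAt L1 (L2 x) x
  ode : ∀ x, 0 ≤ x → (k : ℝ) * L1 x = x * (L x - L2 x)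
  pos : ∀ x, 0 < L x

variable {k : ℕ} {L L1 L2 J J1 J2 : ℝ → ℝ}

lemma BesODE.c0 (h : BesODE k L L1 L2) : Continuous L :=
  continuous_iff_continuousAt.2 fun x => (h.d0 x).continuousAt

lemma BesODE.c1 (h : BesODE k L L1 L2) : Continuous L1 :=
  continuous_iff_continuousAt.2 fun x => (h.d1 x).continuousAt

lemma BesODE.wronsk (h : BesODE (k + 1) L L1 L2) (h' : BesODE (k + 1) J J1 J2) {x : ℝ}
    (hx : 0 < x) : L x * J1 x = L1 x * J x := by
  have hd : ∀ y, HasDerivAt (fun y => y ^ (k + 1) * (L y * J1 y - L1 y * J y))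
      ((((k + 1 : ℕ) : ℝ) * y ^ k) * (L y * J1 y - L1 y * J y) + y ^ (k + 1) *
        ((L1 y * J1 y + L y * J2 y) - (L2 y * J y + L1 y * J1 y))) y := fun y => by
    have h1 := hasDerivAt_pow (k + 1) y
    exact h1.mul (((h.d0 y).mul (h'.d1 y)).sub ((h.d1 y).mul (h'.d0 y)))
  have hz : ∀ y, 0 ≤ y → HasDerivAt (fun y => y ^ (k + 1) * (L y * J1 y - L1 y * J y)) 0 y :=
    fun y hy => by
    refine (hd y).congr_deriv ?_
    have e1 := h.ode y hy
    have e2 := h'.ode y hy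
    linear_combination y ^ k * L y * e2 - y ^ k * J y * e1
  have := constant_of_has_deriv_right_zero (a := 0) (b := x)
    (fun y hy => (hz y hy.1).continuousAt.continuousWithinAt)
    (fun y hy => (hz y hy.1).hasDerivWithinAt) x ⟨hx.le, le_rfl⟩
  simp only [ne_eq, Nat.add_eq_zero_iff, one_ne_zero, and_false, not_false_eq_true, zero_pow,
    zero_mul, mul_eq_zero, pow_eq_zero_iff, hx.ne', false_or] at this
  linarith

lemma BesODE.L1pos (h : BesODE (k + 1) L L1 L2) {x : ℝ} (hx : 0 < x) : 0 < L1 x := by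
  have hd : ∀ y, 0 ≤ y → HasDerivAt (fun y => y ^ (k + 1) * L1 y) (y ^ (k + 1) * L y) y :=
    fun y hy => by
    refine ((hasDerivAt_pow (k + 1) y).mul (h.d1 y)).congr_deriv ?_
    have := h.ode y hy
    simp only [Nat.add_sub_cancel]
    linear_combination y ^ k * this
  have hc := h.c1
  have hm : StrictMonoOn (fun y => y ^ (k + 1) * L1 y) (Set.Ici 0) := by
    refine strictMonoOn_of_deriv_pos (convex_Ici 0) (by fun_prop) fun y hy => ?_
    rw [interior_Ici, Set.mem_Ioi] at hy
    rw [(hd y hy.le).deriv]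
    exact mul_pos (pow_pos hy _) (h.pos y)
  have := hm (Set.mem_Ici.2 le_rfl) (Set.mem_Ici.2 hx.le) hx
  simp only [ne_eq, Nat.add_eq_zero_iff, one_ne_zero, and_false, not_false_eq_true, zero_pow,
    zero_mul] at this
  exact (pos_iff_pos_of_mul_pos this).1 (pow_pos hx _)

lemma BesODE.Zneg (h : BesODE (k + 1) L L1 L2) {x : ℝ} (hx : 0 < x) :
    x * L x ^ 2 - x * L1 x ^ 2 - ((k : ℝ) + 2) * (L x * L1 x) < 0 := by
  set Z : ℝ → ℝ := fun x => x * L x ^ 2 - x * L1 x ^ 2 - ((k : ℝ) + 2) * (L x * L1 x) with hZ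
  have hd : ∀ y, 0 ≤ y → HasDerivAt (fun y => y ^ (k + 1) * Z y)
      (-2 * y ^ (k + 1) * L1 y ^ 2) y := fun y hy => by
    have h0 := h.d0 y
    have h1 := h.d1 y
    have hZd : HasDerivAt Z ((1 * L y ^ 2 + y * (2 * L y * L1 y))
      - (1 * L1 y ^ 2 + y * (2 * L1 y * L2 y)) - ((k : ℝ) + 2) * (L1 y * L1 y + L y * L2 y)) y := by
      refine (((hasDerivAt_id y).mul ((h0.pow 2).congr_deriv ?_)).sub
        ((hasDerivAt_id y).mul ((h1.pow 2).congr_deriv ?_))).sub ((h0.mul h1).const_mul _) <;> simp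
    refine ((hasDerivAt_pow (k + 1) y).mul hZd).congr_deriv ?_
    have e := h.ode y hy
    simp only [Nat.add_sub_cancel, hZ]
    push_cast at e ⊢
    linear_combination y ^ k * (-((k:ℝ) + 2) * L y - 2 * y * L1 y) * e
  have hc0 := h.c0
  have hc1 := h.c1
  have hm : StrictAntiOn (fun y => y ^ (k + 1) * Z y) (Set.Ici 0) := by
    refine strictAntiOn_of_deriv_neg (convex_Ici 0) (by fun_prop) fun y hy => ?_
    rw [interior_Ici, Set.mem_Ioi] at hy
    rw [(hd y hy.le).deriv]
    have := h.L1pos hy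
    have : 0 < y ^ (k + 1) * L1 y ^ 2 := by positivity
    linarith
  have := hm (Set.mem_Ici.2 le_rfl) (Set.mem_Ici.2 hx.le) hx
  simp only [ne_eq, Nat.add_eq_zero_iff, one_ne_zero, and_false, not_false_eq_true, zero_pow,
    zero_mul] at this
  by_contra hcon
  have h2 : 0 ≤ Z x := not_lt.1 hcon
  have : 0 ≤ x ^ (k + 1) * Z x := by positivity
  linarith

lemma BesODE.fderiv (h : BesODE k L L1 L2) (x : ℝ) :
    HasDerivAt (fun x => L1 x / L x) (L2 x / L x - (L1 x / L x) ^ 2) x := by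
  refine ((h.d1 x).div (h.d0 x) (h.pos x).ne').congr_deriv ?_
  have := (h.pos x).ne'
  field_simp

lemma BesODE.fderiv_lt (h : BesODE (k + 1) L L1 L2) {x : ℝ} (hx : 0 < x) :
    x * (L2 x / L x - (L1 x / L x) ^ 2) < L1 x / L x := by
  have hp := h.pos x
  have hZ := h.Zneg hx
  have e := h.ode x hx.le
  have : x * (L2 x / L x - (L1 x / L x) ^ 2) - L1 x / L x =
      (x * L x ^ 2 - x * L1 x ^ 2 - ((k : ℝ) + 2) * (L x * L1 x)) / L x ^ 2 := by
    field_simp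
    push_cast at e
    linear_combination L x * e
  have h2 : (x * L x ^ 2 - x * L1 x ^ 2 - ((k : ℝ) + 2) * (L x * L1 x)) / L x ^ 2 < 0 :=
    div_neg_of_neg_of_pos hZ (by positivity)
  linarith

lemma BesODE.u_anti (h : BesODE (k + 1) L L1 L2) :
    StrictAntiOn (fun x => L1 x / L x / x) (Set.Ioi 0) := by
  have hd : ∀ x, 0 < x → HasDerivAt (fun x => L1 x / L x / x)
      (((L2 x / L x - (L1 x / L x) ^ 2) * x - L1 x / L x * 1) / x ^ 2) x := fun x hx =>
    (h.fderiv x).div (hasDerivAt_id x) hx.ne'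
  refine strictAntiOn_of_deriv_neg (convex_Ioi 0)
    (fun x hx => (hd x hx).continuousAt.continuousWithinAt) fun y hy => ?_
  rw [interior_Ioi, Set.mem_Ioi] at hy
  rw [(hd y hy).deriv]
  have := h.fderiv_lt hy
  exact div_neg_of_neg_of_pos (by linarith) (by positivity)

lemma BesODE.below (h : BesODE (k + 1) L L1 L2) {β b : ℝ} (hβ : 0 < β) (hb : 0 < b)
    (hfix : b = β * (L1 b / L b)) {x : ℝ} (hx : 0 < x) (hxb : x < b) : x < β * (L1 x / L x) := by
  have h1 := h.u_anti (Set.mem_Ioi.2 hx) (Set.mem_Ioi.2 hb) hxb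
  simp only at h1
  have h2 : L1 b / L b / b = 1 / β := by
    rw [div_eq_div_iff hb.ne' hβ.ne']; linarith
  rw [h2, div_lt_div_iff₀ hβ hx] at h1
  linarith

lemma BesODE.above (h : BesODE (k + 1) L L1 L2) {β b : ℝ} (hβ : 0 < β) (hb : 0 < b)
    (hfix : b = β * (L1 b / L b)) {x : ℝ} (hxb : b < x) : β * (L1 x / L x) < x := by
  have hx := hb.trans hxb
  have h1 := h.u_anti (Set.mem_Ioi.2 hb) (Set.mem_Ioi.2 hx) hxb
  simp only at h1
  have h2 : L1 b / L b / b = 1 / β := by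
    rw [div_eq_div_iff hb.ne' hβ.ne']; linarith
  rw [h2, div_lt_div_iff₀ hx hβ] at h1
  linarith

lemma BesODE.rate (h : BesODE (k + 1) L L1 L2) (h0 : L 0 = 1) {β b : ℝ} (hβ : 0 < β) (hb : 0 < b)
    (hfix : b = β * (L1 b / L b)) : 0 < Real.log (L b) - b ^ 2 / (2 * β) := by
  have hd : ∀ x, HasDerivAt (fun x => Real.log (L x) - x ^ 2 / (2 * β)) (L1 x / L x - x / β) x :=
    fun x => by
    refine (((h.d0 x).log (h.pos x).ne').sub ((hasDerivAt_pow 2 x).div_const _)).congr_deriv ?_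
    field_simp
    simp
    ring
  have hm : StrictMonoOn (fun x => Real.log (L x) - x ^ 2 / (2 * β)) (Set.Icc 0 b) := by
    refine strictMonoOn_of_deriv_pos (convex_Icc 0 b)
      (fun x _ => (hd x).continuousAt.continuousWithinAt) fun y hy => ?_
    rw [interior_Icc] at hy
    rw [(hd y).deriv]
    have := h.below hβ hb hfix hy.1 hy.2
    rw [sub_pos, div_lt_iff₀ hβ]
    linarith
  have := hm (Set.left_mem_Icc.2 hb.le) (Set.right_mem_Icc.2 hb.le) hb
  simpa [h0] using this

end BesselODE

/-- Quadratic Taylor bound at a double zero. -/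
lemma double_zero {p : ℝ → ℝ} (hp : ContDiff ℝ 2 p) {ρ : ℝ} (hρ : ρ ∈ Set.Icc (0:ℝ) 1)
    (h0 : p ρ = 0) (h1 : deriv p ρ = 0) :
    ∃ C, 0 ≤ C ∧ ∀ r ∈ Set.Icc (0:ℝ) 1, |p r| ≤ C * (r - ρ) ^ 2 := by
  have hd : ContDiff ℝ 1 (deriv p) := by
    have : ContDiff ℝ (1 + 1) p := by simpa [one_add_one_eq_two] using hp
    exact (contDiff_succ_iff_deriv.1 this).2.2
  obtain ⟨K, hK⟩ := hd.contDiffOn.exists_lipschitzOnWith (s := Set.Icc (0:ℝ) 1) one_ne_zero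
    (convex_Icc 0 1) isCompact_Icc
  refine ⟨K, K.2, fun r hr => ?_⟩
  have hsub : Set.uIcc ρ r ⊆ Set.Icc 0 1 := Set.uIcc_subset_Icc hρ hr
  have := Convex.norm_image_sub_le_of_norm_deriv_le (f := p) (s := Set.uIcc ρ r)
    (C := K * |r - ρ|) (fun x _ => (hp.differentiable (by norm_num)).differentiableAt)
    (fun x hx => by
      have h := hK.dist_le_mul x (hsub hx) ρ hρ
      rw [Real.dist_eq, h1, sub_zero, Real.dist_eq] at h
      refine h.trans (mul_le_mul_of_nonneg_left ?_ K.2)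
      exact Set.abs_sub_left_of_mem_uIcc hx)
    (convex_uIcc ρ r) Set.left_mem_uIcc Set.right_mem_uIcc
  rw [h0, sub_zero, Real.norm_eq_abs, Real.norm_eq_abs, mul_assoc, abs_mul_abs_self, ← sq] at this
  exact this

/-- Linear lower bound near a simple zero, on a compact interval. -/
lemma simple_zero {h : ℝ → ℝ} (hc : Continuous h) {ρ ε : ℝ}
    (hd : DifferentiableAt ℝ h ρ) (h0 : h ρ = 0) (h1 : deriv h ρ ≠ 0)
    (hne : ∀ r ∈ Set.Icc ε 1, r ≠ ρ → h r ≠ 0) :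
    ∃ c, 0 < c ∧ ∀ r ∈ Set.Icc ε 1, c * |r - ρ| ≤ |h r| := by
  have hcont : ContinuousOn (fun r => |dslope h ρ r|) (Set.Icc ε 1) := by
    have : Continuous (dslope h ρ) := by
      rw [← continuousOn_univ, continuousOn_dslope Filter.univ_mem]
      exact ⟨hc.continuousOn, hd⟩
    fun_prop
  have hpos : ∀ r ∈ Set.Icc ε 1, 0 < |dslope h ρ r| := fun r hr => by
    rw [abs_pos]
    by_cases hrρ : r = ρ
    · rw [hrρ, dslope_same]; exact h1
    · rw [dslope_of_ne _ hrρ, slope_def_field, h0, sub_zero]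
      exact div_ne_zero (hne r hr hrρ) (sub_ne_zero.2 hrρ)
  rcases (Set.Icc ε 1).eq_empty_or_nonempty with he | he
  · exact ⟨1, one_pos, fun r hr => by simp [he] at hr⟩
  obtain ⟨r0, hr0, hmin⟩ := isCompact_Icc.exists_isMinOn he hcont
  refine ⟨|dslope h ρ r0|, hpos r0 hr0, fun r hr => ?_⟩
  have h3 : |dslope h ρ r0| ≤ |dslope h ρ r| := hmin hr
  have e : h r = (r - ρ) * dslope h ρ r := by
    have := sub_smul_dslope h ρ r
    rw [h0, sub_zero, smul_eq_mul] at this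
    exact this.symm
  rw [e, abs_mul, mul_comm]
  exact mul_le_mul_of_nonneg_left h3 (abs_nonneg _)

end

section

/-! ### Part 4: moments, the sphere, and identification of `besselRatio` -/

section Moments

variable {X : Type} [MeasurableSpace X]

/-- Exponential moments. -/
def mom (ν : Measure X) (w c : X → ℝ) (k : ℕ) (x : ℝ) : ℝ :=
  ∫ s, w s * c s ^ k * Real.exp (x * c s) ∂ν

lemma mom_integrable (ν : Measure X) [IsFiniteMeasure ν] {w c : X → ℝ} (hw : Measurable w)
    (hc : Measurable c) (hc1 : ∀ s, |c s| ≤ 1) {K : ℝ} (hK : ∀ s, |w s| ≤ K) (k : ℕ) (x : ℝ) :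
    Integrable (fun s => w s * c s ^ k * Real.exp (x * c s)) ν := by
  refine Integrable.of_bound (by fun_prop) (K * 1 * Real.exp |x|)
    (Filter.Eventually.of_forall fun s => ?_)
  have hK0 := (abs_nonneg _).trans (hK s)
  rw [Real.norm_eq_abs, abs_mul, abs_mul, abs_pow, abs_of_pos (Real.exp_pos _)]
  gcongr
  · exact hK s
  · exact pow_le_one₀ (abs_nonneg _) (hc1 s)
  · calc x * c s ≤ |x * c s| := le_abs_self _
      _ ≤ |x| * 1 := by rw [abs_mul]; gcongr; exact hc1 s
      _ = |x| := mul_one _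

lemma mom_deriv (ν : Measure X) [IsFiniteMeasure ν] {w c : X → ℝ} (hw : Measurable w)
    (hc : Measurable c) (hc1 : ∀ s, |c s| ≤ 1) {K : ℝ} (hK : ∀ s, |w s| ≤ K) (k : ℕ) (x : ℝ) :
    HasDerivAt (mom ν w c k) (mom ν w c (k + 1) x) x := by
  refine (hasDerivAt_integral_of_dominated_loc_of_deriv_le (μ := ν)
    (F := fun x s => w s * c s ^ k * Real.exp (x * c s))
    (F' := fun x s => w s * c s ^ (k + 1) * Real.exp (x * c s))
    (bound := fun _ => K * 1 * Real.exp (|x| + 1))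
    (Metric.ball_mem_nhds x one_pos) ?_ (mom_integrable ν hw hc hc1 hK k x) ?_ ?_
    (integrable_const _) ?_).2
  · exact Filter.Eventually.of_forall fun y => (mom_integrable ν hw hc hc1 hK k y).1
  · exact (mom_integrable ν hw hc hc1 hK (k + 1) x).1
  · refine Filter.Eventually.of_forall fun s y hy => ?_
    have hK0 := (abs_nonneg _).trans (hK s)
    rw [Real.norm_eq_abs, abs_mul, abs_mul, abs_pow, abs_of_pos (Real.exp_pos _)]
    have hy' : |y| ≤ |x| + 1 := by
      rw [Metric.mem_ball, Real.dist_eq] at hy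
      have := abs_sub_abs_le_abs_sub y x
      linarith
    gcongr
    · exact hK s
    · exact pow_le_one₀ (abs_nonneg _) (hc1 s)
    · calc y * c s ≤ |y * c s| := le_abs_self _
        _ ≤ |y| * 1 := by rw [abs_mul]; gcongr; exact hc1 s
        _ ≤ |x| + 1 := by rw [mul_one]; exact hy'
  · refine Filter.Eventually.of_forall fun s y _ => ?_
    refine ((((hasDerivAt_id y).mul_const (c s)).exp).const_mul (w s * c s ^ k)).congr_deriv ?_
    simp only [id]; ring

lemma mom_contDiff (ν : Measure X) [IsFiniteMeasure ν] {w c : X → ℝ} (hw : Measurable w)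
    (hc : Measurable c) (hc1 : ∀ s, |c s| ≤ 1) {K : ℝ} (hK : ∀ s, |w s| ≤ K) (m : ℕ) :
    ∀ k, ContDiff ℝ m (mom ν w c k) := by
  induction m with
  | zero => exact fun k => contDiff_zero.2 (continuous_iff_continuousAt.2 fun x =>
      (mom_deriv ν hw hc hc1 hK k x).continuousAt)
  | succ m ih =>
    intro k
    push_cast
    rw [contDiff_succ_iff_deriv]
    refine ⟨fun x => (mom_deriv ν hw hc hc1 hK k x).differentiableAt, fun h => ?_, ?_⟩
    · simp at h
    · have : deriv (mom ν w c k) = mom ν w c (k + 1) :=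
        funext fun x => (mom_deriv ν hw hc hc1 hK k x).deriv
      rw [this]; exact ih _

end Moments

/-- The measure `dθ` on `(0, π]`. -/
def thetaM : Measure ℝ := volume.restrict (Set.Ioc 0 π)

instance : IsFiniteMeasure thetaM := by unfold thetaM; infer_instance

/-- Moments in the angular variable. -/
def Jm (K k : ℕ) (x : ℝ) : ℝ := mom thetaM (fun θ => Real.sin θ ^ K) Real.cos k x

lemma Jm_eq (K k : ℕ) (x : ℝ) : Jm K k x =
    ∫ θ in (0:ℝ)..π, Real.sin θ ^ K * Real.cos θ ^ k * Real.exp (x * Real.cos θ) := by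
  rw [intervalIntegral.integral_of_le Real.pi_pos.le]; rfl

lemma Jm_ode_aux (K : ℕ) (x : ℝ) : ((K + 1 : ℕ) : ℝ) * Jm K 1 x =
    x * ∫ θ in (0:ℝ)..π, Real.exp (x * Real.cos θ) * Real.sin θ ^ (K + 2) := by
  have h := intervalIntegral.integral_eq_sub_of_hasDerivAt (a := 0) (b := π)
    (f := fun θ => Real.exp (x * Real.cos θ) * Real.sin θ ^ (K + 1))
    (f' := fun θ => ((K + 1 : ℕ) : ℝ) *
        (Real.sin θ ^ K * Real.cos θ ^ 1 * Real.exp (x * Real.cos θ))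
      - x * (Real.exp (x * Real.cos θ) * Real.sin θ ^ (K + 2)))
    (fun θ _ => by
      refine ((((Real.hasDerivAt_cos θ).const_mul x).exp).mul
        ((Real.hasDerivAt_sin θ).pow (K + 1))).congr_deriv ?_
      simp only [Nat.add_sub_cancel, Pi.pow_apply]
      ring)
    (Continuous.intervalIntegrable (by fun_prop) _ _)
  rw [intervalIntegral.integral_sub (Continuous.intervalIntegrable (by fun_prop) _ _)
    (Continuous.intervalIntegrable (by fun_prop) _ _), intervalIntegral.integral_const_mul,
    intervalIntegral.integral_const_mul] at h
  rw [Jm_eq]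
  simp at h
  simp
  linarith

lemma Jm_sin (K : ℕ) (x : ℝ) :
    ∫ θ in (0:ℝ)..π, Real.exp (x * Real.cos θ) * Real.sin θ ^ (K + 2) = Jm K 0 x - Jm K 2 x := by
  rw [Jm_eq, Jm_eq, ← intervalIntegral.integral_sub
    (Continuous.intervalIntegrable (by fun_prop) _ _)
    (Continuous.intervalIntegrable (by fun_prop) _ _)]
  refine intervalIntegral.integral_congr fun θ _ => ?_
  have := Real.sin_sq_add_cos_sq θ
  linear_combination Real.exp (x * Real.cos θ) * Real.sin θ ^ K * this

lemma Jm_ODE (K : ℕ) : BesODE (K + 1) (Jm K 0) (Jm K 1) (Jm K 2) where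
  d0 x := mom_deriv thetaM (by fun_prop) (by fun_prop) Real.abs_cos_le_one (K := 1)
    (fun s => by rw [abs_pow]; exact pow_le_one₀ (abs_nonneg _) (Real.abs_sin_le_one s)) 0 x
  d1 x := mom_deriv thetaM (by fun_prop) (by fun_prop) Real.abs_cos_le_one (K := 1)
    (fun s => by rw [abs_pow]; exact pow_le_one₀ (abs_nonneg _) (Real.abs_sin_le_one s)) 1 x
  ode x _ := by rw [Jm_ode_aux, Jm_sin]
  pos x := by
    rw [Jm_eq]
    refine intervalIntegral.intervalIntegral_pos_of_pos_on
      (Continuous.intervalIntegrable (by fun_prop) _ _) (fun θ hθ => ?_) Real.pi_pos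
    have := Real.sin_pos_of_mem_Ioo hθ
    positivity

lemma besselRatio_eq_J (K : ℕ) (x : ℝ) : besselRatio (K + 2) x = Jm K 1 x / Jm K 0 x := by
  unfold besselRatio
  have e : ∫ θ in (0:ℝ)..π, Real.exp (x * Real.cos θ) * Real.sin θ ^ (K + 2 - 2) = Jm K 0 x := by
    rw [Jm_eq]
    refine intervalIntegral.integral_congr fun θ _ => ?_
    simp [mul_comm]
  rw [e]
  congr 1
  have h := Jm_ode_aux K x
  push_cast at h ⊢
  have h2 : ((K:ℝ) + 2 - 1) = K + 1 := by ring
  have h3 : ((K:ℝ) + 1) ≠ 0 := by positivity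
  rw [h2, div_mul_eq_mul_div, ← h]
  field_simp

section Sphere

variable {K : ℕ} (μ : Measure (UnitSphere (K + 2))) [IsProbabilityMeasure μ]

/-- Rotation invariance. -/
def RotInv (μ : Measure (UnitSphere (K + 2))) : Prop :=
  ∀ e : EuclideanSpace ℝ (Fin (K + 2)) ≃ₗᵢ[ℝ] EuclideanSpace ℝ (Fin (K + 2)),
      Measure.map (sphereMap e) μ = μ

/-- Coordinates on the sphere. -/
def crd (j : Fin (K + 2)) (s : UnitSphere (K + 2)) : ℝ := (s : EuclideanSpace ℝ (Fin (K + 2))) j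

lemma crd_cont (j : Fin (K + 2)) : Continuous (crd j) := by
  unfold crd; fun_prop

lemma sph_norm (s : UnitSphere (K + 2)) : ‖(s : EuclideanSpace ℝ (Fin (K + 2)))‖ = 1 :=
  mem_sphere_zero_iff_norm.mp s.2

lemma crd_le (j : Fin (K + 2)) (s : UnitSphere (K + 2)) : |crd j s| ≤ 1 := by
  have := PiLp.norm_apply_le (s : EuclideanSpace ℝ (Fin (K + 2))) j
  rw [sph_norm] at this
  exact this

lemma sphereMap_cont (e : EuclideanSpace ℝ (Fin (K + 2)) ≃ₗᵢ[ℝ] EuclideanSpace ℝ (Fin (K + 2))) :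
    Continuous (sphereMap e) :=
  Continuous.subtype_mk (e.continuous.comp continuous_subtype_val) _

lemma rot_int (hμ : RotInv μ) {F : ℝ → ℝ} (hF : Continuous F)
    {v w : EuclideanSpace ℝ (Fin (K + 2))} (h : ‖v‖ = ‖w‖) :
    ∫ s, F ⟪(s : EuclideanSpace ℝ (Fin (K + 2))), v⟫ ∂μ =
      ∫ s, F ⟪(s : EuclideanSpace ℝ (Fin (K + 2))), w⟫ ∂μ := by
  set e := Submodule.reflection (Submodule.span ℝ {v - w})ᗮ
  have hev : e v = w := Submodule.reflection_sub h
  have hc : Continuous fun s : UnitSphere (K + 2) =>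
      F ⟪(s : EuclideanSpace ℝ (Fin (K + 2))), w⟫ := by fun_prop
  conv_rhs => rw [← hμ e]
  rw [integral_map (sphereMap_cont e).measurable.aemeasurable
    hc.measurable.aestronglyMeasurable]
  congr 1
  funext s
  show _ = F ⟪e s, w⟫
  rw [← hev, e.inner_map_map]

/-- Moments of one coordinate. -/
def Lm (k : ℕ) (x : ℝ) : ℝ := mom μ (fun _ => 1) (crd 0) k x

lemma Lm_deriv (k : ℕ) (x : ℝ) : HasDerivAt (Lm μ k) (Lm μ (k + 1) x) x :=
  mom_deriv μ measurable_const (crd_cont 0).measurable (crd_le 0) (K := 1) (by simp) k x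

lemma Lm_contDiff (m k : ℕ) : ContDiff ℝ m (Lm μ k) :=
  mom_contDiff μ measurable_const (crd_cont 0).measurable (crd_le 0) (K := 1) (by simp) m k

lemma Lm_pos (x : ℝ) : 0 < Lm μ 0 x := by
  have : Lm μ 0 x = ∫ s, Real.exp (x * crd 0 s) ∂μ := by simp [Lm, mom]
  rw [this]
  refine integral_exp_pos ?_
  have := mom_integrable μ (measurable_const (a := (1:ℝ))) (crd_cont 0).measurable (crd_le 0)
    (K := 1) (by simp) 0 x
  simpa using this

lemma Lm_zero : Lm μ 0 0 = 1 := by simp [Lm, mom]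

/-- Moments in direction `v`. -/
lemma rot_mom (hμ : RotInv μ) (k : ℕ) (β : ℝ) (v : EuclideanSpace ℝ (Fin (K + 2))) :
    ∫ s, ⟪(s : EuclideanSpace ℝ (Fin (K + 2))), v⟫ ^ k *
      Real.exp (β * ⟪(s : EuclideanSpace ℝ (Fin (K + 2))), v⟫) ∂μ =
      ‖v‖ ^ k * Lm μ k (β * ‖v‖) := by
  have h := rot_int μ hμ (F := fun y => y ^ k * Real.exp (β * y)) (by fun_prop) (v := v)
    (w := EuclideanSpace.single 0 ‖v‖) (by simp)
  rw [h, Lm, mom, ← integral_const_mul]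
  congr 1
  funext s
  rw [EuclideanSpace.inner_single_right]
  simp only [conj_trivial, one_mul, crd]
  rw [mul_pow]
  ring_nf

lemma Lm_second (hμ : RotInv μ) {x : ℝ} (hx : 0 < x) {j : Fin (K + 2)} (hj : j ≠ 0) :
    ∫ s, crd j s ^ 2 * Real.exp (x * crd 0 s) ∂μ = Lm μ 1 x / x := by
  set w : UnitSphere (K + 2) → ℝ := fun s => Real.exp (x * crd 0 s) with hw
  have hc0 := crd_cont (K := K) 0
  have hwm : Measurable w := by
    have : Continuous w := by fun_prop
    exact this.measurable
  have hwb : ∀ s, |w s| ≤ Real.exp x := fun s => by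
    rw [hw, abs_of_pos (Real.exp_pos _)]
    refine Real.exp_le_exp.2 ?_
    have := (abs_le.1 (crd_le 0 s)).2
    nlinarith
  have hd := mom_deriv μ hwm (crd_cont j).measurable (crd_le j) hwb
  have hpos : ∀ t, 0 < Real.sqrt (x ^ 2 + t ^ 2) := fun t => Real.sqrt_pos.2 (by positivity)
  have h0 : mom μ w (crd j) 0 = fun t => Lm μ 0 (Real.sqrt (x ^ 2 + t ^ 2)) := by
    funext t
    have h := rot_mom μ hμ 0 1 (EuclideanSpace.single 0 x + EuclideanSpace.single j t)
    have hn : ‖(EuclideanSpace.single 0 x + EuclideanSpace.single j t :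
        EuclideanSpace ℝ (Fin (K + 2)))‖ = Real.sqrt (x ^ 2 + t ^ 2) := by
      rw [eq_comm, Real.sqrt_eq_iff_mul_self_eq (by positivity) (norm_nonneg _), ← sq,
        norm_add_sq_real]
      simp [EuclideanSpace.inner_single_left, hj.symm]
    rw [hn] at h
    simp only [pow_zero, one_mul] at h
    rw [← h]
    unfold mom
    congr 1
    funext s
    simp only [hw, pow_zero, mul_one, inner_add_right, EuclideanSpace.inner_single_right,
      conj_trivial, crd, Real.exp_add]
  have hsq : ∀ t, HasDerivAt (fun t => Real.sqrt (x ^ 2 + t ^ 2))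
      (t / Real.sqrt (x ^ 2 + t ^ 2)) t := fun t => by
    have h1 : HasDerivAt (fun t => x ^ 2 + t ^ 2) (2 * t) t := by
      simpa using (hasDerivAt_pow 2 t).const_add (x ^ 2)
    refine (h1.sqrt (by positivity)).congr_deriv ?_
    field_simp
  have h1 : mom μ w (crd j) 1 = fun t =>
      Lm μ 1 (Real.sqrt (x ^ 2 + t ^ 2)) * (t / Real.sqrt (x ^ 2 + t ^ 2)) := by
    funext t
    have e1 := hd 0 t
    rw [h0] at e1
    have e2 := (Lm_deriv μ 0 (Real.sqrt (x ^ 2 + t ^ 2))).comp t (hsq t)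
    exact e1.unique e2
  have hq0 : Real.sqrt (x ^ 2 + 0 ^ 2) = x := by
    rw [zero_pow two_ne_zero, add_zero, Real.sqrt_sq hx.le]
  have e1 := hd 1 0
  rw [h1] at e1
  have e2 := ((Lm_deriv μ 1 (Real.sqrt (x ^ 2 + 0 ^ 2))).comp 0 (hsq 0)).mul
    ((hasDerivAt_id (0:ℝ)).div (hsq 0) (hpos 0).ne')
  have e3 := e1.unique e2
  simp only [Function.comp, id, hq0] at e3
  have e4 : mom μ w (crd j) (1 + 1) 0 = ∫ s, crd j s ^ 2 * Real.exp (x * crd 0 s) ∂μ := by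
    unfold mom
    congr 1
    funext s
    simp [hw, mul_comm]
  rw [← e4, e3]
  field_simp
  simp
  ring

lemma Lm_ode_pos (hμ : RotInv μ) {x : ℝ} (hx : 0 < x) :
    ((K + 1 : ℕ) : ℝ) * Lm μ 1 x = x * (Lm μ 0 x - Lm μ 2 x) := by
  have hc := fun j => crd_cont (K := K) j
  have hs : ∀ s : UnitSphere (K + 2), ∑ j : Fin (K + 1), crd j.succ s ^ 2 = 1 - crd 0 s ^ 2 := by
    intro s
    have := EuclideanSpace.real_norm_sq_eq (s : EuclideanSpace ℝ (Fin (K + 2)))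
    rw [sph_norm, Fin.sum_univ_succ] at this
    simp only [crd]
    linarith
  have h1 : ∑ j : Fin (K + 1), ∫ s, crd j.succ s ^ 2 * Real.exp (x * crd 0 s) ∂μ
      = ((K + 1 : ℕ) : ℝ) * (Lm μ 1 x / x) := by
    rw [Finset.sum_congr rfl fun j _ => Lm_second μ hμ hx (Fin.succ_ne_zero j)]
    simp
  rw [← integral_finsetSum _ fun j _ => cont_integrable _ (by
    have := hc j.succ
    have := hc 0
    fun_prop)] at h1
  simp only [← Finset.sum_mul, hs, sub_mul, one_mul] at h1
  have h00 := hc 0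
  rw [integral_sub (cont_integrable _ (by fun_prop)) (cont_integrable _ (by fun_prop))] at h1
  have e0 : Lm μ 0 x = ∫ s, Real.exp (x * crd 0 s) ∂μ := by simp [Lm, mom]
  have e2 : Lm μ 2 x = ∫ s, crd 0 s ^ 2 * Real.exp (x * crd 0 s) ∂μ := by simp [Lm, mom]
  rw [e0, e2, h1]
  field_simp

lemma Lm_ODE (hμ : RotInv μ) : BesODE (K + 1) (Lm μ 0) (Lm μ 1) (Lm μ 2) where
  d0 := Lm_deriv μ 0
  d1 := Lm_deriv μ 1
  pos := Lm_pos μ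
  ode x hx := by
    have hcl : Set.Ici (0:ℝ) ⊆
        {x | ((K + 1 : ℕ) : ℝ) * Lm μ 1 x = x * (Lm μ 0 x - Lm μ 2 x)} := by
      rw [← closure_Ioi]
      have h0 := (Lm_contDiff μ 0 0).continuous
      have h1 := (Lm_contDiff μ 0 1).continuous
      have h2 := (Lm_contDiff μ 0 2).continuous
      exact closure_minimal (fun y hy => Lm_ode_pos μ hμ hy)
        (isClosed_eq (by fun_prop) (by fun_prop))
    exact hcl hx

lemma besselRatio_eq (hμ : RotInv μ) {x : ℝ} (hx : 0 < x) :
    besselRatio (K + 2) x = Lm μ 1 x / Lm μ 0 x := by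
  rw [besselRatio_eq_J, div_eq_div_iff ((Jm_ODE K).pos x).ne' (Lm_pos μ x).ne']
  have := (Lm_ODE μ hμ).wronsk (Jm_ODE K) hx
  linarith

lemma besselRatio_deriv (hμ : RotInv μ) {x : ℝ} (hx : 0 < x) :
    deriv (besselRatio (K + 2)) x = Lm μ 2 x / Lm μ 0 x - (Lm μ 1 x / Lm μ 0 x) ^ 2 := by
  have : besselRatio (K + 2) =ᶠ[nhds x] fun x => Lm μ 1 x / Lm μ 0 x := by
    filter_upwards [lt_mem_nhds hx] with y hy
    exact besselRatio_eq μ hμ hy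
  rw [this.deriv_eq, ((Lm_ODE μ hμ).fderiv x).deriv]

end Sphere

end

section

/-! ### Part 5: the mean-field model -/

section Model

variable {K : ℕ} {n : ℕ}

/-- Mean spin. -/
def mx (σ : Fin n → UnitSphere (K + 2)) : EuclideanSpace ℝ (Fin (K + 2)) :=
  ((n : ℝ)⁻¹) • ∑ j, (σ j : EuclideanSpace ℝ (Fin (K + 2)))

/-- Mean spin without site `i`. -/
def mi (i : Fin n) (σ : Fin n → UnitSphere (K + 2)) : EuclideanSpace ℝ (Fin (K + 2)) :=
  ((n : ℝ)⁻¹) • ∑ j ∈ Finset.univ.erase i, (σ j : EuclideanSpace ℝ (Fin (K + 2)))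

/-- Local field product. -/
def pf (i : Fin n) (σ : Fin n → UnitSphere (K + 2)) : ℝ :=
  ⟪(σ i : EuclideanSpace ℝ (Fin (K + 2))), mi i σ⟫

/-- Hamiltonian. -/
def Hs (β : ℝ) (σ : Fin n → UnitSphere (K + 2)) : ℝ :=
  β / (2 * n) * ∑ i, ∑ j, ⟪(σ i : EuclideanSpace ℝ (Fin (K + 2))),
    (σ j : EuclideanSpace ℝ (Fin (K + 2)))⟫

lemma mx_cont : Continuous (mx : (Fin n → UnitSphere (K + 2)) → _) := by
  unfold mx; fun_prop

lemma mi_cont (i : Fin n) : Continuous (mi i : (Fin n → UnitSphere (K + 2)) → _) := by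
  unfold mi; fun_prop

lemma pf_cont (i : Fin n) : Continuous (pf i : (Fin n → UnitSphere (K + 2)) → _) := by
  have := mi_cont (K := K) i
  unfold pf; fun_prop

lemma Hs_cont (β : ℝ) : Continuous (Hs β : (Fin n → UnitSphere (K + 2)) → _) := by
  unfold Hs; fun_prop

lemma mx_eq (i : Fin n) (σ : Fin n → UnitSphere (K + 2)) :
    mx σ = mi i σ + (n : ℝ)⁻¹ • (σ i : EuclideanSpace ℝ (Fin (K + 2))) := by
  unfold mx mi
  rw [← smul_add, Finset.sum_erase_add _ _ (Finset.mem_univ i)]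

lemma mi_upd (i : Fin n) (σ : Fin n → UnitSphere (K + 2)) (t : UnitSphere (K + 2)) :
    mi i (Function.update σ i t) = mi i σ := by
  unfold mi
  congr 1
  refine Finset.sum_congr rfl fun j hj => ?_
  rw [Function.update_of_ne (Finset.ne_of_mem_erase hj)]

lemma mx_upd (i : Fin n) (σ : Fin n → UnitSphere (K + 2)) (t : UnitSphere (K + 2)) :
    mx (Function.update σ i t) = mi i σ + (n : ℝ)⁻¹ • (t : EuclideanSpace ℝ (Fin (K + 2))) := by
  rw [mx_eq i, mi_upd]; simp

lemma pf_upd (i : Fin n) (σ : Fin n → UnitSphere (K + 2)) (t : UnitSphere (K + 2)) :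
    pf i (Function.update σ i t) = ⟪(t : EuclideanSpace ℝ (Fin (K + 2))), mi i σ⟫ := by
  unfold pf
  rw [mi_upd]; simp

lemma mx_sub_upd (i : Fin n) (σ : Fin n → UnitSphere (K + 2)) (t : UnitSphere (K + 2)) :
    ‖mx σ - mx (Function.update σ i t)‖ ≤ 2 / n := by
  rw [mx_upd, mx_eq i σ, add_sub_add_left_eq_sub, ← smul_sub, norm_smul]
  have h : ‖(σ i : EuclideanSpace ℝ (Fin (K + 2))) - t‖ ≤ 2 := by
    refine (norm_sub_le _ _).trans ?_
    rw [sph_norm, sph_norm]; norm_num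
  have : ‖(n:ℝ)⁻¹‖ = (n:ℝ)⁻¹ := by rw [Real.norm_eq_abs, abs_of_nonneg (by positivity)]
  rw [this, div_eq_inv_mul]
  gcongr

lemma mi_sub_upd {i j : Fin n} (hij : i ≠ j) (σ : Fin n → UnitSphere (K + 2))
    (t : UnitSphere (K + 2)) : ‖mi j σ - mi j (Function.update σ i t)‖ ≤ 2 / n := by
  have h1 := mx_eq j σ
  have h2 := mx_eq j (Function.update σ i t)
  rw [Function.update_of_ne hij.symm] at h2
  have : mi j σ - mi j (Function.update σ i t) = mx σ - mx (Function.update σ i t) := by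
    rw [h1, h2]; abel
  rw [this]
  exact mx_sub_upd i σ t

lemma mx_norm (hn : 1 ≤ n) (σ : Fin n → UnitSphere (K + 2)) : ‖mx σ‖ ≤ 1 := by
  have hn' : (0:ℝ) < n := by exact_mod_cast hn
  unfold mx
  rw [norm_smul, Real.norm_eq_abs, abs_of_nonneg (by positivity : (0:ℝ) ≤ (n:ℝ)⁻¹),
    inv_mul_le_iff₀ hn', mul_one]
  refine (norm_sum_le _ _).trans ?_
  simp

lemma mi_norm (hn : 1 ≤ n) (i : Fin n) (σ : Fin n → UnitSphere (K + 2)) : ‖mi i σ‖ ≤ 1 := by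
  have hn' : (0:ℝ) < n := by exact_mod_cast hn
  unfold mi
  rw [norm_smul, Real.norm_eq_abs, abs_of_nonneg (by positivity : (0:ℝ) ≤ (n:ℝ)⁻¹),
    inv_mul_le_iff₀ hn', mul_one]
  refine (norm_sum_le _ _).trans ?_
  simp

lemma mi_mem (hn : 1 ≤ n) (i : Fin n) (σ : Fin n → UnitSphere (K + 2)) :
    ‖mi i σ‖ ∈ Set.Icc (0:ℝ) 1 := ⟨norm_nonneg _, mi_norm hn i σ⟩

lemma mx_mem (hn : 1 ≤ n) (σ : Fin n → UnitSphere (K + 2)) :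
    ‖mx σ‖ ∈ Set.Icc (0:ℝ) 1 := ⟨norm_nonneg _, mx_norm hn σ⟩

lemma mi_mx (i : Fin n) (σ : Fin n → UnitSphere (K + 2)) : |‖mi i σ‖ - ‖mx σ‖| ≤ 1 / n := by
  refine (abs_norm_sub_norm_le _ _).trans ?_
  rw [mx_eq i σ, sub_add_cancel_left, norm_neg, norm_smul, sph_norm, Real.norm_eq_abs,
    abs_of_nonneg (by positivity : (0:ℝ) ≤ (n:ℝ)⁻¹)]
  simp

lemma inner_mi_le (hn : 1 ≤ n) (i : Fin n) (σ : Fin n → UnitSphere (K + 2))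
    (t : UnitSphere (K + 2)) :
    |⟪(t : EuclideanSpace ℝ (Fin (K + 2))), mi i σ⟫| ≤ 1 := by
  refine (abs_real_inner_le_norm _ _).trans ?_
  rw [sph_norm, one_mul]
  exact mi_norm hn i σ

lemma pf_le (hn : 1 ≤ n) (i : Fin n) (σ : Fin n → UnitSphere (K + 2)) : |pf i σ| ≤ 1 :=
  inner_mi_le hn i σ (σ i)

lemma pf_sub_upd {i j : Fin n} (hij : i ≠ j) (σ : Fin n → UnitSphere (K + 2))
    (t : UnitSphere (K + 2)) : |pf j σ - pf j (Function.update σ i t)| ≤ 2 / n := by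
  unfold pf
  rw [Function.update_of_ne hij.symm, ← inner_sub_right]
  refine (abs_real_inner_le_norm _ _).trans ?_
  rw [sph_norm, one_mul]
  exact mi_sub_upd hij σ t

lemma pf_sum (hn : 1 ≤ n) (σ : Fin n → UnitSphere (K + 2)) :
    (∑ i, pf i σ) / n = ‖mx σ‖ ^ 2 - 1 / n := by
  have hn' : (0:ℝ) < n := by exact_mod_cast hn
  have h : ∀ i, pf i σ = ⟪(σ i : EuclideanSpace ℝ (Fin (K + 2))), mx σ⟫ - 1 / n := fun i => by
    rw [mx_eq i σ, inner_add_right, real_inner_smul_right, real_inner_self_eq_norm_sq, sph_norm]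
    simp [pf]
  simp only [h]
  rw [Finset.sum_sub_distrib, ← sum_inner]
  have h2 : ∑ i, (σ i : EuclideanSpace ℝ (Fin (K + 2))) = (n:ℝ) • mx σ := by
    unfold mx; rw [smul_smul, mul_inv_cancel₀ hn'.ne', one_smul]
  rw [h2, real_inner_smul_left, real_inner_self_eq_norm_sq]
  simp
  field_simp

lemma Hs_eq (hn : 1 ≤ n) (β : ℝ) (σ : Fin n → UnitSphere (K + 2)) :
    Hs β σ = β * n / 2 * ‖mx σ‖ ^ 2 := by
  have hn' : (0:ℝ) < n := by exact_mod_cast hn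
  unfold Hs mx
  simp only [← inner_sum, ← sum_inner]
  rw [norm_smul, real_inner_self_eq_norm_sq, Real.norm_eq_abs,
    abs_of_nonneg (by positivity : (0:ℝ) ≤ (n:ℝ)⁻¹)]
  field_simp

lemma mx_upd_sq (hn : 1 ≤ n) (i : Fin n) (σ : Fin n → UnitSphere (K + 2))
    (t : UnitSphere (K + 2)) : ‖mx (Function.update σ i t)‖ ^ 2 =
      ‖mi i σ‖ ^ 2 + 1 / (n:ℝ) ^ 2 + 2 / n * ⟪(t : EuclideanSpace ℝ (Fin (K + 2))), mi i σ⟫ := by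
  have hn' : (0:ℝ) < n := by exact_mod_cast hn
  rw [mx_upd, norm_add_sq_real, norm_smul, sph_norm, real_inner_smul_right, Real.norm_eq_abs,
    abs_of_nonneg (by positivity : (0:ℝ) ≤ (n:ℝ)⁻¹), real_inner_comm]
  field_simp
  ring

variable (μ : Measure (UnitSphere (K + 2))) [IsProbabilityMeasure μ]

lemma kLaw_eq (hn : 1 ≤ n) (β : ℝ) (i : Fin n) (σ : Fin n → UnitSphere (K + 2))
    (φ : UnitSphere (K + 2) → ℝ) : ∫ t, φ t ∂(kLaw μ (Hs β) i σ) =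
      (∫ t, φ t * Real.exp (β * ⟪(t : EuclideanSpace ℝ (Fin (K + 2))), mi i σ⟫) ∂μ) /
        ∫ t, Real.exp (β * ⟪(t : EuclideanSpace ℝ (Fin (K + 2))), mi i σ⟫) ∂μ := by
  have hn' : (0:ℝ) < n := by exact_mod_cast hn
  set c := β * n / 2 * (‖mi i σ‖ ^ 2 + 1 / (n:ℝ) ^ 2)
  have hH : ∀ t, Hs β (Function.update σ i t) =
      c + β * ⟪(t : EuclideanSpace ℝ (Fin (K + 2))), mi i σ⟫ := fun t => by
    rw [Hs_eq hn, mx_upd_sq hn]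
    simp only [c]
    field_simp
  unfold kLaw
  simp only [hH]
  rw [integral_tilted]
  simp only [Real.exp_add, smul_eq_mul, integral_const_mul]
  rw [← integral_div]
  congr 1
  funext t
  have := Real.exp_ne_zero c
  field_simp

/-- Conditional moments of the local field. -/
def Rm (β : ℝ) (k : ℕ) (r : ℝ) : ℝ := r ^ k * Lm μ k (β * r) / Lm μ 0 (β * r)

lemma Rm_contDiff (β : ℝ) (m k : ℕ) : ContDiff ℝ m (Rm μ β k) := by
  unfold Rm
  have h1 : ContDiff ℝ m fun r => Lm μ k (β * r) :=
    (Lm_contDiff μ m k).comp (contDiff_const.mul contDiff_id)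
  have h2 : ContDiff ℝ m fun r => Lm μ 0 (β * r) :=
    (Lm_contDiff μ m 0).comp (contDiff_const.mul contDiff_id)
  exact ((contDiff_id.pow k).mul h1).div h2 fun r => (Lm_pos μ _).ne'

lemma Rm_lip (β : ℝ) (k : ℕ) : ∃ C, 0 ≤ C ∧ ∀ r ∈ Set.Icc (0:ℝ) 1, ∀ s ∈ Set.Icc (0:ℝ) 1,
    |Rm μ β k r - Rm μ β k s| ≤ C * |r - s| := by
  obtain ⟨C, hC⟩ := (Rm_contDiff μ β 1 k).contDiffOn.exists_lipschitzOnWith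
    (s := Set.Icc (0:ℝ) 1) (by simp) (convex_Icc 0 1) isCompact_Icc
  exact ⟨C, C.2, fun r hr s hs => hC.dist_le_mul r hr s hs⟩

variable {μ}

lemma kLaw_mom (hμ : RotInv μ) (hn : 1 ≤ n) (β : ℝ) (k : ℕ) (i : Fin n)
    (σ : Fin n → UnitSphere (K + 2)) :
    ∫ t : UnitSphere (K + 2), ⟪(t : EuclideanSpace ℝ (Fin (K + 2))), mi i σ⟫ ^ k
      ∂(kLaw μ (Hs β) i σ) = Rm μ β k ‖mi i σ‖ := by
  rw [kLaw_eq μ hn, rot_mom μ hμ]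
  have := rot_mom μ hμ 0 β (mi i σ)
  simp only [pow_zero, one_mul] at this
  rw [this]
  rfl

/-- Centred local functions. -/
def cf (μ : Measure (UnitSphere (K + 2))) (β : ℝ) (k : ℕ) (i : Fin n)
    (σ : Fin n → UnitSphere (K + 2)) : ℝ := pf i σ ^ k - Rm μ β k ‖mi i σ‖

lemma cf_cont (β : ℝ) (k : ℕ) (i : Fin n) :
    Continuous (cf μ β k i : (Fin n → UnitSphere (K + 2)) → ℝ) := by
  have h1 := (Rm_contDiff μ β 0 k).continuous
  have h2 := pf_cont (K := K) i
  have h3 := mi_cont (K := K) i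
  unfold cf; fun_prop

lemma cf_Kc (hμ : RotInv μ) (hn : 1 ≤ n) (β : ℝ) (k : ℕ) (i : Fin n)
    (σ : Fin n → UnitSphere (K + 2)) : Kc μ (Hs β) i (cf μ β k i) σ = 0 := by
  have := kLaw_prob μ (Hs_cont β) i σ
  unfold Kc cf
  simp only [pf_upd, mi_upd]
  rw [integral_sub (cont_integrable _ (by fun_prop)) (integrable_const _), kLaw_mom hμ hn]
  simp

lemma cf_var (hμ : RotInv μ) (β : ℝ) {k : ℕ} (hk : k = 1 ∨ k = 2) {C : ℝ} (hC : 0 ≤ C)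
    (hlip : ∀ r ∈ Set.Icc (0:ℝ) 1, ∀ s ∈ Set.Icc (0:ℝ) 1,
      |Rm μ β k r - Rm μ β k s| ≤ C * |r - s|) (hn : 1 ≤ n) :
    ∫ σ : Fin n → UnitSphere (K + 2), ((∑ i, cf μ β k i σ) / n) ^ 2 ∂(Pm μ (Hs β)) ≤
      ((1 + C) ^ 2 + (1 + C) * (4 + 2 * C)) / n := by
  have hn' : (0:ℝ) < n := by exact_mod_cast hn
  refine var_bound μ (Hs_cont β) (fun i => cf μ β k i) (fun i => cf_cont β k i) ?_
    (by positivity) ?_ (fun i σ => cf_Kc hμ hn β k i σ) hn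
  · intro i σ
    unfold cf
    refine (abs_sub _ _).trans (add_le_add ?_ ?_)
    · rw [abs_pow]; exact pow_le_one₀ (abs_nonneg _) (pf_le hn i σ)
    · have h := hlip _ (mi_mem hn i σ) 0 (by simp)
      have h0 : Rm μ β k 0 = 0 := by
        unfold Rm
        rcases hk with rfl | rfl <;> simp
      rw [h0, sub_zero, sub_zero, abs_of_nonneg (norm_nonneg _)] at h
      exact h.trans (mul_le_of_le_one_right hC (mi_norm hn i σ))
  · intro i j hij σ t
    unfold cf
    have h1 : |pf j σ ^ k - pf j (Function.update σ i t) ^ k| ≤ 4 / n := by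
      have hp := pf_sub_upd hij σ t
      rcases hk with rfl | rfl
      · simp only [pow_one]
        refine hp.trans ?_
        gcongr; norm_num
      · rw [sq_sub_sq, abs_mul]
        have h3 : |pf j σ + pf j (Function.update σ i t)| ≤ 2 :=
          (abs_add_le _ _).trans (by linarith [pf_le hn j σ, pf_le hn j (Function.update σ i t)])
        calc _ ≤ 2 * (2 / (n:ℝ)) := by gcongr
          _ = _ := by ring
    have h2 := hlip _ (mi_mem hn j σ) _ (mi_mem hn j (Function.update σ i t))
    have h3 : |‖mi j σ‖ - ‖mi j (Function.update σ i t)‖| ≤ 2 / n :=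
      (abs_norm_sub_norm_le _ _).trans (mi_sub_upd hij σ t)
    calc _ = |(pf j σ ^ k - pf j (Function.update σ i t) ^ k) -
          (Rm μ β k ‖mi j σ‖ - Rm μ β k ‖mi j (Function.update σ i t)‖)| := by congr 1; ring
      _ ≤ 4 / n + C * (2 / n) := (abs_sub _ _).trans
          (add_le_add h1 (h2.trans (mul_le_mul_of_nonneg_left h3 hC)))
      _ = _ := by ring

/-- The normalized statistic. -/
def Wf (a q : ℝ) (σ : Fin n → UnitSphere (K + 2)) : ℝ :=
  a * Real.sqrt n * (‖mx σ‖ ^ 2 - q)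

lemma Wf_cont (a q : ℝ) : Continuous (Wf a q : (Fin n → UnitSphere (K + 2)) → ℝ) := by
  have := mx_cont (K := K) (n := n)
  unfold Wf; fun_prop

lemma Wf_sub (hn : 1 ≤ n) (a q : ℝ) (i : Fin n) (σ : Fin n → UnitSphere (K + 2))
    (t : UnitSphere (K + 2)) : Wf a q σ - Wf a q (Function.update σ i t) =
      2 * a / Real.sqrt n * (pf i σ - ⟪(t : EuclideanSpace ℝ (Fin (K + 2))), mi i σ⟫) := by
  have hn' : (0:ℝ) < n := by exact_mod_cast hn
  have hs : 0 < Real.sqrt n := Real.sqrt_pos.2 hn'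
  have h1 := mx_upd_sq hn i σ (σ i)
  rw [Function.update_eq_self] at h1
  have h2 := mx_upd_sq hn i σ t
  unfold Wf
  rw [h1, h2]
  have e : Real.sqrt n / n = 1 / Real.sqrt n := by
    rw [div_eq_div_iff hn'.ne' hs.ne', Real.mul_self_sqrt hn'.le, one_mul]
  unfold pf
  calc _ = 2 * a * (Real.sqrt n / n) * (⟪(σ i : EuclideanSpace ℝ (Fin (K + 2))), mi i σ⟫ -
        ⟪(t : EuclideanSpace ℝ (Fin (K + 2))), mi i σ⟫) := by ring
    _ = _ := by rw [e]; ring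

lemma Wf_sub_le (hn : 1 ≤ n) {a : ℝ} (ha : 0 ≤ a) (q : ℝ) (i : Fin n)
    (σ : Fin n → UnitSphere (K + 2)) (t : UnitSphere (K + 2)) :
    |Wf a q σ - Wf a q (Function.update σ i t)| ≤ 4 * a / Real.sqrt n := by
  rw [Wf_sub hn, abs_mul, abs_of_nonneg (by positivity)]
  have : |pf i σ - ⟪(t : EuclideanSpace ℝ (Fin (K + 2))), mi i σ⟫| ≤ 2 :=
    (abs_sub _ _).trans (by linarith [pf_le hn i σ, inner_mi_le hn i σ t])
  calc _ ≤ 2 * a / Real.sqrt n * 2 := by gcongr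
    _ = _ := by ring

lemma Wf_dr (hμ : RotInv μ) (hn : 1 ≤ n) (β a q : ℝ) (σ : Fin n → UnitSphere (K + 2)) :
    dr μ (Hs β) (Wf a q) σ = 2 * a * Real.sqrt n * ((∑ i, cf μ β 1 i σ) / n) := by
  have hn' : (0:ℝ) < n := by exact_mod_cast hn
  have hs : 0 < Real.sqrt n := Real.sqrt_pos.2 hn'
  have h : ∀ i, Wf a q σ - Kc μ (Hs β) i (Wf a q) σ = 2 * a / Real.sqrt n * cf μ β 1 i σ := by
    intro i
    have := kLaw_prob μ (Hs_cont β) i σ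
    have hW := cont_slice (Hs_cont β) (Wf_cont (K := K) (n := n) a q) i σ
    have e : Wf a q σ - Kc μ (Hs β) i (Wf a q) σ =
        ∫ t, (Wf a q σ - Wf a q (Function.update σ i t)) ∂(kLaw μ (Hs β) i σ) := by
      rw [integral_sub (integrable_const _) (cont_integrable _ hW)]
      simp [Kc]
    rw [e]
    simp only [Wf_sub hn]
    rw [integral_const_mul, integral_sub (integrable_const _) (cont_integrable _ (by fun_prop))]
    have := kLaw_mom hμ hn β 1 i σ
    simp only [pow_one] at this
    rw [this]
    simp [cf]
  unfold dr
  rw [Finset.sum_congr rfl fun i _ => h i, ← Finset.mul_sum]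
  have e : 1 / Real.sqrt n = Real.sqrt n / n := by
    rw [div_eq_div_iff hs.ne' hn'.ne', Real.mul_self_sqrt hn'.le, one_mul]
  calc _ = 2 * a * (1 / Real.sqrt n) * ∑ i, cf μ β 1 i σ := by ring
    _ = _ := by rw [e]; ring

lemma Wf_qv (hμ : RotInv μ) (hn : 1 ≤ n) (β a q : ℝ) (σ : Fin n → UnitSphere (K + 2)) :
    qv μ (Hs β) (Wf a q) σ = 4 * a ^ 2 * ((∑ i, cf μ β 2 i σ) / n +
      (∑ i, (2 * Rm μ β 2 ‖mi i σ‖ - 2 * pf i σ * Rm μ β 1 ‖mi i σ‖)) / n) := by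
  have hn' : (0:ℝ) < n := by exact_mod_cast hn
  have hs : 0 < Real.sqrt n := Real.sqrt_pos.2 hn'
  unfold qv
  rw [← add_div, ← Finset.sum_add_distrib, Finset.sum_div, Finset.mul_sum]
  refine Finset.sum_congr rfl fun i _ => ?_
  have := kLaw_prob μ (Hs_cont β) i σ
  have h1 := kLaw_mom hμ hn β 1 i σ
  have h2 := kLaw_mom hμ hn β 2 i σ
  have e : ∀ t : UnitSphere (K + 2), (Wf a q σ - Wf a q (Function.update σ i t)) ^ 2 =
    4 * a ^ 2 / n * (pf i σ ^ 2 - 2 * pf i σ *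
      ⟪(t : EuclideanSpace ℝ (Fin (K + 2))), mi i σ⟫ ^ 1 +
      ⟪(t : EuclideanSpace ℝ (Fin (K + 2))), mi i σ⟫ ^ 2) := fun t => by
    rw [Wf_sub hn, mul_pow, div_pow, Real.sq_sqrt hn'.le]
    ring
  simp only [e]
  rw [integral_const_mul, integral_add (cont_integrable _ (by fun_prop))
    (cont_integrable _ (by fun_prop)), integral_sub (integrable_const _)
    (cont_integrable _ (by fun_prop)), integral_const_mul, h1, h2]
  simp [cf]
  ring

lemma Wf_qv_le (hn : 1 ≤ n) (β : ℝ) {a : ℝ} (ha : 0 ≤ a) (q : ℝ)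
    (σ : Fin n → UnitSphere (K + 2)) : qv μ (Hs β) (Wf a q) σ ≤ 16 * a ^ 2 := by
  have hn' : (0:ℝ) < n := by exact_mod_cast hn
  have h : ∀ i : Fin n, ∫ t, (Wf a q σ - Wf a q (Function.update σ i t)) ^ 2
      ∂(kLaw μ (Hs β) i σ) ≤ 16 * a ^ 2 / n := by
    intro i
    have := kLaw_prob μ (Hs_cont β) i σ
    have hW := cont_slice (Hs_cont β) (Wf_cont (K := K) (n := n) a q) i σ
    calc _ ≤ ∫ _, 16 * a ^ 2 / (n:ℝ) ∂(kLaw μ (Hs β) i σ) := by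
          refine integral_mono (cont_integrable _ (by fun_prop)) (integrable_const _) fun t => ?_
          have := pow_le_pow_left₀ (abs_nonneg _) (Wf_sub_le hn ha q i σ t) 2
          rw [sq_abs, div_pow, Real.sq_sqrt hn'.le] at this
          refine this.trans (le_of_eq ?_)
          ring
      _ = _ := by simp
  unfold qv
  refine (Finset.sum_le_sum fun i _ => h i).trans ?_
  simp
  field_simp
  exact le_rfl

/-- Deterministic approximations. -/
lemma avg_approx {β C1 C2 : ℝ} (hC1 : 0 ≤ C1) (hC2 : 0 ≤ C2)
    (h1 : ∀ r ∈ Set.Icc (0:ℝ) 1, ∀ s ∈ Set.Icc (0:ℝ) 1,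
      |Rm μ β 1 r - Rm μ β 1 s| ≤ C1 * |r - s|)
    (h2 : ∀ r ∈ Set.Icc (0:ℝ) 1, ∀ s ∈ Set.Icc (0:ℝ) 1,
      |Rm μ β 2 r - Rm μ β 2 s| ≤ C2 * |r - s|) (hn : 1 ≤ n) (σ : Fin n → UnitSphere (K + 2)) :
    |(∑ i, cf μ β 1 i σ) / n - (‖mx σ‖ ^ 2 - Rm μ β 1 ‖mx σ‖)| ≤ (1 + C1) / n ∧
    |(∑ i, (2 * Rm μ β 2 ‖mi i σ‖ - 2 * pf i σ * Rm μ β 1 ‖mi i σ‖)) / n -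
      (2 * Rm μ β 2 ‖mx σ‖ - 2 * ‖mx σ‖ ^ 2 * Rm μ β 1 ‖mx σ‖)| ≤ (2 * C2 + 4 * C1) / n := by
  have hn' : (0:ℝ) < n := by exact_mod_cast hn
  have hp := pf_sum hn σ
  set r := ‖mx σ‖ with hr
  have hrm : r ∈ Set.Icc (0:ℝ) 1 := mx_mem hn σ
  have b1 : ∀ i, |Rm μ β 1 ‖mi i σ‖ - Rm μ β 1 r| ≤ C1 / n := fun i => by
    refine (h1 _ (mi_mem hn i σ) _ hrm).trans ?_
    calc _ ≤ C1 * (1 / n) := mul_le_mul_of_nonneg_left (mi_mx i σ) hC1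
      _ = _ := by ring
  have b2 : ∀ i, |Rm μ β 2 ‖mi i σ‖ - Rm μ β 2 r| ≤ C2 / n := fun i => by
    refine (h2 _ (mi_mem hn i σ) _ hrm).trans ?_
    calc _ ≤ C2 * (1 / n) := mul_le_mul_of_nonneg_left (mi_mx i σ) hC2
      _ = _ := by ring
  have hR0 : Rm μ β 1 0 = 0 := by simp [Rm]
  have b3 : |Rm μ β 1 r| ≤ C1 := by
    have := h1 r hrm 0 (by simp)
    rw [hR0, sub_zero, sub_zero, abs_of_nonneg hrm.1] at this
    exact this.trans (mul_le_of_le_one_right hC1 hrm.2)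
  have avg : ∀ (g : Fin n → ℝ) (D : ℝ), (∀ i, |g i| ≤ D) → |(∑ i, g i) / n| ≤ D := by
    intro g D hg
    rw [abs_div, abs_of_pos hn', div_le_iff₀ hn']
    refine (Finset.abs_sum_le_sum_abs _ _).trans ((Finset.sum_le_sum fun i _ => hg i).trans ?_)
    simp [mul_comm]
  constructor
  · have e : (∑ i, cf μ β 1 i σ) / n - (r ^ 2 - Rm μ β 1 r) =
        -(1 / n) - (∑ i, (Rm μ β 1 ‖mi i σ‖ - Rm μ β 1 r)) / n := by
      simp only [cf, pow_one]
      rw [Finset.sum_sub_distrib, Finset.sum_sub_distrib, sub_div, hp]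
      simp
      field_simp
      ring
    rw [e]
    refine (abs_sub _ _).trans ?_
    rw [abs_neg, abs_of_pos (by positivity), add_div]
    exact add_le_add le_rfl (avg _ _ b1)
  · have e : (∑ i, (2 * Rm μ β 2 ‖mi i σ‖ - 2 * pf i σ * Rm μ β 1 ‖mi i σ‖)) / n -
      (2 * Rm μ β 2 r - 2 * r ^ 2 * Rm μ β 1 r) =
        (∑ i, (2 * (Rm μ β 2 ‖mi i σ‖ - Rm μ β 2 r) -
          2 * pf i σ * (Rm μ β 1 ‖mi i σ‖ - Rm μ β 1 r))) / n + 2 * (1 / n) * Rm μ β 1 r := by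
      have hp' : r ^ 2 = (∑ i, pf i σ) / n + 1 / n := by linarith
      rw [hp']
      simp only [mul_sub, Finset.sum_sub_distrib, ← Finset.mul_sum, ← Finset.sum_mul]
      simp
      field_simp
      ring
    rw [e]
    refine (abs_add_le _ _).trans ?_
    have := avg (fun i => 2 * (Rm μ β 2 ‖mi i σ‖ - Rm μ β 2 r) -
          2 * pf i σ * (Rm μ β 1 ‖mi i σ‖ - Rm μ β 1 r)) (2 * (C2 / n) + 2 * 1 * (C1 / n))
          (fun i => by
            refine (abs_sub _ _).trans ?_
            rw [abs_mul, abs_mul, abs_mul, abs_of_pos (two_pos : (0:ℝ) < 2)]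
            have := b1 i
            have := b2 i
            have := pf_le hn i σ
            gcongr)
    have h4 : |2 * (1 / n) * Rm μ β 1 r| ≤ 2 * (1 / n) * C1 := by
      rw [abs_mul, abs_of_pos (by positivity)]
      gcongr
    calc _ ≤ _ := add_le_add this h4
      _ = _ := by ring

/-- Lower bound for the partition function. -/
lemma Z_lower (hn : 1 ≤ n) {β b : ℝ} (hβ : 0 < β) :
    Real.exp (n * (Real.log (Lm μ 0 b) - b ^ 2 / (2 * β))) ≤
      ∫ σ : Fin n → UnitSphere (K + 2), Real.exp (Hs β σ) ∂(Measure.pi fun _ : Fin n => μ) := by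
  have hn' : (0:ℝ) < n := by exact_mod_cast hn
  have hc0 := crd_cont (K := K) 0
  have hcH := Hs_cont (K := K) (n := n) β
  have hle : ∀ σ : Fin n → UnitSphere (K + 2),
      Real.exp (-(n * (b ^ 2 / (2 * β)))) * ∏ i, Real.exp (b * crd 0 (σ i)) ≤
        Real.exp (Hs β σ) := by
    intro σ
    rw [← Real.exp_sum, ← Real.exp_add, Real.exp_le_exp, Hs_eq hn]
    set e : EuclideanSpace ℝ (Fin (K + 2)) := EuclideanSpace.single 0 b with he
    have hi : ∑ i, b * crd 0 (σ i) = n * ⟪mx σ, e⟫ := by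
      unfold mx
      rw [real_inner_smul_left, ← mul_assoc, mul_inv_cancel₀ hn'.ne', one_mul, sum_inner]
      refine Finset.sum_congr rfl fun i _ => ?_
      rw [he, EuclideanSpace.inner_single_right]
      simp [crd]
    have hsq : 0 ≤ ‖β • mx σ - e‖ ^ 2 := sq_nonneg _
    rw [norm_sub_sq_real, norm_smul, real_inner_smul_left, Real.norm_eq_abs, abs_of_pos hβ] at hsq
    have hen : ‖e‖ ^ 2 = b ^ 2 := by simp [he]
    rw [hen] at hsq
    rw [hi]
    have : β * n / 2 * ‖mx σ‖ ^ 2 - (-(n * (b ^ 2 / (2 * β))) + n * ⟪mx σ, e⟫) =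
      n / (2 * β) * ((β * ‖mx σ‖) ^ 2 - 2 * (β * ⟪mx σ, e⟫) + b ^ 2) := by
      field_simp
      ring
    have h2 : 0 ≤ n / (2 * β) * ((β * ‖mx σ‖) ^ 2 - 2 * (β * ⟪mx σ, e⟫) + b ^ 2) := by
      exact mul_nonneg (by positivity) hsq
    linarith
  have hprodint : ∫ σ : Fin n → UnitSphere (K + 2), ∏ i, Real.exp (b * crd 0 (σ i))
      ∂(Measure.pi fun _ : Fin n => μ) = (Lm μ 0 b) ^ n := by
    rw [integral_fintype_prod_eq_pow (μ := μ) (fun s => Real.exp (b * crd 0 s))]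
    simp [Lm, mom]
  calc _ = Real.exp (-(n * (b ^ 2 / (2 * β)))) * (Lm μ 0 b) ^ n := by
        rw [mul_sub, sub_eq_add_neg, Real.exp_add, mul_comm, mul_comm (n:ℝ) (Real.log _),
          Real.exp_mul, Real.exp_log (Lm_pos μ b), Real.rpow_natCast]
    _ = ∫ σ : Fin n → UnitSphere (K + 2),
        Real.exp (-(n * (b ^ 2 / (2 * β)))) * ∏ i, Real.exp (b * crd 0 (σ i))
        ∂(Measure.pi fun _ : Fin n => μ) := by rw [integral_const_mul, hprodint]
    _ ≤ _ := integral_mono (cont_integrable _ (by fun_prop)) (cont_integrable _ (by fun_prop)) hle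

lemma loc_bound (hn : 1 ≤ n) {β b ε rate : ℝ} (hβ : 0 < β)
    (hr : rate = Real.log (Lm μ 0 b) - b ^ 2 / (2 * β)) (hr0 : 0 < rate)
    (hε : β * ε ^ 2 = rate) :
    ∫ σ : Fin n → UnitSphere (K + 2), Real.exp (β * n / 2 * ε ^ 2 - Hs β σ) ∂(Pm μ (Hs β)) ≤
      (2 / rate) / n := by
  have hn' : (0:ℝ) < n := by exact_mod_cast hn
  rw [Pm_int μ (Hs_cont β)]
  have e : ∀ σ : Fin n → UnitSphere (K + 2),
      Real.exp (Hs β σ) * Real.exp (β * n / 2 * ε ^ 2 - Hs β σ) =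
      Real.exp (n * rate / 2) := fun σ => by
    rw [← Real.exp_add, ← hε]; congr 1; ring
  simp only [e]
  have hZ := Z_lower (μ := μ) (b := b) hn hβ
  rw [← hr] at hZ
  simp only [integral_const, probReal_univ, one_smul]
  have hpos : 0 < n * rate / 2 := by positivity
  calc _ ≤ Real.exp (n * rate / 2) / Real.exp (n * rate) := by gcongr
    _ = 1 / Real.exp (n * rate / 2) := by
      rw [← Real.exp_sub, one_div, ← Real.exp_neg]; congr 1; ring
    _ ≤ 1 / (n * rate / 2) := by
      refine one_div_le_one_div_of_le hpos ?_
      linarith [Real.add_one_le_exp (n * rate / 2)]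
    _ = _ := by field_simp

end Model

end

section

/-! ### Part 6: assembling the bound -/

lemma abs_of_sq {X : Type} [MetricSpace X] [CompactSpace X] [MeasurableSpace X] [BorelSpace X]
    (P : Measure X) [IsProbabilityMeasure P] {F : X → ℝ} (hF : Continuous F) {V : ℝ} {n : ℕ}
    (hn : 1 ≤ n) (h : ∫ x, F x ^ 2 ∂P ≤ V / n) : ∫ x, |F x| ∂P ≤ (V + 1) / Real.sqrt n := by
  have hn' : (0:ℝ) < n := by exact_mod_cast hn
  have hs : 0 < Real.sqrt n := Real.sqrt_pos.2 hn'
  have hsq := Real.sq_sqrt hn'.le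
  set s := Real.sqrt n
  have h1 : ∫ x, |F x| ∂P ≤ ∫ x, (s * F x ^ 2 + 1 / s) ∂P := by
    refine integral_mono (cont_integrable _ (by fun_prop)) (cont_integrable _ (by fun_prop)) ?_
    intro x
    simp only
    rw [← sq_abs]
    have e : s * |F x| ^ 2 + 1 / s - |F x| = ((s * |F x| - 1 / 2) ^ 2 + 3 / 4) / s := by
      field_simp; ring
    have : 0 ≤ ((s * |F x| - 1 / 2) ^ 2 + 3 / 4) / s := by positivity
    linarith
  refine h1.trans ?_
  rw [integral_add (cont_integrable _ (by fun_prop)) (integrable_const _), integral_const_mul]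
  simp only [integral_const, probReal_univ, one_smul]
  calc s * ∫ x, F x ^ 2 ∂P + 1 / s ≤ s * (V / n) + 1 / s := by gcongr
    _ = _ := by rw [← hsq]; field_simp

lemma Lm_one_le {K : ℕ} (μ : Measure (UnitSphere (K + 2))) [IsProbabilityMeasure μ] (x : ℝ) :
    Lm μ 1 x ≤ Lm μ 0 x := by
  have hc := crd_cont (K := K) 0
  unfold Lm mom
  refine integral_mono (cont_integrable _ (by fun_prop)) (cont_integrable _ (by fun_prop)) ?_
  intro s
  have h1 := (abs_le.1 (crd_le 0 s)).2
  simp only [one_mul, pow_one, pow_zero]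
  exact mul_le_of_le_one_left (Real.exp_pos _).le h1

lemma final_arith {kS κ a s C1 V1 V2 CQ C12 T CT I1 I2 I3 I4 X : ℝ} (hk : 2 ≤ kS) (hκ : 0 < κ)
    (ha : 0 < a) (hs : 1 ≤ s) (hT : 0 ≤ T)
    (h1 : I1 ≤ (4 * a ^ 2 / (2 * κ) * ((V2 + 1) + CQ * (T + 1) + C12)) / s)
    (h2 : I2 ≤ (2 * a * (1 + C1 + CT * T)) / s)
    (h3 : I3 ≤ 2 * a * (T + 1)) (h4 : I4 ≤ 2 * a * (V1 + 1))
    (hX : X ≤ kS * I1 + kS / κ * I2 + (kS * (4 * a / s) * (16 * a ^ 2) / (2 * κ)) *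
      (1 + 4 * a / s + I3) + (4 * kS * (4 * a / s) / κ) * I4) :
    X ≤ (kS * (4 * a ^ 2 / (2 * κ) * ((V2 + 1) + CQ * (T + 1) + C12)) +
      kS / κ * (2 * a * (1 + C1 + CT * T)) + (kS * (4 * a) * (16 * a ^ 2) / (2 * κ)) *
      (1 + 4 * a + 2 * a * (T + 1)) + (4 * kS * (4 * a) / κ) * (2 * a * (V1 + 1))) / s := by
  have hs0 : 0 < s := by linarith
  have hk0 : 0 < kS := by linarith
  have h5 : 4 * a / s ≤ 4 * a := div_le_self (by positivity) hs
  refine hX.trans ?_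
  calc _ ≤ kS * ((4 * a ^ 2 / (2 * κ) * ((V2 + 1) + CQ * (T + 1) + C12)) / s) +
        kS / κ * ((2 * a * (1 + C1 + CT * T)) / s) +
        (kS * (4 * a / s) * (16 * a ^ 2) / (2 * κ)) * (1 + 4 * a + 2 * a * (T + 1)) +
        (4 * kS * (4 * a / s) / κ) * (2 * a * (V1 + 1)) := by gcongr
    _ = _ := by field_simp

set_option maxHeartbeats 3000000 in
lemma core_bound {K : ℕ} (μ : Measure (UnitSphere (K + 2))) [IsProbabilityMeasure μ]
    (hμ : RotInv μ) {β b a v κ ρ : ℝ} (hβ : 0 < β) (hb : 0 < b)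
    (hfix : b = β * (Lm μ 1 b / Lm μ 0 b))
    (hv : v = Lm μ 2 b / Lm μ 0 b - (Lm μ 1 b / Lm μ 0 b) ^ 2) (hκ : κ = 1 - β * v) (hκ0 : 0 < κ)
    (hρ : ρ = b / β) (ha : 0 < a) (haκ : 4 * a ^ 2 * (2 * ρ ^ 2 * v) = 2 * κ) :
    ∃ C > 0, ∀ n : ℕ, 1 ≤ n → ∀ z : ℝ,
      |((Pm μ (Hs β)) {σ : Fin n → UnitSphere (K + 2) | Wf a (ρ ^ 2) σ ≤ z}).toReal - gPhi z|
        ≤ C / Real.sqrt n := by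
  have hode := Lm_ODE μ hμ
  have hρ0 : 0 < ρ := by rw [hρ]; positivity
  have hρf : Lm μ 1 b / Lm μ 0 b = ρ := by
    rw [hρ, eq_div_iff hβ.ne']; linarith
  have hbρ : β * ρ = b := by rw [hρ]; field_simp
  have hρ1 : ρ ≤ 1 := by
    rw [← hρf]; exact (div_le_one (Lm_pos μ b)).2 (Lm_one_le μ b)
  have hρm : ρ ∈ Set.Icc (0:ℝ) 1 := ⟨hρ0.le, hρ1⟩
  obtain ⟨C1, hC1, hl1⟩ := Rm_lip μ β 1
  obtain ⟨C2, hC2, hl2⟩ := Rm_lip μ β 2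
  -- the drift function
  set h : ℝ → ℝ := fun r => r ^ 2 - Rm μ β 1 r with hh
  have hform : ∀ r, h r = r * (r - Lm μ 1 (β * r) / Lm μ 0 (β * r)) := fun r => by
    simp only [hh, Rm]; ring
  have hR1 := Rm_contDiff μ β 2 1
  have hR2 := Rm_contDiff μ β 2 2
  have hhC : ContDiff ℝ 2 h := (contDiff_id.pow 2).sub (by exact_mod_cast hR1)
  have hhρ : h ρ = 0 := by rw [hform, hbρ, hρf]; ring
  have hhd : HasDerivAt h (κ * ρ) ρ := by
    have e : h = fun r => r * (r - (fun x => Lm μ 1 x / Lm μ 0 x) (β * r)) := funext hform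
    rw [e]
    have h1 : HasDerivAt (fun r => β * r) β ρ := by
      simpa using (hasDerivAt_id ρ).const_mul β
    have h2 := hode.fderiv (β * ρ)
    have h3 := HasDerivAt.comp ρ h2 h1
    refine ((hasDerivAt_id ρ).mul ((hasDerivAt_id ρ).sub h3)).congr_deriv ?_
    rw [hbρ, ← hv]
    simp [hbρ, hρf, hκ]
    ring
  -- Taylor
  obtain ⟨CT, hCT, htay⟩ := double_zero (p := fun r => h r - κ / 2 * (r ^ 2 - ρ ^ 2)) (ρ := ρ)
    (hhC.sub (contDiff_const.mul ((contDiff_id.pow 2).sub contDiff_const))) hρm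
    (by simp [hhρ]) (by
      have h1 : HasDerivAt (fun r : ℝ => κ / 2 * (r ^ 2 - ρ ^ 2)) (κ / 2 * (2 * ρ)) ρ := by
        have := ((hasDerivAt_pow 2 ρ).sub_const (ρ ^ 2)).const_mul (κ / 2)
        simpa using this
      have h2 := hhd.sub h1
      have h3 : deriv (h - fun r => κ / 2 * (r ^ 2 - ρ ^ 2)) ρ = 0 := by rw [h2.deriv]; ring
      exact h3)
  -- localization
  set rate := Real.log (Lm μ 0 b) - b ^ 2 / (2 * β) with hrate
  have hrate0 : 0 < rate := hode.rate (Lm_zero μ) hβ hb hfix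
  set ε := Real.sqrt (rate / β) with hε
  have hε0 : 0 < ε := Real.sqrt_pos.2 (by positivity)
  have hεr : β * ε ^ 2 = rate := by
    rw [hε, Real.sq_sqrt (by positivity)]; field_simp
  obtain ⟨c, hc0, hlow⟩ := simple_zero (h := h) (ρ := ρ) (ε := ε) hhC.continuous
    hhd.differentiableAt hhρ (by rw [hhd.deriv]; positivity) (by
      intro r hr hne
      have hr0 : 0 < r := hε0.trans_le hr.1
      rw [hform]
      refine mul_ne_zero hr0.ne' (sub_ne_zero.2 ?_)
      rcases lt_or_gt_of_ne hne with hlt | hgt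
      · have := hode.below hβ hb hfix (x := β * r) (by positivity)
          (by rw [← hbρ]; gcongr)
        exact (lt_of_mul_lt_mul_left this hβ.le).ne
      · have := hode.above hβ hb hfix (x := β * r) (by rw [← hbρ]; gcongr)
        exact (lt_of_mul_lt_mul_left this hβ.le).ne')
  set Q : ℝ → ℝ := fun r => 2 * Rm μ β 2 r - 2 * r ^ 2 * Rm μ β 1 r with hQ
  have hQC : ContDiff ℝ 1 Q := by
    have h1 := Rm_contDiff μ β 1 1
    have h2 := Rm_contDiff μ β 1 2
    exact (contDiff_const.mul (by exact_mod_cast h2)).sub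
      ((contDiff_const.mul (contDiff_id.pow 2)).mul (by exact_mod_cast h1))
  obtain ⟨CQ', hCQ'⟩ := hQC.contDiffOn.exists_lipschitzOnWith (s := Set.Icc (0:ℝ) 1) one_ne_zero
    (convex_Icc 0 1) isCompact_Icc
  obtain ⟨CQ, hCQ0, hCQ⟩ : ∃ CQ : ℝ, 0 ≤ CQ ∧ ∀ r ∈ Set.Icc (0:ℝ) 1,
      |Q r - Q ρ| ≤ CQ * |r - ρ| :=
    ⟨(CQ' : ℝ), CQ'.2, fun r hr => hCQ'.dist_le_mul r hr ρ hρm⟩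
  have hQρ : Q ρ = 2 * ρ ^ 2 * v := by
    simp only [hQ, Rm, hbρ]
    rw [hv, ← hρf]
    ring
  set V1 := (1 + C1) ^ 2 + (1 + C1) * (4 + 2 * C1) with hV1
  set V2 := (1 + C2) ^ 2 + (1 + C2) * (4 + 2 * C2) with hV2
  set T := (2 * V1 + 2 * (1 + C1) ^ 2) / c ^ 2 + 2 / rate with hT
  have hV10 : 0 ≤ V1 := by positivity
  have hV20 : 0 ≤ V2 := by positivity
  have hT0 : 0 ≤ T := by positivity
  have hk := kS_ge
  have hkp : 0 < kS := by linarith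
  refine ⟨(kS * (4 * a ^ 2 / (2 * κ) * ((V2 + 1) + CQ * (T + 1) + (2 * C2 + 4 * C1))) +
      kS / κ * (2 * a * (1 + C1 + CT * T)) + (kS * (4 * a) * (16 * a ^ 2) / (2 * κ)) *
      (1 + 4 * a + 2 * a * (T + 1)) + (4 * kS * (4 * a) / κ) * (2 * a * (V1 + 1))),
      by positivity, ?_⟩
  intro n hn z
  have hn' : (0:ℝ) < n := by exact_mod_cast hn
  have hn1 : (1:ℝ) ≤ n := by exact_mod_cast hn
  have hs1 : 1 ≤ Real.sqrt n := Real.one_le_sqrt.2 hn1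
  have hs : 0 < Real.sqrt n := by linarith
  have hssq := Real.sq_sqrt hn'.le
  have hH := Hs_cont (K := K) (n := n) β
  have hP := Pm_prob μ hH
  have hWc := Wf_cont (K := K) (n := n) a (ρ ^ 2)
  have hmc := mx_cont (K := K) (n := n)
  have hhc := hhC.continuous
  have hQc := hQC.continuous
  set P : Measure (Fin n → UnitSphere (K + 2)) := Pm μ (Hs β) with hPdef
  set D : (Fin n → UnitSphere (K + 2)) → ℝ := fun σ => (∑ i, cf μ β 1 i σ) / n with hD
  set A : (Fin n → UnitSphere (K + 2)) → ℝ := fun σ => (∑ i, cf μ β 2 i σ) / n with hA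
  have hDc : Continuous D := by
    have := fun i : Fin n => cf_cont (μ := μ) β 1 i
    fun_prop
  have hAc : Continuous A := by
    have := fun i : Fin n => cf_cont (μ := μ) β 2 i
    fun_prop
  have hD2 : ∫ σ, D σ ^ 2 ∂P ≤ V1 / n := cf_var hμ β (Or.inl rfl) hC1 hl1 hn
  have hA2 : ∫ σ, A σ ^ 2 ∂P ≤ V2 / n := cf_var hμ β (Or.inr rfl) hC2 hl2 hn
  have hap := fun σ => avg_approx hC1 hC2 hl1 hl2 hn (σ : Fin n → UnitSphere (K + 2))
  have hDh : ∀ σ, |D σ - h ‖mx σ‖| ≤ (1 + C1) / n := fun σ => (hap σ).1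
  -- second moment of r - ρ
  have hpt : ∀ σ : Fin n → UnitSphere (K + 2), (‖mx σ‖ - ρ) ^ 2 ≤
      (2 * D σ ^ 2 + 2 * (1 + C1) ^ 2 / n) / c ^ 2 + Real.exp (β * n / 2 * ε ^ 2 - Hs β σ) := by
    intro σ
    have hm := mx_mem hn σ
    rcases le_or_gt ε ‖mx σ‖ with hge | hlt
    · have h1 := hlow ‖mx σ‖ ⟨hge, hm.2⟩
      have h2 := pow_le_pow_left₀ (by positivity) h1 2
      rw [mul_pow, sq_abs, sq_abs] at h2
      have h3 : h ‖mx σ‖ ^ 2 ≤ 2 * D σ ^ 2 + 2 * (1 + C1) ^ 2 / n := by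
        have h4 := pow_le_pow_left₀ (abs_nonneg _) (hDh σ) 2
        rw [sq_abs] at h4
        have h5 : ((1 + C1) / n) ^ 2 ≤ (1 + C1) ^ 2 / n := by
          rw [div_pow]
          gcongr
          nlinarith
        have h6 : 2 * (1 + C1) ^ 2 / (n:ℝ) = 2 * ((1 + C1) ^ 2 / n) := by ring
        rw [h6]
        nlinarith [sq_nonneg (2 * D σ - h ‖mx σ‖)]
      have h7 : (‖mx σ‖ - ρ) ^ 2 ≤ (2 * D σ ^ 2 + 2 * (1 + C1) ^ 2 / n) / c ^ 2 := by
        rw [le_div_iff₀ (by positivity)]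
        linarith
      have := Real.exp_pos (β * n / 2 * ε ^ 2 - Hs β σ)
      linarith
    · have h1 : 1 ≤ Real.exp (β * n / 2 * ε ^ 2 - Hs β σ) := by
        rw [Real.one_le_exp_iff, Hs_eq hn, ← mul_sub]
        refine mul_nonneg (by positivity) (sub_nonneg.2 ?_)
        exact pow_le_pow_left₀ (norm_nonneg _) hlt.le 2
      have h2 : (‖mx σ‖ - ρ) ^ 2 ≤ 1 := by
        rw [sq_le_one_iff_abs_le_one, abs_le]
        constructor <;> linarith [hm.1, hm.2]
      have h3 : 0 ≤ (2 * D σ ^ 2 + 2 * (1 + C1) ^ 2 / n) / c ^ 2 := by positivity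
      linarith
  have hT2 : ∫ σ, (‖mx σ‖ - ρ) ^ 2 ∂P ≤ T / n := by
    have h1 : ∫ σ, (‖mx σ‖ - ρ) ^ 2 ∂P ≤ ∫ σ, ((2 * D σ ^ 2 + 2 * (1 + C1) ^ 2 / n) / c ^ 2 +
        Real.exp (β * n / 2 * ε ^ 2 - Hs β σ)) ∂P :=
      integral_mono (cont_integrable _ (by fun_prop)) (cont_integrable _ (by fun_prop)) hpt
    refine h1.trans ?_
    rw [integral_add (cont_integrable _ (by fun_prop)) (cont_integrable _ (by fun_prop)),
      integral_div, integral_add (cont_integrable _ (by fun_prop)) (integrable_const _),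
      integral_const_mul]
    simp only [integral_const, probReal_univ, one_smul]
    have h2 := loc_bound (μ := μ) hn hβ hrate hrate0 hεr
    calc _ ≤ (2 * (V1 / n) + 2 * (1 + C1) ^ 2 / n) / c ^ 2 + (2 / rate) / n := by gcongr
      _ = _ := by rw [hT]; field_simp
  have hTabs : ∫ σ : Fin n → UnitSphere (K + 2), |‖mx σ‖ - ρ| ∂P ≤ (T + 1) / Real.sqrt n :=
    abs_of_sq P (by fun_prop) hn hT2
  have hDabs : ∫ σ, |D σ| ∂P ≤ (V1 + 1) / Real.sqrt n := abs_of_sq P hDc hn hD2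
  have hAabs : ∫ σ, |A σ| ∂P ≤ (V2 + 1) / Real.sqrt n := abs_of_sq P hAc hn hA2
  have hinv : 1 / (n:ℝ) ≤ 1 / Real.sqrt n := by
    refine one_div_le_one_div_of_le hs ?_
    nlinarith
  have hdr : ∀ σ : Fin n → UnitSphere (K + 2),
      dr μ (Hs β) (Wf a (ρ ^ 2)) σ = 2 * a * Real.sqrt n * D σ :=
    fun σ => Wf_dr hμ hn β a (ρ ^ 2) σ
  have hdrc := dr_cont μ hH hWc
  have hqvc := qv_cont μ hH hWc
  -- the four terms
  have hI1 : ∫ σ, |1 - qv μ (Hs β) (Wf a (ρ ^ 2)) σ / (2 * κ)| ∂P ≤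
      (4 * a ^ 2 / (2 * κ) * ((V2 + 1) + CQ * (T + 1) + (2 * C2 + 4 * C1))) / Real.sqrt n := by
    have hp : ∀ σ : Fin n → UnitSphere (K + 2),
        |1 - qv μ (Hs β) (Wf a (ρ ^ 2)) σ / (2 * κ)| ≤
        4 * a ^ 2 / (2 * κ) * (|A σ| + CQ * |‖mx σ‖ - ρ| + (2 * C2 + 4 * C1) / Real.sqrt n) := by
      intro σ
      have hq := Wf_qv hμ hn β a (ρ ^ 2) σ
      set U := (∑ i, (2 * Rm μ β 2 ‖mi i σ‖ - 2 * pf i σ * Rm μ β 1 ‖mi i σ‖)) / n with hU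
      have hUQ : |U - Q ‖mx σ‖| ≤ (2 * C2 + 4 * C1) / n := (hap σ).2
      have hQQ := hCQ _ (mx_mem hn σ)
      have e : 1 - qv μ (Hs β) (Wf a (ρ ^ 2)) σ / (2 * κ) =
          4 * a ^ 2 / (2 * κ) * (-(A σ) - (U - Q ‖mx σ‖) - (Q ‖mx σ‖ - Q ρ)) := by
        rw [hq, hQρ]
        have : (1:ℝ) = 4 * a ^ 2 * (2 * ρ ^ 2 * v) / (2 * κ) := by rw [haκ]; field_simp
        nth_rewrite 1 [this]
        simp only [hA]
        ring
      rw [e, abs_mul, abs_of_pos (by positivity)]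
      refine mul_le_mul_of_nonneg_left ?_ (by positivity)
      have h1 : (2 * C2 + 4 * C1) / (n:ℝ) ≤ (2 * C2 + 4 * C1) / Real.sqrt n := by
        rw [div_eq_mul_one_div, div_eq_mul_one_div _ (Real.sqrt n)]
        gcongr
      have h2 := abs_sub (-(A σ) - (U - Q ‖mx σ‖)) (Q ‖mx σ‖ - Q ρ)
      have h3 := abs_sub (-(A σ)) (U - Q ‖mx σ‖)
      rw [abs_neg] at h3
      linarith
    refine (integral_mono (cont_integrable _ (by fun_prop)) (cont_integrable _ (by fun_prop))
      hp).trans ?_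
    rw [integral_const_mul, integral_add (cont_integrable _ (by fun_prop)) (integrable_const _),
      integral_add (cont_integrable _ (by fun_prop)) (cont_integrable _ (by fun_prop)),
      integral_const_mul]
    simp only [integral_const, probReal_univ, one_smul]
    calc _ ≤ 4 * a ^ 2 / (2 * κ) * ((V2 + 1) / Real.sqrt n + CQ * ((T + 1) / Real.sqrt n)
          + (2 * C2 + 4 * C1) / Real.sqrt n) := by gcongr
      _ = _ := by ring
  have hI2 : ∫ σ, |dr μ (Hs β) (Wf a (ρ ^ 2)) σ - κ * Wf a (ρ ^ 2) σ| ∂P ≤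
      (2 * a * (1 + C1 + CT * T)) / Real.sqrt n := by
    have hp : ∀ σ : Fin n → UnitSphere (K + 2),
        |dr μ (Hs β) (Wf a (ρ ^ 2)) σ - κ * Wf a (ρ ^ 2) σ| ≤
        2 * a * Real.sqrt n * ((1 + C1) / n + CT * (‖mx σ‖ - ρ) ^ 2) := by
      intro σ
      have e : dr μ (Hs β) (Wf a (ρ ^ 2)) σ - κ * Wf a (ρ ^ 2) σ = 2 * a * Real.sqrt n *
          ((D σ - h ‖mx σ‖) + (h ‖mx σ‖ - κ / 2 * (‖mx σ‖ ^ 2 - ρ ^ 2))) := by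
        rw [hdr]; unfold Wf; ring
      rw [e, abs_mul, abs_of_pos (by positivity)]
      refine mul_le_mul_of_nonneg_left ?_ (by positivity)
      exact (abs_add_le _ _).trans (add_le_add (hDh σ) (htay _ (mx_mem hn σ)))
    refine (integral_mono (cont_integrable _ (by fun_prop)) (cont_integrable _ (by fun_prop))
      hp).trans ?_
    rw [integral_const_mul, integral_add (integrable_const _) (cont_integrable _ (by fun_prop)),
      integral_const_mul]
    simp only [integral_const, probReal_univ, one_smul]
    have e : Real.sqrt n / n = 1 / Real.sqrt n := by
      rw [div_eq_div_iff hn'.ne' hs.ne', Real.mul_self_sqrt hn'.le, one_mul]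
    calc _ ≤ 2 * a * Real.sqrt n * ((1 + C1) / n + CT * (T / n)) := by gcongr
      _ = 2 * a * (1 + C1 + CT * T) * (Real.sqrt n / n) := by ring
      _ = _ := by rw [e]; ring
  have hI3 : ∫ σ : Fin n → UnitSphere (K + 2), |Wf a (ρ ^ 2) σ| ∂P ≤ 2 * a * (T + 1) := by
    have hp : ∀ σ : Fin n → UnitSphere (K + 2), |Wf a (ρ ^ 2) σ| ≤
        2 * a * Real.sqrt n * |‖mx σ‖ - ρ| := by
      intro σ
      have hm := mx_mem hn σ
      unfold Wf
      rw [abs_mul, abs_of_pos (by positivity), sq_sub_sq, abs_mul,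
        abs_of_nonneg (by linarith [hm.1] : 0 ≤ ‖mx σ‖ + ρ)]
      have h1 : ‖mx σ‖ + ρ ≤ 2 := by linarith [hm.2]
      calc _ ≤ a * Real.sqrt n * (2 * |‖mx σ‖ - ρ|) := by gcongr
        _ = _ := by ring
    refine (integral_mono (cont_integrable _ (by fun_prop)) (cont_integrable _ (by fun_prop))
      hp).trans ?_
    rw [integral_const_mul]
    calc _ ≤ 2 * a * Real.sqrt n * ((T + 1) / Real.sqrt n) := by gcongr
      _ = _ := by field_simp
  have hI4 : ∫ σ, |dr μ (Hs β) (Wf a (ρ ^ 2)) σ| ∂P ≤ 2 * a * (V1 + 1) := by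
    have hp : ∀ σ : Fin n → UnitSphere (K + 2), |dr μ (Hs β) (Wf a (ρ ^ 2)) σ| =
        2 * a * Real.sqrt n * |D σ| := fun σ => by
      rw [hdr, abs_mul, abs_of_pos (by positivity)]
    simp only [hp]
    rw [integral_const_mul]
    calc _ ≤ 2 * a * Real.sqrt n * ((V1 + 1) / Real.sqrt n) := by gcongr
      _ = _ := by field_simp
  have hst := stein_bound μ hH hWc (δ := 4 * a / Real.sqrt n) (M := 16 * a ^ 2) hκ0
    (fun i σ t => Wf_sub_le hn ha.le (ρ ^ 2) i σ t) (by positivity)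
    (fun σ => Wf_qv_le hn β ha.le (ρ ^ 2) σ) z
  exact final_arith hk hκ0 ha hs1 hT0 hI1 hI2 hI3 hI4 hst

lemma kolm_aux (K : ℕ) (μ : Measure (UnitSphere (K + 2))) [IsProbabilityMeasure μ]
    (hμ : RotInv μ) (β : ℝ) (hβ : 0 < β)
    (b : ℝ) (hb : 0 < b) (hbfix : b = β * besselRatio (K + 2) b)
    (B : ℝ) (hB : 0 < B)
    (hBsq : B ^ 2 = 4 * β ^ 2 / ((1 - β * deriv (besselRatio (K + 2)) b) * b ^ 2) *
      (1 - (((K + 2 : ℕ) : ℝ) - 1) * besselRatio (K + 2) b / b - besselRatio (K + 2) b ^ 2)) :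
    ∃ C > 0, ∀ n : ℕ, 1 ≤ n → ∀ z : ℝ,
      |((gibbsMeasure (K + 2) n β μ) {σ | Wspin (K + 2) n β b σ / B ≤ z}).toReal -
          ((ProbabilityTheory.gaussianReal 0 1) (Set.Iic z)).toReal| ≤ C / Real.sqrt n := by
  have hode := Lm_ODE μ hμ
  rw [besselRatio_eq μ hμ hb] at hbfix
  rw [besselRatio_deriv μ hμ hb, besselRatio_eq μ hμ hb] at hBsq
  set v := Lm μ 2 b / Lm μ 0 b - (Lm μ 1 b / Lm μ 0 b) ^ 2 with hv
  have hvb : 1 - (((K + 2 : ℕ) : ℝ) - 1) * (Lm μ 1 b / Lm μ 0 b) / b - (Lm μ 1 b / Lm μ 0 b) ^ 2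
      = v := by
    have e := hode.ode b hb.le
    have hp := hode.pos b
    rw [hv]
    push_cast at e ⊢
    field_simp
    linear_combination -(Lm μ 0 b) * e
  rw [hvb] at hBsq
  have hκ0 : 0 < 1 - β * v := by
    have h1 := hode.fderiv_lt hb
    rw [← hv] at h1
    have h2 : β * (b * v) < b := by
      calc β * (b * v) < β * (Lm μ 1 b / Lm μ 0 b) := by gcongr
        _ = b := hbfix.symm
    have h3 : b * (β * v) < b * 1 := by linarith
    linarith [lt_of_mul_lt_mul_left h3 hb.le]
  set κ := 1 - β * v with hκ
  set ρ := b / β with hρ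
  have hρ0 : 0 < ρ := by positivity
  have hB2 : B ^ 2 * (κ * ρ ^ 2) = 4 * v := by
    rw [hBsq, hρ]; field_simp
  set a := 1 / (ρ ^ 2 * B) with ha
  have ha0 : 0 < a := by positivity
  have haκ : 4 * a ^ 2 * (2 * ρ ^ 2 * v) = 2 * κ := by
    have : v = B ^ 2 * (κ * ρ ^ 2) / 4 := by linarith
    rw [this, ha]; field_simp
  obtain ⟨C, hC, hbd⟩ := core_bound μ hμ hβ hb hbfix hv hκ hκ0 hρ ha0 haκ
  refine ⟨C, hC, fun n hn z => ?_⟩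
  have hn' : (0:ℝ) < n := by exact_mod_cast hn
  have h := hbd n hn z
  rw [gPhi_eq]
  have e : ∀ σ : Fin n → UnitSphere (K + 2), Wspin (K + 2) n β b σ / B = Wf a (ρ ^ 2) σ := by
    intro σ
    have hm : ‖mx σ‖ = (n:ℝ)⁻¹ * ‖totalSpin σ‖ := by
      unfold mx totalSpin
      rw [norm_smul, Real.norm_eq_abs, abs_of_nonneg (by positivity : (0:ℝ) ≤ (n:ℝ)⁻¹)]
    unfold Wspin Wf
    rw [hm, ha, hρ]
    field_simp
  simp only [e]
  exact h

end

end

noncomputable section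

/-- Kolmogorov bound of the main theorem: for `β > N`,
`sup_z |P(W_n/B ≤ z) - Φ(z)| ≤ C n^{-1/2}`. -/
theorem kolmogorov_bound (N : ℕ) (hN : 2 ≤ N)
    (μ : Measure (UnitSphere N)) [IsProbabilityMeasure μ]
    (hμinv : ∀ e : EuclideanSpace ℝ (Fin N) ≃ₗᵢ[ℝ] EuclideanSpace ℝ (Fin N),
      Measure.map (sphereMap e) μ = μ)
    (β : ℝ) (hβ : (N : ℝ) < β)
    (b : ℝ) (hb : 0 < b) (hbfix : b = β * besselRatio N b)
    (B : ℝ) (hB : 0 < B)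
    (hBsq : B ^ 2 = 4 * β ^ 2 / ((1 - β * deriv (besselRatio N) b) * b ^ 2) *
      (1 - ((N : ℝ) - 1) * besselRatio N b / b - besselRatio N b ^ 2)) :
    ∃ C > 0, ∀ n : ℕ, 1 ≤ n → ∀ z : ℝ,
      |((gibbsMeasure N n β μ) {σ | Wspin N n β b σ / B ≤ z}).toReal -
          ((ProbabilityTheory.gaussianReal 0 1) (Set.Iic z)).toReal| ≤ C / Real.sqrt n := by
  obtain ⟨K, rfl⟩ : ∃ K, N = K + 2 := ⟨N - 2, by omega⟩
  exact kolm_aux K μ hμinv β (lt_of_le_of_lt (Nat.cast_nonneg _) hβ) b hb hbfix B hB hBsq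

end
end

section
/- If in addition |Δ| ≤ a almost surely for a constant a > 0, then sup_{z ∈ ℝ} |P(W ≤ z) − Φ(z)| ≤ E|1 − (1/(2λ)) E(Δ² | W)| + (E|W| + 1) a + E|R|. -/
open MeasureTheory Real
noncomputable section

def szE (t : ℝ) : ℝ := exp (-t ^ 2 / 2)

lemma szE_pos (t : ℝ) : 0 < szE t := exp_pos _

lemma szE_neg (t : ℝ) : szE (-t) = szE t := by simp [szE]

lemma szE_cont : Continuous szE := by unfold szE; fun_prop

lemma szE_eq : szE = fun t => exp (-(1/2) * t ^ 2) := by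
  funext t; unfold szE; congr 1; ring

lemma szE_int : Integrable szE := by
  rw [szE_eq]; exact integrable_exp_neg_mul_sq (by norm_num)

lemma szE_deriv (x : ℝ) : HasDerivAt szE (-x * szE x) x := by
  unfold szE
  have h : HasDerivAt (fun t : ℝ => -t ^ 2 / 2) (-x) x := by
    have := ((hasDerivAt_pow 2 x).neg).div_const 2
    refine this.congr_deriv ?_
    ring
  convert h.exp using 1
  ring

lemma szE_tendsto : Filter.Tendsto szE Filter.atTop (nhds 0) := by
  unfold szE
  refine tendsto_exp_atBot.comp ?_
  have h : Filter.Tendsto (fun t : ℝ => t ^ 2 * (1/2)) Filter.atTop Filter.atTop :=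
    (Filter.tendsto_pow_atTop (by norm_num)).atTop_mul_const (by norm_num)
  refine (Filter.tendsto_neg_atTop_atBot.comp h).congr ?_
  intro t; simp; ring

def szB (x : ℝ) : ℝ := ∫ t in Set.Ioi x, szE t

def szC : ℝ := ∫ t, szE t

lemma szC_eq : szC = √(2 * π) := by
  unfold szC
  rw [szE_eq, integral_gaussian]; congr 1; ring

lemma szB_add (x : ℝ) : szB x + szB (-x) = szC := by
  have h1 : szB (-x) = ∫ t in Set.Iic x, szE t := by
    unfold szB
    have := integral_comp_neg_Iic x szE
    rw [← this]; simp only [szE_neg]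
  rw [h1, add_comm]
  have := integral_add_compl (measurableSet_Iic (a := x)) szE_int
  rw [Set.compl_Iic] at this
  exact this

lemma szB_deriv (x : ℝ) : HasDerivAt szB (-szE x) x := by
  have h : szB = fun y => szB 0 - ∫ t in (0:ℝ)..y, szE t := by
    funext y
    have := intervalIntegral.integral_Ioi_sub_Ioi' (μ := volume) (a := 0) (b := y) (f := szE)
      szE_int.integrableOn szE_int.integrableOn
    unfold szB
    linarith
  rw [h]
  exact (intervalIntegral.integral_hasDerivAt_right (szE_cont.intervalIntegrable _ _)
    (szE_cont.stronglyMeasurableAtFilter _ _) szE_cont.continuousAt).const_sub _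

lemma szB_tendsto : Filter.Tendsto szB Filter.atTop (nhds 0) := by
  have h : szB = fun y => szB 0 - ∫ t in (0:ℝ)..y, szE t := by
    funext y
    have := intervalIntegral.integral_Ioi_sub_Ioi' (μ := volume) (a := 0) (b := y) (f := szE)
      szE_int.integrableOn szE_int.integrableOn
    unfold szB
    linarith
  rw [h]
  have := intervalIntegral_tendsto_integral_Ioi 0 (szE_int.integrableOn) Filter.tendsto_id
  have h2 := this.const_sub (szB 0)
  simpa [szB] using h2

lemma szB_anti : Antitone szB := by
  apply antitone_of_deriv_nonpos
  · exact fun x => (szB_deriv x).differentiableAt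
  · intro x; rw [(szB_deriv x).deriv]; linarith [szE_pos x]

lemma szB_nonneg (x : ℝ) : 0 ≤ szB x := szB_anti.le_of_tendsto szB_tendsto x

lemma szC_pos : 0 < szC := by rw [szC_eq]; positivity

lemma szB_le (x : ℝ) : szB x ≤ szC := by
  have := szB_add x
  linarith [szB_nonneg (-x)]

lemma szB_lower (x : ℝ) : x * szE x ≤ (1 + x ^ 2) * szB x := by
  have hd : ∀ x : ℝ, HasDerivAt (fun y => szB y - y / (1 + y ^ 2) * szE y)
      (-(2 / (1 + x ^ 2) ^ 2 * szE x)) x := by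
    intro x
    have hp : (1 + x ^ 2) ≠ 0 := by positivity
    have h1 : HasDerivAt (fun y : ℝ => 1 + y ^ 2) (2 * x) x := by
      simpa using (hasDerivAt_pow 2 x).const_add 1
    have h2 := (szB_deriv x).sub (((hasDerivAt_id x).div h1 hp).mul (szE_deriv x))
    refine h2.congr_deriv ?_
    simp only [id, Pi.div_apply]
    field_simp
    ring
  have hanti : Antitone (fun y => szB y - y / (1 + y ^ 2) * szE y) := by
    apply antitone_of_deriv_nonpos
    · exact fun x => (hd x).differentiableAt
    · intro x; rw [(hd x).deriv]
      have := szE_pos x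
      have : 0 ≤ 2 / (1 + x ^ 2) ^ 2 * szE x := by positivity
      linarith
  have hlim : Filter.Tendsto (fun y => y / (1 + y ^ 2) * szE y) Filter.atTop (nhds 0) := by
    refine squeeze_zero_norm (fun y => ?_) szE_tendsto
    rw [norm_mul, Real.norm_eq_abs, Real.norm_eq_abs, abs_of_pos (szE_pos y)]
    have : |y / (1 + y ^ 2)| ≤ 1 := by
      rw [abs_div, abs_of_pos (by positivity : 0 < 1 + y ^ 2), div_le_one (by positivity)]
      rw [abs_le]; constructor <;> nlinarith [sq_nonneg (y - 1), sq_nonneg (y + 1)]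
    have := mul_le_mul_of_nonneg_right this (szE_pos y).le
    linarith
  have h0 := hanti.le_of_tendsto (by simpa using szB_tendsto.sub hlim) x
  have hp : 0 < (1 + x ^ 2) := by positivity
  have h1 : x / (1 + x ^ 2) * szE x ≤ szB x := by linarith
  rw [div_mul_eq_mul_div, div_le_iff₀ hp] at h1
  linarith

lemma szB_upper (x : ℝ) (hx : 0 < x) : (x ^ 3 + 3 * x) * szB x ≤ (x ^ 2 + 2) * szE x := by
  have hd : ∀ x : ℝ, 0 < x → HasDerivAt (fun y => (y ^ 2 + 2) / (y ^ 3 + 3 * y) * szE y - szB y)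
      (-(6 / (x ^ 3 + 3 * x) ^ 2 * szE x)) x := by
    intro x hx
    have hp : (x ^ 3 + 3 * x) ≠ 0 := by positivity
    have h1 : HasDerivAt (fun y : ℝ => y ^ 2 + 2) (2 * x) x := by
      simpa using (hasDerivAt_pow 2 x).add_const 2
    have h3 : HasDerivAt (fun y : ℝ => y ^ 3 + 3 * y) (3 * x ^ 2 + 3) x := by
      refine ((hasDerivAt_pow 3 x).add ((hasDerivAt_id x).const_mul 3)).congr_deriv ?_
      norm_num
    have h2 := (((h1.div h3 hp).mul (szE_deriv x))).sub (szB_deriv x)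
    refine h2.congr_deriv ?_
    have hq : x ^ 2 + 3 ≠ 0 := by positivity
    have : x ^ 3 + 3 * x = x * (x ^ 2 + 3) := by ring
    simp only [Pi.div_apply]
    rw [this]
    field_simp
    ring
  have hanti : AntitoneOn (fun y => (y ^ 2 + 2) / (y ^ 3 + 3 * y) * szE y - szB y)
      (Set.Ioi 0) := by
    apply antitoneOn_of_deriv_nonpos (convex_Ioi 0)
    · exact fun x hx => (hd x hx).continuousAt.continuousWithinAt
    · rw [interior_Ioi]
      exact fun x hx => (hd x hx).differentiableAt.differentiableWithinAt
    · rw [interior_Ioi]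
      intro x hx; rw [(hd x hx).deriv]
      have := szE_pos x
      have : 0 ≤ 6 / (x ^ 3 + 3 * x) ^ 2 * szE x := by positivity
      linarith
  have hlim : Filter.Tendsto (fun y => (y ^ 2 + 2) / (y ^ 3 + 3 * y) * szE y)
      Filter.atTop (nhds 0) := by
    refine squeeze_zero_norm' ?_ szE_tendsto
    filter_upwards [Filter.eventually_ge_atTop 1] with y hy
    have hy0 : 0 < y := by linarith
    rw [norm_mul, Real.norm_eq_abs, Real.norm_eq_abs, abs_of_pos (szE_pos y)]
    have : |(y ^ 2 + 2) / (y ^ 3 + 3 * y)| ≤ 1 := by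
      rw [abs_of_pos (by positivity), div_le_one (by positivity)]
      nlinarith [mul_nonneg (sq_nonneg y) (sub_nonneg.2 hy)]
    have := mul_le_mul_of_nonneg_right this (szE_pos y).le
    linarith
  have h0 : 0 ≤ (x ^ 2 + 2) / (x ^ 3 + 3 * x) * szE x - szB x := by
    refine le_of_tendsto (by simpa using hlim.sub szB_tendsto) ?_
    filter_upwards [Filter.eventually_ge_atTop x] with y hy
    exact hanti hx (lt_of_lt_of_le hx hy) hy
  have hp : 0 < (x ^ 3 + 3 * x) := by positivity
  have h1 : szB x ≤ (x ^ 2 + 2) / (x ^ 3 + 3 * x) * szE x := by linarith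
  rw [div_mul_eq_mul_div, le_div_iff₀ hp] at h1
  linarith

def szN (x : ℝ) : ℝ := szB x / szE x

lemma szN_nonneg (x : ℝ) : 0 ≤ szN x := div_nonneg (szB_nonneg x) (szE_pos x).le

lemma szN_lower (x : ℝ) : x ≤ (1 + x ^ 2) * szN x := by
  unfold szN
  rw [← mul_div_assoc, le_div_iff₀ (szE_pos x)]; exact szB_lower x

lemma szN_upper (x : ℝ) (hx : 0 < x) : (x ^ 3 + 3 * x) * szN x ≤ x ^ 2 + 2 := by
  unfold szN
  rw [← mul_div_assoc, div_le_iff₀ (szE_pos x)]; exact szB_upper x hx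

lemma szN_mul_le (x : ℝ) : x * szN x ≤ 1 := by
  rcases le_or_gt x 0 with h | h
  · nlinarith [szN_nonneg x]
  · have := szN_upper x h
    have h2 : (x ^ 2 + 3) * (x * szN x) ≤ (x ^ 2 + 3) * 1 := by nlinarith
    exact le_of_mul_le_mul_left h2 (by positivity)

lemma szN_le_one (x : ℝ) (hx : 3 / 4 ≤ x) : szN x ≤ 1 := by
  have := szN_upper x (by linarith)
  have h2 : (x ^ 3 + 3 * x) * szN x ≤ (x ^ 3 + 3 * x) * 1 := by
    nlinarith [mul_nonneg (sq_nonneg x) (sub_nonneg.2 hx), mul_nonneg (sub_nonneg.2 hx) (sub_nonneg.2 hx)]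
  exact le_of_mul_le_mul_left h2 (by positivity)

lemma szN_deriv (x : ℝ) : HasDerivAt szN (x * szN x - 1) x := by
  have := (szB_deriv x).div (szE_deriv x) (szE_pos x).ne'
  refine this.congr_deriv ?_
  unfold szN
  have := (szE_pos x).ne'
  field_simp
  ring

lemma sz_swap (w : ℝ) : szN (-w) * szB w = szN w * szB (-w) := by
  unfold szN; rw [szE_neg]; ring

lemma sz_prod_aux (w : ℝ) (hw : 0 ≤ w) : szN w * szB (-w) ≤ szC := by
  rcases le_or_gt (3/4) w with h | h
  · have := szN_le_one w h
    nlinarith [szB_le (-w), szB_nonneg (-w), szN_nonneg w]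
  · unfold szN
    rw [div_mul_eq_mul_div, div_le_iff₀ (szE_pos w)]
    have h1 : szB w * szB (-w) ≤ szC ^ 2 / 4 := by
      rw [← szB_add w]; nlinarith [sq_nonneg (szB w - szB (-w))]
    have h2 : 23 / 32 ≤ szE w := by
      have := add_one_le_exp (-w ^ 2 / 2)
      unfold szE
      nlinarith
    have h3 : szC ≤ 23 / 8 := by
      rw [szC_eq, sqrt_le_left (by norm_num)]
      linarith [pi_lt_d2]
    have := szC_pos
    nlinarith

lemma sz_prod (w : ℝ) : szN (-w) * szB w ≤ szC := by
  rcases le_total 0 w with h | h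
  · rw [sz_swap]; exact sz_prod_aux w h
  · have := sz_prod_aux (-w) (by linarith)
    simpa using this

/-- `x * N(-x)` is monotone -/
lemma sz_mono : Monotone (fun w => w * szN (-w)) := by
  have hd : ∀ x : ℝ, HasDerivAt (fun w => w * szN (-w)) ((1 + x ^ 2) * szN (-x) + x) x := by
    intro x
    have h1 : HasDerivAt (fun w => szN (-w)) ((-x * szN (-x) - 1) * (-1)) x :=
      (szN_deriv (-x)).comp x (hasDerivAt_neg x)
    refine ((hasDerivAt_id x).mul h1).congr_deriv ?_
    simp only [id]; ring
  apply monotone_of_deriv_nonneg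
  · exact fun x => (hd x).differentiableAt
  · intro x; rw [(hd x).deriv]
    have := szN_lower (-x)
    simp only [neg_sq] at this
    linarith

lemma sz_gauss (z : ℝ) :
    ((ProbabilityTheory.gaussianReal 0 1) (Set.Iic z)).toReal = szB (-z) / szC := by
  rw [ProbabilityTheory.gaussianReal_apply_eq_integral _ (by norm_num),
    ENNReal.toReal_ofReal (integral_nonneg fun x => ProbabilityTheory.gaussianPDFReal_nonneg _ _ _)]
  have h1 : szB (-z) = ∫ t in Set.Iic z, szE t := by
    unfold szB
    have := integral_comp_neg_Iic z szE
    rw [← this]; simp only [szE_neg]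
  rw [h1, ← integral_div]
  congr 1
  funext t
  rw [szC_eq]
  simp [ProbabilityTheory.gaussianPDFReal, szE]
  field_simp

lemma sz_incr (F : ℝ → ℝ) (κ : ℝ) (hF : ∀ w, HasDerivAt F (w * F w + κ) w)
    (hm : Monotone fun w => w * F w) (x y : ℝ) (hxy : x ≤ y) :
    (y - x) * (x * F x + κ) ≤ F y - F x ∧ F y - F x ≤ (y - x) * (y * F y + κ) := by
  rcases hxy.eq_or_lt with rfl | h
  · simp
  · obtain ⟨c, hc, hc2⟩ := exists_hasDerivAt_eq_slope F _ h
      (fun w _ => (hF w).continuousAt.continuousWithinAt) (fun w _ => hF w)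
    have hp : 0 < y - x := by linarith
    rw [eq_div_iff hp.ne'] at hc2
    have h1 : x * F x ≤ c * F c := hm hc.1.le
    have h2 : c * F c ≤ y * F y := hm hc.2.le
    rw [← hc2]
    constructor <;> nlinarith

def szh (z w : ℝ) : ℝ := if w ≤ z then 1 else 0

def szp (z : ℝ) : ℝ := szB (-z) / szC

def szF (z w : ℝ) : ℝ := if w ≤ z then szN (-w) * (1 - szp z) else szN w * szp z

lemma szp_nonneg (z : ℝ) : 0 ≤ szp z := div_nonneg (szB_nonneg _) szC_pos.le

lemma szp_compl (z : ℝ) : 1 - szp z = szB z / szC := by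
  unfold szp
  have := szC_pos
  field_simp
  linarith [szB_add z]

lemma szp_neg (z : ℝ) : szp (-z) = 1 - szp z := by
  rw [szp_compl]; simp [szp]

lemma szp_le (z : ℝ) : szp z ≤ 1 := by
  have := szp_nonneg (-z); rw [szp_neg] at this; linarith

lemma szF_at (z : ℝ) : szN (-z) * (1 - szp z) = szN z * szp z := by
  rw [szp_compl, szp, ← mul_div_assoc, sz_swap, mul_div_assoc]

lemma szF_right (z w : ℝ) (h : z ≤ w) : szF z w = szN w * szp z := by
  unfold szF
  split_ifs with h1
  · have : w = z := le_antisymm h1 h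
    subst this; exact szF_at w
  · rfl

lemma szF_left (z w : ℝ) (h : w ≤ z) : szF z w = szN (-w) * (1 - szp z) := if_pos h

lemma szF_symm (z w : ℝ) : szF z w = szF (-z) (-w) := by
  rcases le_total w z with h | h
  · rw [szF_left z w h, szF_right (-z) (-w) (by linarith), szp_neg]
  · rw [szF_right z w h, szF_left (-z) (-w) (by linarith), szp_neg]; simp

lemma szF_nonneg (z w : ℝ) : 0 ≤ szF z w := by
  have := szp_nonneg z
  have := szp_le z
  unfold szF
  split_ifs
  · exact mul_nonneg (szN_nonneg _) (by linarith)
  · exact mul_nonneg (szN_nonneg _) (by linarith)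

lemma szF_le_aux (z w : ℝ) (h : w ≤ z) : szF z w ≤ 1 := by
  rw [szF_left z w h, szp_compl, ← mul_div_assoc, div_le_one szC_pos]
  calc _ ≤ szN (-w) * szB w := mul_le_mul_of_nonneg_left (szB_anti h) (szN_nonneg _)
    _ ≤ _ := sz_prod w

lemma szF_le (z w : ℝ) : szF z w ≤ 1 := by
  rcases le_total w z with h | h
  · exact szF_le_aux z w h
  · rw [szF_symm]; exact szF_le_aux _ _ (by linarith)

lemma szG_aux (z w : ℝ) (h : w ≤ z) : -(1 - szp z) ≤ w * szF z w ∧ w * szF z w ≤ szp z := by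
  have hp0 := szp_nonneg z
  have hp1 := szp_le z
  constructor
  · rw [szF_left z w h]
    have := szN_mul_le (-w)
    nlinarith
  · rcases le_or_gt w 0 with h0 | h0
    · nlinarith [szF_nonneg z w]
    · rw [szF_left z w h, szp_compl, szp, ← mul_div_assoc, ← mul_div_assoc]
      refine div_le_div_of_nonneg_right ?_ szC_pos.le
      calc w * (szN (-w) * szB z) ≤ w * (szN (-w) * szB w) := by
            have := szB_anti h
            have := szN_nonneg (-w)
            gcongr
        _ = (w * szN w) * szB (-w) := by rw [sz_swap]; ring
        _ ≤ 1 * szB (-w) := mul_le_mul_of_nonneg_right (szN_mul_le w) (szB_nonneg _)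
        _ ≤ szB (-z) := by rw [one_mul]; exact szB_anti (by linarith)

lemma szG_bound (z w : ℝ) : -(1 - szp z) ≤ w * szF z w ∧ w * szF z w ≤ szp z := by
  rcases le_total w z with h | h
  · exact szG_aux z w h
  · have := szG_aux (-z) (-w) (by linarith)
    rw [← szF_symm, szp_neg] at this
    constructor <;> linarith

lemma szF_mono (z : ℝ) : Monotone fun w => w * szF z w := by
  have hp0 := szp_nonneg z
  have hp1 := szp_le z
  have hl : ∀ x y, x ≤ y → y ≤ z → x * szF z x ≤ y * szF z y := by
    intro x y hxy hy
    rw [szF_left z x (hxy.trans hy), szF_left z y hy]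
    have : x * szN (-x) ≤ y * szN (-y) := sz_mono hxy
    nlinarith
  have hr : ∀ x y, x ≤ y → z ≤ x → x * szF z x ≤ y * szF z y := by
    intro x y hxy hy
    rw [szF_right z x hy, szF_right z y (hy.trans hxy)]
    have := sz_mono (neg_le_neg hxy)
    simp only [neg_neg] at this
    nlinarith
  intro x y hxy
  rcases le_total y z with h | h
  · exact hl x y hxy h
  · rcases le_total z x with h2 | h2
    · exact hr x y hxy h2
    · exact (hl x z h2 le_rfl).trans (hr z y h le_rfl)

lemma szF_incr (z x y : ℝ) (hxy : x ≤ y) :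
    (y - x) * (x * szF z x + szh z y - szp z) ≤ szF z y - szF z x ∧
    szF z y - szF z x ≤ (y - x) * (y * szF z y + szh z x - szp z) := by
  have hp0 := szp_nonneg z
  have hp1 := szp_le z
  have hl : ∀ x y, x ≤ y → y ≤ z → (y - x) * (x * szF z x + (1 - szp z)) ≤ szF z y - szF z x ∧
      szF z y - szF z x ≤ (y - x) * (y * szF z y + (1 - szp z)) := by
    intro x y hxy hy
    rw [szF_left z x (hxy.trans hy), szF_left z y hy]
    refine sz_incr (fun w => szN (-w) * (1 - szp z)) _ ?_ ?_ x y hxy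
    · intro w
      have h1 : HasDerivAt (fun w => szN (-w)) ((-w * szN (-w) - 1) * (-1)) w :=
        (szN_deriv (-w)).comp w (hasDerivAt_neg w)
      refine (h1.mul_const _).congr_deriv ?_
      ring
    · intro x y hxy
      have : x * szN (-x) ≤ y * szN (-y) := sz_mono hxy
      simp only
      nlinarith
  have hr : ∀ x y, x ≤ y → z ≤ x → (y - x) * (x * szF z x + (- szp z)) ≤ szF z y - szF z x ∧
      szF z y - szF z x ≤ (y - x) * (y * szF z y + (- szp z)) := by
    intro x y hxy hy
    rw [szF_right z x hy, szF_right z y (hy.trans hxy)]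
    refine sz_incr (fun w => szN w * szp z) _ ?_ ?_ x y hxy
    · intro w
      refine ((szN_deriv w).mul_const _).congr_deriv ?_
      ring
    · intro x y hxy
      have := sz_mono (neg_le_neg hxy)
      simp only [neg_neg] at this
      simp only
      nlinarith
  rcases le_or_gt y z with h | h
  · have := hl x y hxy h
    simp only [szh, if_pos h, if_pos (hxy.trans h)]
    constructor <;> linarith
  · rcases lt_or_ge z x with h2 | h2
    · have := hr x y hxy h2.le
      simp only [szh, if_neg (not_le.2 h), if_neg (not_le.2 h2)]
      constructor <;> linarith
    · have h3 := hl x z h2 le_rfl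
      have h4 := hr z y h.le le_rfl
      simp only [szh, if_neg (not_le.2 h), if_pos h2]
      have m1 : x * szF z x ≤ z * szF z z := szF_mono z h2
      have m2 : z * szF z z ≤ y * szF z y := szF_mono z h.le
      constructor <;> nlinarith

lemma szh_meas (z : ℝ) : Measurable (szh z) :=
  Measurable.ite measurableSet_Iic measurable_const measurable_const

lemma szF_meas (z : ℝ) : Measurable (szF z) := by
  have hc : Measurable szN :=
    (continuous_iff_continuousAt.2 fun x => (szN_deriv x).continuousAt).measurable
  exact Measurable.ite measurableSet_Iic ((hc.comp measurable_neg).mul_const _) (hc.mul_const _)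

/-- Existence of the Stein solution with all needed properties. -/
lemma sz_stein (z : ℝ) : ∃ f g h : ℝ → ℝ, ∃ p : ℝ, Measurable f ∧ Measurable g ∧ Measurable h ∧
    p = ((ProbabilityTheory.gaussianReal 0 1) (Set.Iic z)).toReal ∧
    (∀ w, h w = (Set.Iic z).indicator 1 w) ∧ (∀ w, g w = w * f w) ∧
    (∀ w, |f w| ≤ 1) ∧ (∀ w, |g w| ≤ 1) ∧ (∀ w, |h w| ≤ 1) ∧ (∀ w, |g w + h w - p| ≤ 1) ∧
    Monotone g ∧ Antitone h ∧
    (∀ x y, x ≤ y → (y - x) * (g x + h y - p) ≤ f y - f x ∧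
      f y - f x ≤ (y - x) * (g y + h x - p)) := by
  have hp0 := szp_nonneg z
  have hp1 := szp_le z
  refine ⟨szF z, fun w => w * szF z w, szh z, szp z, szF_meas z, measurable_id.mul (szF_meas z),
    szh_meas z, (sz_gauss z).symm, ?_, fun _ => rfl, ?_, ?_, ?_, ?_, szF_mono z, ?_, szF_incr z⟩
  · intro w; simp [szh, Set.indicator_apply]
  · intro w; rw [abs_of_nonneg (szF_nonneg z w)]; exact szF_le z w
  · intro w; have := szG_bound z w
    rw [abs_le]; constructor <;> linarith
  · intro w; unfold szh; split_ifs <;> simp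
  · intro w
    have hb := szG_bound z w
    simp only [szh]
    split_ifs with h
    · rw [abs_le]; constructor <;> linarith
    · rw [abs_le]; constructor <;> linarith
  · intro x y hxy
    unfold szh
    split_ifs <;> linarith

lemma sz_bi {Ω : Type*} [MeasurableSpace Ω] {P : Measure Ω} (ψ : ℝ → ℝ) (C : ℝ)
    (hψ : Measurable ψ) (hC : ∀ w, |ψ w| ≤ C) (V X : Ω → ℝ) (hV : AEMeasurable V P)
    (hX : Integrable X P) : Integrable (fun ω => ψ (V ω) * X ω) P :=
  Integrable.bdd_mul hX (hψ.comp_aemeasurable hV).aestronglyMeasurable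
    (Filter.Eventually.of_forall fun ω => hC (V ω))

lemma sz_pull {Ω : Type*} [MeasurableSpace Ω] {P : Measure Ω} [IsProbabilityMeasure P]
    (ψ : ℝ → ℝ) (C : ℝ)
    (hψ : Measurable ψ) (hC : ∀ w, |ψ w| ≤ C) (W X : Ω → ℝ) (hW : Measurable W)
    (hX : Integrable X P) :
    ∫ ω, ψ (W ω) * X ω ∂P =
      ∫ ω, ψ (W ω) * (P[X | MeasurableSpace.comap W Real.measurableSpace]) ω ∂P := by
  have hm : MeasurableSpace.comap W Real.measurableSpace ≤ _ := hW.comap_le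
  rw [← integral_condExp hm]
  refine integral_congr_ae ?_
  have hs : StronglyMeasurable[MeasurableSpace.comap W Real.measurableSpace]
      (fun ω => ψ (W ω)) :=
    (hψ.comp (comap_measurable W)).stronglyMeasurable
  exact condExp_mul_of_stronglyMeasurable_left hs (sz_bi ψ C hψ hC W X hW.aemeasurable hX) hX

lemma sz_swap_int {Ω : Type*} [MeasurableSpace Ω] {P : Measure Ω}
    (W W' : Ω → ℝ) (hW : AEMeasurable W P) (hW' : AEMeasurable W' P)
    (hexch : Measure.map (fun ω => (W ω, W' ω)) P = Measure.map (fun ω => (W' ω, W ω)) P)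
    (F : ℝ → ℝ → ℝ) (hF : Measurable (fun x : ℝ × ℝ => F x.1 x.2)) :
    ∫ ω, F (W ω) (W' ω) ∂P = ∫ ω, F (W' ω) (W ω) ∂P := by
  have h1 := integral_map (hW.prodMk hW') (f := fun x : ℝ × ℝ => F x.1 x.2)
    hF.aestronglyMeasurable
  have h2 := integral_map (hW'.prodMk hW) (f := fun x : ℝ × ℝ => F x.1 x.2)
    hF.aestronglyMeasurable
  simp only at h1 h2
  rw [← h1, ← h2, hexch]

def szU (g h : ℝ → ℝ) (x y : ℝ) : ℝ :=
  max (x - y) 0 * (g x - g y) + max (y - x) 0 * (h x - h y)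

lemma szU_add (g h : ℝ → ℝ) (x y : ℝ) :
    szU g h x y + szU g h y x = (x - y) * ((g x - h x) - (g y - h y)) := by
  unfold szU
  rcases le_total x y with hxy | hxy
  · rw [max_eq_right (by linarith), max_eq_left (by linarith)]; ring
  · rw [max_eq_left (by linarith), max_eq_right (by linarith)]; ring

lemma szU_upper (f g h : ℝ → ℝ) (p a : ℝ) (hg : Monotone g) (hh : Antitone h)
    (hinc : ∀ x y, x ≤ y → (y - x) * (g x + h y - p) ≤ f y - f x ∧
      f y - f x ≤ (y - x) * (g y + h x - p)) (x y : ℝ) (hxy : |x - y| ≤ a) :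
    (x - y) ^ 2 * (g x + h x - p) - (x - y) * (f x - f y) ≤ a * szU g h x y ∧
    -(a * szU g h y x) ≤ (x - y) ^ 2 * (g x + h x - p) - (x - y) * (f x - f y) := by
  rw [abs_le] at hxy
  unfold szU
  rcases le_total x y with h1 | h1
  · rw [max_eq_right (by linarith), max_eq_left (by linarith : 0 ≤ y - x)]
    obtain ⟨i1, i2⟩ := hinc x y h1
    have hg' := hg h1
    have hh' := hh h1
    have hp : 0 ≤ y - x := by linarith
    have j1 := mul_le_mul_of_nonneg_left i1 hp
    have j2 := mul_le_mul_of_nonneg_left i2 hp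
    have k1 := mul_nonneg (mul_nonneg hp (sub_nonneg.2 hg')) (by linarith : 0 ≤ a - (y - x))
    have k2 := mul_nonneg (mul_nonneg hp (sub_nonneg.2 hh')) (by linarith : 0 ≤ a - (y - x))
    constructor <;> nlinarith
  · rw [max_eq_left (by linarith : 0 ≤ x - y), max_eq_right (by linarith)]
    obtain ⟨i1, i2⟩ := hinc y x h1
    have hg' := hg h1
    have hh' := hh h1
    have hp : 0 ≤ x - y := by linarith
    have j1 := mul_le_mul_of_nonneg_left i1 hp
    have j2 := mul_le_mul_of_nonneg_left i2 hp
    have k1 := mul_nonneg (mul_nonneg hp (sub_nonneg.2 hg')) (by linarith : 0 ≤ a - (x - y))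
    have k2 := mul_nonneg (mul_nonneg hp (sub_nonneg.2 hh')) (by linarith : 0 ≤ a - (x - y))
    constructor <;> nlinarith

lemma sz_main {Ω : Type*} [MeasurableSpace Ω]
    (P : Measure Ω) [IsProbabilityMeasure P]
    (W W' R : Ω → ℝ) (hWm : Measurable W)
    (hW : Integrable W P) (hW' : Integrable W' P) (hR : Integrable R P)
    (hexch : Measure.map (fun ω => (W ω, W' ω)) P = Measure.map (fun ω => (W' ω, W ω)) P)
    (lam : ℝ) (hlam₀ : 0 < lam)
    (hcond : P[fun ω => W ω - W' ω | MeasurableSpace.comap W Real.measurableSpace]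
      =ᵐ[P] fun ω => lam * (W ω + R ω))
    (a : ℝ) (ha : 0 < a) (hΔ : ∀ᵐ ω ∂P, |W ω - W' ω| ≤ a) (z : ℝ) :
      |(P {ω | W ω ≤ z}).toReal -
          ((ProbabilityTheory.gaussianReal 0 1) (Set.Iic z)).toReal| ≤
        (∫ ω, |1 - 1 / (2 * lam) *
            (P[fun ω => (W ω - W' ω) ^ 2 |
              MeasurableSpace.comap W Real.measurableSpace]) ω| ∂P)
        + a * ((∫ ω, |W ω| ∂P) + ∫ ω, |R ω| ∂P)
        + ∫ ω, |R ω| ∂P := by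
  obtain ⟨f, g, h, p, hfm, hgm, hhm, hp, hh, hg, hf1, hg1, hh1, hk1, hgmono, hhanti, hinc⟩ :=
    sz_stein z
  rw [← hp]
  have hWa := hWm.aemeasurable (μ := P)
  have hWa' := hW'.aemeasurable
  have hD : Integrable (fun ω => W ω - W' ω) P := hW.sub hW'
  have hD2 : Integrable (fun ω => (W ω - W' ω) ^ 2) P := by
    have : Integrable (fun ω => (W ω - W' ω) * (W ω - W' ω)) P :=
      Integrable.bdd_mul hD hD.aestronglyMeasurable (c := a) hΔ
    simpa [sq] using this
  set q := P[fun ω => (W ω - W' ω) ^ 2 | MeasurableSpace.comap W Real.measurableSpace] with hq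
  have hqi : Integrable q P := integrable_condExp
  -- pull out
  have hpull : ∀ (ψ : ℝ → ℝ) (C : ℝ), Measurable ψ → (∀ w, |ψ w| ≤ C) →
      ∫ ω, ψ (W ω) * (W ω - W' ω) ∂P = lam * ∫ ω, ψ (W ω) * (W ω + R ω) ∂P := by
    intro ψ C hψ hC
    rw [sz_pull ψ C hψ hC W _ hWm hD, ← integral_const_mul]
    refine integral_congr_ae ?_
    filter_upwards [hcond] with ω hω
    rw [hω]; ring
  have hanti : ∀ (ψ : ℝ → ℝ), Measurable ψ →
      ∫ ω, ψ (W' ω) * (W ω - W' ω) ∂P = - ∫ ω, ψ (W ω) * (W ω - W' ω) ∂P := by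
    intro ψ hψ
    rw [sz_swap_int W W' hWa hWa' hexch (fun x y => ψ y * (x - y)) (by fun_prop), ← integral_neg]
    congr 1; funext ω; ring
  -- step 1
  have e1 : ∫ ω, f (W ω) * (W ω - W' ω) ∂P = lam * (∫ ω, g (W ω) ∂P + ∫ ω, f (W ω) * R ω ∂P) := by
    rw [hpull f 1 hfm hf1]
    congr 1
    have : ∀ ω, f (W ω) * (W ω + R ω) = g (W ω) + f (W ω) * R ω := by
      intro ω; rw [hg]; ring
    simp_rw [this]
    refine integral_add ?_ (sz_bi f 1 hfm hf1 W R hWa hR)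
    simpa using sz_bi g 1 hgm hg1 W (fun _ => (1:ℝ)) hWa (integrable_const 1)
  have e2 := hanti f hfm
  -- J
  have hψm : Measurable (fun w => g w - h w) := hgm.sub hhm
  have hψ2 : ∀ w, |g w - h w| ≤ 2 := by
    intro w
    have h1 := abs_sub (g w) (h w)
    linarith [hg1 w, hh1 w]
  set J := ∫ ω, (g (W ω) - h (W ω)) * (W ω - W' ω) ∂P with hJ
  have hJ1 : J = lam * ∫ ω, (g (W ω) - h (W ω)) * (W ω + R ω) ∂P :=
    hpull (fun w => g w - h w) 2 hψm hψ2
  have hJ2 : J ≤ lam * (2 * (∫ ω, |W ω| ∂P + ∫ ω, |R ω| ∂P)) := by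
    rw [hJ1]
    refine mul_le_mul_of_nonneg_left ?_ hlam₀.le
    rw [← integral_add hW.abs hR.abs, ← integral_const_mul]
    refine integral_mono (sz_bi _ 2 hψm hψ2 W _ hWa (hW.add hR))
      ((hW.abs.add hR.abs).const_mul 2) ?_
    intro ω
    calc _ ≤ |(g (W ω) - h (W ω)) * (W ω + R ω)| := le_abs_self _
      _ = |g (W ω) - h (W ω)| * |W ω + R ω| := abs_mul _ _
      _ ≤ 2 * (|W ω| + |R ω|) :=
        mul_le_mul (hψ2 _) (abs_add_le _ _) (abs_nonneg _) (by norm_num)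
  have hUm : Measurable (fun x : ℝ × ℝ => szU g h x.1 x.2) := by
    unfold szU; fun_prop
  have hUb : ∀ x y, |szU g h x y| ≤ 4 * |x - y| := by
    intro x y
    have b1 : |g x - g y| ≤ 2 := (abs_sub _ _).trans (by linarith [hg1 x, hg1 y])
    have b2 : |h x - h y| ≤ 2 := (abs_sub _ _).trans (by linarith [hh1 x, hh1 y])
    have c1 : |max (x - y) 0| ≤ |x - y| := by
      rw [abs_of_nonneg (le_max_right _ _)]; exact max_le (le_abs_self _) (abs_nonneg _)
    have c2 : |max (y - x) 0| ≤ |x - y| := by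
      rw [abs_of_nonneg (le_max_right _ _), abs_sub_comm]
      exact max_le (le_abs_self _) (abs_nonneg _)
    unfold szU
    refine (abs_add_le _ _).trans ?_
    rw [abs_mul, abs_mul]
    have d1 := mul_le_mul c1 b1 (abs_nonneg _) (abs_nonneg _)
    have d2 := mul_le_mul c2 b2 (abs_nonneg _) (abs_nonneg _)
    linarith
  have hU1 : Integrable (fun ω => szU g h (W ω) (W' ω)) P := by
    refine Integrable.mono' (hD.abs.const_mul 4)
      (hUm.comp_aemeasurable (hWa.prodMk hWa')).aestronglyMeasurable ?_
    exact Filter.Eventually.of_forall fun ω => hUb _ _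
  have hU2 : Integrable (fun ω => szU g h (W' ω) (W ω)) P := by
    refine Integrable.mono' (hD.abs.const_mul 4)
      (hUm.comp_aemeasurable (hWa'.prodMk hWa)).aestronglyMeasurable ?_
    refine Filter.Eventually.of_forall fun ω => ?_
    rw [abs_sub_comm]; exact hUb _ _
  have hUs := sz_swap_int W W' hWa hWa' hexch (szU g h) hUm
  have hUa : ∫ ω, szU g h (W ω) (W' ω) ∂P + ∫ ω, szU g h (W' ω) (W ω) ∂P = 2 * J := by
    rw [← integral_add hU1 hU2]
    simp_rw [szU_add]
    have h1 := hanti (fun w => g w - h w) hψm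
    have h2 := integral_sub (sz_bi _ 2 hψm hψ2 W _ hWa hD) (sz_bi _ 2 hψm hψ2 W' _ hWa' hD)
    have h3 : ∀ ω, (W ω - W' ω) * (g (W ω) - h (W ω) - (g (W' ω) - h (W' ω)))
      = (g (W ω) - h (W ω)) * (W ω - W' ω) - (g (W' ω) - h (W' ω)) * (W ω - W' ω) := by
      intro ω; ring
    simp_rw [h3]
    rw [h2, h1]; ring
  -- I
  have hkm : Measurable (fun w => g w + h w - p) := (hgm.add hhm).sub_const p
  have i1 := sz_bi _ 1 hkm hk1 W _ hWa hD2
  have i2 := sz_bi f 1 hfm hf1 W _ hWa hD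
  have i3 := sz_bi f 1 hfm hf1 W' _ hWa' hD
  have hIeq : ∀ ω, (W ω - W' ω) ^ 2 * (g (W ω) + h (W ω) - p)
      - (W ω - W' ω) * (f (W ω) - f (W' ω)) =
      (g (W ω) + h (W ω) - p) * (W ω - W' ω) ^ 2 -
        (f (W ω) * (W ω - W' ω) - f (W' ω) * (W ω - W' ω)) := by intro ω; ring
  have i4 : Integrable (fun ω => (W ω - W' ω) ^ 2 * (g (W ω) + h (W ω) - p)
      - (W ω - W' ω) * (f (W ω) - f (W' ω))) P := by
    simp_rw [hIeq]; exact i1.sub (i2.sub i3)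
  set I := ∫ ω, ((W ω - W' ω) ^ 2 * (g (W ω) + h (W ω) - p)
      - (W ω - W' ω) * (f (W ω) - f (W' ω))) ∂P with hI
  have hI1 : I = ∫ ω, (g (W ω) + h (W ω) - p) * q ω ∂P
      - 2 * ∫ ω, f (W ω) * (W ω - W' ω) ∂P := by
    rw [hI]
    simp_rw [hIeq]
    have h1 := integral_sub i1 (i2.sub i3)
    have h2 := integral_sub i2 i3
    simp only [Pi.sub_apply] at h1
    rw [h1, h2, e2, sz_pull _ 1 hkm hk1 W _ hWm hD2]
    ring
  have hIu : I ≤ a * J := by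
    have : I ≤ ∫ ω, a * szU g h (W ω) (W' ω) ∂P := by
      refine integral_mono_ae i4 (hU1.const_mul a) ?_
      filter_upwards [hΔ] with ω hω
      exact (szU_upper f g h p a hgmono hhanti hinc _ _ hω).1
    rw [integral_const_mul] at this
    have e : ∫ ω, szU g h (W ω) (W' ω) ∂P = J := by linarith
    rwa [e] at this
  have hIl : -(a * J) ≤ I := by
    have : ∫ ω, -(a * szU g h (W' ω) (W ω)) ∂P ≤ I := by
      refine integral_mono_ae (hU2.const_mul a).neg i4 ?_
      filter_upwards [hΔ] with ω hω
      exact (szU_upper f g h p a hgmono hhanti hinc _ _ hω).2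
    rw [integral_neg, integral_const_mul] at this
    have e : ∫ ω, szU g h (W' ω) (W ω) ∂P = J := by linarith
    rwa [e] at this
  -- probability
  have hone : ∀ ψ : ℝ → ℝ, Measurable ψ → (∀ w, |ψ w| ≤ 1) → Integrable (fun ω => ψ (W ω)) P := by
    intro ψ h1 h2
    simpa using sz_bi ψ 1 h1 h2 W (fun _ => (1:ℝ)) hWa (integrable_const 1)
  have hprob : ∫ ω, h (W ω) ∂P = (P {ω | W ω ≤ z}).toReal := by
    have : (fun ω => h (W ω)) = ({ω | W ω ≤ z} : Set Ω).indicator 1 := by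
      funext ω; rw [hh]; simp [Set.indicator_apply]
    have hs : MeasurableSet {ω | W ω ≤ z} := hWm measurableSet_Iic
    rw [this]
    exact integral_indicator_one hs
  have hk : ∫ ω, (g (W ω) + h (W ω) - p) ∂P =
      ∫ ω, g (W ω) ∂P + (P {ω | W ω ≤ z}).toReal - p := by
    have h1 := integral_sub ((hone g hgm hg1).add (hone h hhm hh1)) (integrable_const (μ := P) p)
    have h2 := integral_add (hone g hgm hg1) (hone h hhm hh1)
    simp only [Pi.add_apply] at h1
    rw [h1, h2, hprob]; simp
  have hQi : Integrable (fun ω => 1 - 1 / (2 * lam) * q ω) P :=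
    (integrable_const 1).sub (hqi.const_mul _)
  have hK : ∫ ω, (g (W ω) + h (W ω) - p) * (1 - 1 / (2 * lam) * q ω) ∂P =
      ∫ ω, (g (W ω) + h (W ω) - p) ∂P
        - 1 / (2 * lam) * ∫ ω, (g (W ω) + h (W ω) - p) * q ω ∂P := by
    rw [← integral_const_mul, ← integral_sub (hone _ hkm hk1)
      ((sz_bi _ 1 hkm hk1 W q hWa hqi).const_mul _)]
    congr 1; funext ω; ring
  have hgen : ∀ (ψ : ℝ → ℝ) (X : Ω → ℝ), (∀ w, |ψ w| ≤ 1) → Integrable X P →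
      |∫ ω, ψ (W ω) * X ω ∂P| ≤ ∫ ω, |X ω| ∂P := by
    intro ψ X hψ hX
    rw [← Real.norm_eq_abs]
    refine norm_integral_le_of_norm_le hX.abs (Filter.Eventually.of_forall fun ω => ?_)
    rw [norm_mul, Real.norm_eq_abs, Real.norm_eq_abs]
    nlinarith [hψ (W ω), abs_nonneg (X ω)]
  have hb1 := hgen _ _ hk1 hQi
  have hb2 := hgen _ _ hf1 hR
  have hfin : (P {ω | W ω ≤ z}).toReal - p =
      ∫ ω, (g (W ω) + h (W ω) - p) * (1 - 1 / (2 * lam) * q ω) ∂P + I / (2 * lam)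
        + ∫ ω, f (W ω) * R ω ∂P := by
    rw [hK, hk, hI1, e1]
    field_simp
    ring
  have hb3 : |I / (2 * lam)| ≤ a * ((∫ ω, |W ω| ∂P) + ∫ ω, |R ω| ∂P) := by
    rw [abs_div, abs_of_pos (by positivity : 0 < 2 * lam), div_le_iff₀ (by positivity)]
    have : |I| ≤ a * J := abs_le.2 ⟨hIl, hIu⟩
    have h2 := mul_le_mul_of_nonneg_left hJ2 ha.le
    linarith
  rw [hfin]
  refine (abs_add_le _ _).trans (add_le_add ((abs_add_le _ _).trans (add_le_add hb1 hb3)) hb2)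

/-- Corollary of the Shao–Zhang bound: if in addition `|Δ| ≤ a` a.s. for a constant `a > 0`,
then `sup_z |P(W ≤ z) - Φ(z)| ≤ E|1 - (1/(2λ)) E(Δ²|W)| + (E|W| + 1) a + E|R|`. -/
theorem shao_zhang_corollary {Ω : Type*} [MeasurableSpace Ω]
    (P : Measure Ω) [IsProbabilityMeasure P]
    (W W' R : Ω → ℝ)
    (hW : Integrable W P) (hW' : Integrable W' P) (hR : Integrable R P)
    (hexch : Measure.map (fun ω => (W ω, W' ω)) P = Measure.map (fun ω => (W' ω, W ω)) P)
    (lam : ℝ) (hlam₀ : 0 < lam) (hlam₁ : lam < 1)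
    (hcond : P[fun ω => W ω - W' ω | MeasurableSpace.comap W Real.measurableSpace]
      =ᵐ[P] fun ω => lam * (W ω + R ω))
    (a : ℝ) (ha : 0 < a) (hΔ : ∀ᵐ ω ∂P, |W ω - W' ω| ≤ a) :
    ∀ z : ℝ,
      |(P {ω | W ω ≤ z}).toReal -
          ((ProbabilityTheory.gaussianReal 0 1) (Set.Iic z)).toReal| ≤
        (∫ ω, |1 - 1 / (2 * lam) *
            (P[fun ω => (W ω - W' ω) ^ 2 |
              MeasurableSpace.comap W Real.measurableSpace]) ω| ∂P)
        + ((∫ ω, |W ω| ∂P) + 1) * a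
        + ∫ ω, |R ω| ∂P := by
  intro z
  have hab : |(P {ω | W ω ≤ z}).toReal -
          ((ProbabilityTheory.gaussianReal 0 1) (Set.Iic z)).toReal| ≤ 1 := by
    have h1 : (P {ω | W ω ≤ z}).toReal ≤ 1 := measureReal_le_one
    have h2 : ((ProbabilityTheory.gaussianReal 0 1) (Set.Iic z)).toReal ≤ 1 := measureReal_le_one
    have h3 : 0 ≤ (P {ω | W ω ≤ z}).toReal := ENNReal.toReal_nonneg
    have h4 : 0 ≤ ((ProbabilityTheory.gaussianReal 0 1) (Set.Iic z)).toReal :=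
      ENNReal.toReal_nonneg
    rw [abs_le]; constructor <;> linarith
  have hA : 0 ≤ ∫ ω, |W ω| ∂P := integral_nonneg fun _ => abs_nonneg _
  have hB : 0 ≤ ∫ ω, |R ω| ∂P := integral_nonneg fun _ => abs_nonneg _
  have hAa : 0 ≤ ((∫ ω, |W ω| ∂P) + 1) * a := by positivity
  by_cases hm : Measurable W
  · by_cases hR1 : ∫ ω, |R ω| ∂P ≤ 1
    · have := sz_main P W W' R hm hW hW' hR hexch lam hlam₀ hcond a ha hΔ z
      nlinarith
    · have : 0 ≤ (∫ ω, |1 - 1 / (2 * lam) *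
            (P[fun ω => (W ω - W' ω) ^ 2 |
              MeasurableSpace.comap W Real.measurableSpace]) ω| ∂P) :=
        integral_nonneg fun _ => abs_nonneg _
      linarith
  · have hle : ¬ (MeasurableSpace.comap W Real.measurableSpace ≤ ‹MeasurableSpace Ω›) :=
      fun h => hm (measurable_iff_comap_le.2 h)
    rw [condExp_of_not_le hle]
    simp only [Pi.zero_apply, mul_zero, sub_zero, abs_one, integral_const, probReal_univ,
      smul_eq_mul, mul_one]
    linarith

end
end
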